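/- Let N = 2 and α ≥ 0. Let β > 0 be such that the first positive zero of the Bessel function J_β equals the second positive zero of J_0, i.e. z_1(β) = z_2(0), and assume that (2+α)β/2 is not an integer. Then there exists p̄ > 1 such that for every p ∈ (1, p̄), every radial classical solution of the Hénon problem with exponent p having exactly two nodal zones has Morse index equal to 2⌈(2+α)β/2⌉, where ⌈s⌉ denotes the least integer ≥ s. -/

import Mathlib

open Real MeasureTheory Metric Filter Topology

noncomputable section

/-- The Euclidean plane. -/
abbrev E2 := EuclideanSpace ℝ (Fin 2)

/-- The Laplacian of `u : ℝ² → ℝ`. -/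
def lap (u : E2 → ℝ) (x : E2) : ℝ :=
  ∑ i : Fin 2, fderiv ℝ (fun y => fderiv ℝ u y (EuclideanSpace.single i 1)) x
    (EuclideanSpace.single i 1)

/-- A classical solution of the planar Hénon problem with parameter `α` and exponent `p`. -/
def IsHenonSol (α p : ℝ) (u : E2 → ℝ) : Prop :=
  ContDiffOn ℝ 2 u (ball 0 1) ∧ ContinuousOn u (closedBall 0 1) ∧
  (∀ x ∈ ball (0 : E2) 1, -lap u x = ‖x‖ ^ α * |u x| ^ (p - 1) * u x) ∧
  (∀ x : E2, ‖x‖ = 1 → u x = 0)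

/-- A radial classical solution with exactly `m` nodal zones. -/
def IsRadialNodalSol (α p : ℝ) (m : ℕ) (u : E2 → ℝ) : Prop :=
  IsHenonSol α p u ∧
  ∃ f : ℝ → ℝ, ContinuousOn f (Set.Icc 0 1) ∧
    (∀ x ∈ closedBall (0 : E2) 1, u x = f ‖x‖) ∧ f 0 ≠ 0 ∧
    {s : ℝ | s ∈ Set.Ioc (0 : ℝ) 1 ∧ f s = 0}.encard = (m : ℕ∞)

/-- The quadratic form associated with the linearization of the Hénon problem at `u`. -/
def quadForm (α p : ℝ) (u ψ : E2 → ℝ) : ℝ :=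
  (∫ x in ball (0 : E2) 1, ‖fderiv ℝ ψ x‖ ^ 2) -
    p * ∫ x in ball (0 : E2) 1, ‖x‖ ^ α * |u x| ^ (p - 1) * ψ x ^ 2

/-- The set of dimensions of subspaces of smooth functions compactly supported in `B` on
which the quadratic form is negative definite. -/
def morseSet (α p : ℝ) (u : E2 → ℝ) : Set ℕ :=
  {d | ∃ V : Submodule ℝ (E2 → ℝ), Module.finrank ℝ V = d ∧
    (∀ ψ ∈ V, ContDiff ℝ (⊤ : ℕ∞) ψ ∧ HasCompactSupport ψ ∧ tsupport ψ ⊆ ball 0 1) ∧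
    (∀ ψ ∈ V, ψ ≠ 0 → quadForm α p u ψ < 0)}

/-- The Bessel function of the first kind of order `β`. -/
def besselJ (β r : ℝ) : ℝ :=
  r ^ β * ∑' k : ℕ,
    ((-1 : ℝ) ^ k / (Nat.factorial k * Real.Gamma ((k : ℝ) + 1 + β))) * (r / 2) ^ (2 * k)

/-- `z` is the `i`-th positive zero of `J_β`. -/
def IsNthZero (β : ℝ) (i : ℕ) (z : ℝ) : Prop :=
  0 < z ∧ besselJ β z = 0 ∧ {r ∈ Set.Ioo 0 z | besselJ β r = 0}.encard = ((i - 1 : ℕ) : ℕ∞)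

/-- The coefficients of the entire function `G_β` with `J_β(r) = r ^ β * G_β((r / 2) ^ 2)`. -/
def besselCoeff (β : ℝ) (k : ℕ) : ℝ :=
  (-1 : ℝ) ^ k / (Nat.factorial k * Real.Gamma ((k : ℝ) + 1 + β))

/-- The entire function `G_β` with `J_β(r) = r ^ β * G_β((r / 2) ^ 2)`. -/
def besselG (β y : ℝ) : ℝ := ∑' k : ℕ, besselCoeff β k * y ^ k

lemma besselJ_eq (β r : ℝ) : besselJ β r = r ^ β * besselG β ((r / 2) ^ 2) := by
  simp only [besselJ, besselG, besselCoeff, pow_mul]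

lemma Gamma_one_add_le {β : ℝ} (hβ : 0 ≤ β) (k : ℕ) :
    Real.Gamma (1 + β) ≤ Real.Gamma ((k : ℝ) + 1 + β) := by
  induction k with
  | zero => simp
  | succ k ih =>
    have h : Real.Gamma (((k + 1 : ℕ) : ℝ) + 1 + β)
        = ((k : ℝ) + 1 + β) * Real.Gamma ((k : ℝ) + 1 + β) := by
      rw [← Real.Gamma_add_one (by positivity)]
      push_cast
      ring_nf
    rw [h]
    have h1 : 0 < Real.Gamma ((k : ℝ) + 1 + β) := Real.Gamma_pos_of_pos (by positivity)
    have h2 : (0 : ℝ) ≤ k := by positivity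
    nlinarith

lemma abs_besselCoeff_le {β : ℝ} (hβ : 0 ≤ β) (k : ℕ) :
    |besselCoeff β k| ≤ (Real.Gamma (1 + β))⁻¹ * (Nat.factorial k : ℝ)⁻¹ := by
  have h0 : 0 < Real.Gamma (1 + β) := Real.Gamma_pos_of_pos (by positivity)
  have h1 : 0 < Real.Gamma ((k : ℝ) + 1 + β) := Real.Gamma_pos_of_pos (by positivity)
  have h2 : (0 : ℝ) < Nat.factorial k := by positivity
  rw [besselCoeff, abs_div, abs_pow, abs_neg, abs_one, one_pow, abs_of_pos (by positivity),
    one_div, mul_inv, mul_comm]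
  gcongr
  exact Gamma_one_add_le hβ k

lemma summable_besselG {β : ℝ} (hβ : 0 ≤ β) (y : ℝ) :
    Summable fun k : ℕ => besselCoeff β k * y ^ k := by
  have h := (Real.summable_pow_div_factorial |y|).mul_left (Real.Gamma (1 + β))⁻¹
  refine Summable.of_norm_bounded h fun k => ?_
  rw [Real.norm_eq_abs, abs_mul, abs_pow]
  calc |besselCoeff β k| * |y| ^ k
      ≤ ((Real.Gamma (1 + β))⁻¹ * (Nat.factorial k : ℝ)⁻¹) * |y| ^ k := by
        gcongr; exact abs_besselCoeff_le hβ k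
    _ = _ := by rw [div_eq_mul_inv]; ring

lemma besselCoeff_succ {β : ℝ} (k : ℕ) :
    besselCoeff β (k + 1) * (k + 1 : ℕ) = -besselCoeff (β + 1) k := by
  rw [besselCoeff, besselCoeff, Nat.factorial_succ]
  have h2 : (0 : ℝ) < Nat.factorial k := by positivity
  have h3 : ((k + 1 : ℕ) : ℝ) + 1 + β = (k : ℝ) + 1 + (β + 1) := by push_cast; ring
  rw [h3]
  have h4 : ((k + 1 : ℕ) : ℝ) ≠ 0 := by positivity
  rw [Nat.cast_mul, pow_succ, mul_assoc ((k + 1 : ℕ) : ℝ), mul_comm ((k + 1 : ℕ) : ℝ),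
    div_mul_eq_mul_div, mul_div_mul_right _ _ h4]
  ring

lemma hasDerivAt_besselG {β : ℝ} (hβ : 0 ≤ β) (y : ℝ) :
    HasDerivAt (besselG β) (-besselG (β + 1) y) y := by
  set R := |y| + 1 with hR
  have hR0 : 0 ≤ R := by positivity
  set u : ℕ → ℝ := fun k => (Real.Gamma (1 + β))⁻¹ * (Nat.factorial k : ℝ)⁻¹ *
    (k * R ^ (k - 1)) with hu
  have hus : Summable u := by
    rw [← summable_nat_add_iff 1]
    refine ((Real.summable_pow_div_factorial R).mul_left (Real.Gamma (1 + β))⁻¹).congr ?_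
    intro k
    simp only [hu, Nat.factorial_succ, Nat.add_sub_cancel]
    push_cast
    field_simp
  have key : HasDerivAt (fun z => ∑' k : ℕ, besselCoeff β k * z ^ k)
      (∑' k : ℕ, besselCoeff β k * (k * y ^ (k - 1))) y := by
    have hder : ∀ (k : ℕ) (z : ℝ), z ∈ Metric.ball (0 : ℝ) R →
        HasDerivAt (fun z => besselCoeff β k * z ^ k) (besselCoeff β k * (k * z ^ (k - 1))) z :=
      fun k z _ => (hasDerivAt_pow k z).const_mul _
    have hpre : IsPreconnected (Metric.ball (0 : ℝ) R) := (convex_ball 0 R).isPreconnected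
    have h0 : (0 : ℝ) ∈ Metric.ball (0 : ℝ) R := by
      rw [mem_ball_zero_iff, norm_zero]; positivity
    have hy : y ∈ Metric.ball (0 : ℝ) R := by
      rw [mem_ball_zero_iff, Real.norm_eq_abs]; linarith
    refine hasDerivAt_tsum_of_isPreconnected hus isOpen_ball hpre hder ?_ h0
      (summable_besselG hβ 0) hy
    intro k z hz
    rw [mem_ball_zero_iff, Real.norm_eq_abs] at hz
    rw [norm_mul, norm_mul, norm_pow, Real.norm_eq_abs, Real.norm_eq_abs z, Real.norm_natCast]
    simp only [hu]
    gcongr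
    exact abs_besselCoeff_le hβ k
  convert! key using 1
  have hs : Summable fun k : ℕ => besselCoeff β k * (k * y ^ (k - 1)) := by
    refine Summable.of_norm_bounded hus fun k => ?_
    rw [norm_mul, norm_mul, norm_pow, Real.norm_eq_abs, Real.norm_eq_abs y, Real.norm_natCast]
    simp only [hu]
    gcongr
    · exact abs_besselCoeff_le hβ k
    · simp [hR]
  rw [hs.tsum_eq_zero_add, besselG, ← tsum_neg]
  simp only [Nat.cast_zero, zero_mul, mul_zero, zero_add]
  refine tsum_congr fun k => ?_
  rw [Nat.add_sub_cancel, ← neg_mul, ← besselCoeff_succ]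
  ring

lemma besselG_recurrence {β : ℝ} (hβ : 0 ≤ β) (y : ℝ) :
    besselG β y = (β + 1) * besselG (β + 1) y - y * besselG (β + 2) y := by
  have e1 : besselG β y - (β + 1) * besselG (β + 1) y
      = ∑' k : ℕ, besselCoeff (β + 1) k * k * y ^ k := by
    rw [besselG, besselG, ← tsum_mul_left,
      ← (summable_besselG hβ y).tsum_sub ((summable_besselG (by positivity) y).mul_left _)]
    refine tsum_congr fun k => ?_
    have h1 : 0 < Real.Gamma ((k : ℝ) + 1 + β) := Real.Gamma_pos_of_pos (by positivity)
    have h2 : (0 : ℝ) < Nat.factorial k := by positivity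
    have h3 : Real.Gamma ((k : ℝ) + 1 + (β + 1))
        = ((k : ℝ) + 1 + β) * Real.Gamma ((k : ℝ) + 1 + β) := by
      rw [← Real.Gamma_add_one (by positivity)]; ring_nf
    have h4 : (k : ℝ) + 1 + β ≠ 0 := by positivity
    have : besselCoeff β k = ((k : ℝ) + 1 + β) * besselCoeff (β + 1) k := by
      rw [besselCoeff, besselCoeff, h3]
      field_simp
    rw [this]; ring
  have hs : Summable fun k : ℕ => besselCoeff (β + 1) k * k * y ^ k := by
    refine ((summable_besselG hβ y).sub
      ((summable_besselG (β := β + 1) (by positivity) y).mul_left (β + 1))).congr fun k => ?_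
    have h1 : 0 < Real.Gamma ((k : ℝ) + 1 + β) := Real.Gamma_pos_of_pos (by positivity)
    have h2 : (0 : ℝ) < Nat.factorial k := by positivity
    have h3 : Real.Gamma ((k : ℝ) + 1 + (β + 1))
        = ((k : ℝ) + 1 + β) * Real.Gamma ((k : ℝ) + 1 + β) := by
      rw [← Real.Gamma_add_one (by positivity)]; ring_nf
    have h4 : (k : ℝ) + 1 + β ≠ 0 := by positivity
    have : besselCoeff β k = ((k : ℝ) + 1 + β) * besselCoeff (β + 1) k := by
      rw [besselCoeff, besselCoeff, h3]
      field_simp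
    rw [this]; ring
  have e2 : ∑' k : ℕ, besselCoeff (β + 1) k * k * y ^ k = -(y * besselG (β + 2) y) := by
    rw [hs.tsum_eq_zero_add, besselG, ← tsum_mul_left, ← tsum_neg]
    simp only [Nat.cast_zero, zero_mul, mul_zero, zero_add]
    refine tsum_congr fun k => ?_
    rw [besselCoeff_succ, pow_succ, show β + 1 + 1 = β + 2 by ring]
    ring
  linarith

lemma besselG_zero_pos {β : ℝ} (hβ : 0 ≤ β) : 0 < besselG β 0 := by
  have : besselG β 0 = besselCoeff β 0 := by
    rw [besselG, tsum_eq_single 0]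
    · simp
    · intro k hk; simp [hk]
  rw [this, besselCoeff]
  have h1 : 0 < Real.Gamma (((0 : ℕ) : ℝ) + 1 + β) := Real.Gamma_pos_of_pos (by positivity)
  simp only [pow_zero, Nat.factorial_zero, Nat.cast_one, one_mul]
  positivity

lemma continuous_besselG {β : ℝ} (hβ : 0 ≤ β) : Continuous (besselG β) :=
  continuous_iff_continuousAt.2 fun y => (hasDerivAt_besselG hβ y).continuousAt

/-- The function `r ↦ r J_β'(r)`. -/
def besselD (β r : ℝ) : ℝ :=
  r ^ β * (β * besselG β ((r / 2) ^ 2) - r ^ 2 / 2 * besselG (β + 1) ((r / 2) ^ 2))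

/-- The pair `h`, `k = r h'` solves the Euler-type equation `(r ∂_r)² h = -P h` on `s`. -/
def EulerPair (h k P : ℝ → ℝ) (s : Set ℝ) : Prop :=
  ∀ r ∈ s, HasDerivAt h (k r / r) r ∧ HasDerivAt k (-(P r * h r) / r) r

lemma eulerPair_bessel {β : ℝ} (hβ : 0 ≤ β) :
    EulerPair (besselJ β) (besselD β) (fun r => r ^ 2 - β ^ 2) (Set.Ioi 0) := by
  intro r hr
  have hr' : (0 : ℝ) < r := hr
  have hsq : HasDerivAt (fun r : ℝ => (r / 2) ^ 2) (r / 2) r := by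
    have := ((hasDerivAt_id r).div_const 2).pow 2
    convert! this using 1
    simp; ring
  have hp : HasDerivAt (fun r : ℝ => r ^ β) (β * r ^ (β - 1)) r :=
    Real.hasDerivAt_rpow_const (Or.inl hr'.ne')
  have hp' : r ^ (β - 1) = r ^ β / r := Real.rpow_sub_one hr'.ne' β
  have hG : HasDerivAt (fun r : ℝ => besselG β ((r / 2) ^ 2))
      (-besselG (β + 1) ((r / 2) ^ 2) * (r / 2)) r :=
    (hasDerivAt_besselG hβ _).comp r hsq
  have hG1 : HasDerivAt (fun r : ℝ => besselG (β + 1) ((r / 2) ^ 2))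
      (-besselG (β + 1 + 1) ((r / 2) ^ 2) * (r / 2)) r :=
    (hasDerivAt_besselG (by positivity) _).comp r hsq
  have hrec := besselG_recurrence hβ ((r / 2) ^ 2)
  constructor
  · have h := hp.mul hG
    have e : besselJ β = fun r => r ^ β * besselG β ((r / 2) ^ 2) := funext (besselJ_eq β)
    rw [e]
    convert! h using 1
    rw [besselD, hp']
    field_simp
    ring
  · have hr2 : HasDerivAt (fun r : ℝ => r ^ 2 / 2) r r := by
      have := ((hasDerivAt_pow 2 r).div_const 2)
      convert! this using 1
      simp
    have h := hp.mul ((hG.const_mul β).sub (hr2.mul hG1))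
    convert! h using 1
    simp only [Pi.sub_apply, Pi.mul_apply]
    rw [besselJ_eq, hrec, hp', show β + 1 + 1 = β + 2 by ring]
    field_simp
    ring

lemma besselJ_zero_zero : 0 < besselJ 0 0 := by
  rw [besselJ_eq]; simpa using besselG_zero_pos le_rfl

lemma continuous_besselJ {β : ℝ} (hβ : 0 ≤ β) : Continuous (besselJ β) := by
  have e : besselJ β = fun r => r ^ β * besselG β ((r / 2) ^ 2) := funext (besselJ_eq β)
  rw [e]
  exact (Real.continuous_rpow_const hβ).mul ((continuous_besselG hβ).comp (by fun_prop))

lemma continuous_besselD {β : ℝ} (hβ : 0 ≤ β) : Continuous (besselD β) := by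
  have h0 := continuous_besselG hβ
  have h1 := continuous_besselG (β := β + 1) (by positivity)
  unfold besselD
  exact (Real.continuous_rpow_const hβ).mul (by fun_prop)

lemma EulerPair.comp_rpow {h k P : ℝ → ℝ} {s s' : Set ℝ} {c κ : ℝ} (H : EulerPair h k P s)
    (hc : 0 < c) (hs : ∀ r ∈ s', 0 < r ∧ c * r ^ κ ∈ s) :
    EulerPair (fun r => h (c * r ^ κ)) (fun r => κ * k (c * r ^ κ))
      (fun r => κ ^ 2 * P (c * r ^ κ)) s' := by
  intro r hr
  obtain ⟨hr0, hrs⟩ := hs r hr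
  obtain ⟨h1, h2⟩ := H _ hrs
  have ht : HasDerivAt (fun r : ℝ => c * r ^ κ) (c * (κ * r ^ (κ - 1))) r :=
    (Real.hasDerivAt_rpow_const (Or.inl hr0.ne')).const_mul c
  have hrk : r ^ (κ - 1) = r ^ κ / r := Real.rpow_sub_one hr0.ne' κ
  have hpos : 0 < r ^ κ := Real.rpow_pos_of_pos hr0 κ
  constructor
  · have := h1.comp r ht
    convert! this using 1
    rw [hrk]; field_simp
  · have := (h2.comp r ht).const_mul κ
    convert! this using 1
    rw [hrk]; field_simp

lemma EulerPair.mono {h k P : ℝ → ℝ} {s s' : Set ℝ} (H : EulerPair h k P s) (hs : s' ⊆ s) :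
    EulerPair h k P s' := fun r hr => H r (hs hr)

lemma pos_of_ne_zero_of_preconnected {f : ℝ → ℝ} {s : Set ℝ} (hs : IsPreconnected s)
    (hf : ContinuousOn f s) (hne : ∀ x ∈ s, f x ≠ 0) {x₀ : ℝ} (hx₀ : x₀ ∈ s) (hpos : 0 < f x₀) :
    ∀ x ∈ s, 0 < f x := by
  intro x hx
  by_contra hcon
  have h := hs.intermediate_value hx hx₀ hf
  obtain ⟨y, hy, hy0⟩ := h ⟨not_lt.1 hcon, hpos.le⟩
  exact hne y hy hy0

lemma eventually_neg_right_of_hasDerivAt {f : ℝ → ℝ} {f' x : ℝ} (hf : HasDerivAt f f' x)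
    (hx : f x = 0) (hf' : f' < 0) : ∀ᶠ y in 𝓝[>] x, f y < 0 := by
  have h1 := hasDerivAt_iff_tendsto_slope.1 hf
  have h2 : ∀ᶠ y in 𝓝[≠] x, slope f x y < 0 := h1.eventually (gt_mem_nhds hf')
  filter_upwards [h2.filter_mono (nhdsWithin_mono x fun y hy => ne_of_gt hy),
    self_mem_nhdsWithin] with y hy hxy
  have hxy' : 0 < y - x := sub_pos.2 hxy
  rw [slope_def_field, hx, sub_zero] at hy
  by_contra hcon
  exact absurd hy (not_lt.2 (div_nonneg (not_lt.1 hcon) hxy'.le))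

lemma eventually_neg_left_of_hasDerivAt {f : ℝ → ℝ} {f' x : ℝ} (hf : HasDerivAt f f' x)
    (hx : f x = 0) (hf' : 0 < f') : ∀ᶠ y in 𝓝[<] x, f y < 0 := by
  have h1 := hasDerivAt_iff_tendsto_slope.1 hf
  have h2 : ∀ᶠ y in 𝓝[≠] x, 0 < slope f x y := h1.eventually (lt_mem_nhds hf')
  filter_upwards [h2.filter_mono (nhdsWithin_mono x fun y hy => ne_of_lt hy),
    self_mem_nhdsWithin] with y hy hxy
  have hxy' : y - x < 0 := sub_neg.2 hxy
  rw [slope_def_field, hx, sub_zero] at hy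
  by_contra hcon
  exact absurd hy (not_lt.2 (div_nonpos_of_nonneg_of_nonpos (not_lt.1 hcon) hxy'.le))

lemma besselD_zero_ne_zero {t : ℝ} (ht : 0 < t) (hJ : besselJ 0 t = 0) : besselD 0 t ≠ 0 := by
  intro hD
  set E : ℝ → ℝ := fun t => t ^ 2 * besselJ 0 t ^ 2 + besselD 0 t ^ 2 with hE
  have hder : ∀ s : ℝ, 0 < s → HasDerivAt E (2 * s * besselJ 0 s ^ 2) s := by
    intro s hs
    obtain ⟨h1, h2⟩ := eulerPair_bessel le_rfl s hs
    have := ((hasDerivAt_pow 2 s).mul (h1.pow 2)).add (h2.pow 2)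
    convert! this using 1
    simp only [Pi.pow_apply]
    field_simp
    ring
  have hcont : Continuous E := by
    have h1 := continuous_besselJ (β := 0) le_rfl
    have h2 := continuous_besselD (β := 0) le_rfl
    fun_prop
  have hmono : MonotoneOn E (Set.Icc 0 t) := by
    refine monotoneOn_of_deriv_nonneg (convex_Icc 0 t) hcont.continuousOn ?_ ?_
    · intro s hs
      rw [interior_Icc] at hs
      exact (hder s hs.1).differentiableAt.differentiableWithinAt
    · intro s hs
      rw [interior_Icc] at hs
      rw [(hder s hs.1).deriv]
      have := hs.1
      positivity
  have hEt : E t = 0 := by simp [hE, hJ, hD]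
  have hzero : ∀ s ∈ Set.Ioo 0 t, besselJ 0 s = 0 := by
    intro s hs
    have h := hmono ⟨hs.1.le, hs.2.le⟩ ⟨ht.le, le_rfl⟩ hs.2.le
    rw [hEt] at h
    have h1 : 0 ≤ besselD 0 s ^ 2 := sq_nonneg _
    have h2 : 0 < s ^ 2 := pow_pos hs.1 2
    have h3 : 0 ≤ besselJ 0 s ^ 2 := sq_nonneg _
    simp only [hE] at h
    have : besselJ 0 s ^ 2 = 0 := by nlinarith
    exact pow_eq_zero_iff (two_ne_zero) |>.1 this
  have hev : ∀ᶠ s in 𝓝[>] (0 : ℝ), 0 < besselJ 0 s :=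
    ((continuous_besselJ le_rfl).continuousAt.eventually
      (lt_mem_nhds besselJ_zero_zero)).filter_mono
      nhdsWithin_le_nhds
  have hev2 : ∀ᶠ s in 𝓝[>] (0 : ℝ), s ∈ Set.Ioo 0 t := Ioo_mem_nhdsGT ht
  obtain ⟨s, hs1, hs2⟩ := (hev.and hev2).exists
  exact hs1.ne' (hzero s hs2)

lemma besselJ_pos_of_isNthZero_one {β z : ℝ} (hβ : 0 ≤ β) (hz : IsNthZero β 1 z) :
    ∀ r ∈ Set.Ioo 0 z, 0 < besselJ β r := by
  obtain ⟨hz0, -, hcard⟩ := hz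
  have hne : ∀ r ∈ Set.Ioo 0 z, besselJ β r ≠ 0 := by
    intro r hr h0
    simp only [Nat.sub_self, Nat.cast_zero, Set.encard_eq_zero] at hcard
    have : r ∈ {r ∈ Set.Ioo 0 z | besselJ β r = 0} := ⟨hr, h0⟩
    rw [hcard] at this
    exact this
  have hev : ∀ᶠ s in 𝓝[>] (0 : ℝ), 0 < besselJ β s := by
    have hc : ContinuousAt (fun r : ℝ => besselG β ((r / 2) ^ 2)) 0 :=
      ((continuous_besselG hβ).comp (by fun_prop)).continuousAt
    have h1 : ∀ᶠ s in 𝓝 (0 : ℝ), 0 < besselG β ((s / 2) ^ 2) :=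
      hc.eventually (lt_mem_nhds (by simpa using besselG_zero_pos hβ))
    filter_upwards [h1.filter_mono nhdsWithin_le_nhds, self_mem_nhdsWithin] with s hs hs0
    rw [besselJ_eq]
    exact mul_pos (Real.rpow_pos_of_pos hs0 β) hs
  have hev2 : ∀ᶠ s in 𝓝[>] (0 : ℝ), s ∈ Set.Ioo 0 z := Ioo_mem_nhdsGT hz0
  obtain ⟨s, hs1, hs2⟩ := (hev.and hev2).exists
  exact pos_of_ne_zero_of_preconnected isPreconnected_Ioo (continuous_besselJ hβ).continuousOn
    hne hs2 hs1

lemma besselJ_zero_sign {z : ℝ} (hz : IsNthZero 0 2 z) :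
    ∃ ρ ∈ Set.Ioo 0 z, (∀ t ∈ Set.Ico 0 ρ, 0 < besselJ 0 t) ∧ besselJ 0 ρ = 0 ∧
      (∀ t ∈ Set.Ioo ρ z, besselJ 0 t < 0) ∧ besselJ 0 z = 0 ∧
      ∃ ε > 0, ∀ t ∈ Set.Ioc z (z + ε), 0 < besselJ 0 t := by
  obtain ⟨hz0, hJz, hcard⟩ := hz
  have hcJ := continuous_besselJ (β := 0) le_rfl
  obtain ⟨ρ, hρ⟩ := Set.encard_eq_one.1 (hcard.trans (by norm_num))
  have hρm : ρ ∈ {r ∈ Set.Ioo 0 z | besselJ 0 r = 0} := by rw [hρ]; rfl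
  obtain ⟨hρI, hρ0⟩ := hρm
  have huniq : ∀ t ∈ Set.Ioo 0 z, besselJ 0 t = 0 → t = ρ := by
    intro t ht h0
    have : t ∈ {r ∈ Set.Ioo 0 z | besselJ 0 r = 0} := ⟨ht, h0⟩
    rwa [hρ] at this
  have hpos : ∀ t ∈ Set.Ico 0 ρ, 0 < besselJ 0 t := by
    refine pos_of_ne_zero_of_preconnected isPreconnected_Ico hcJ.continuousOn ?_
      (x₀ := 0) ⟨le_rfl, hρI.1⟩ besselJ_zero_zero
    intro t ht h0
    rcases ht.1.eq_or_lt with h | h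
    · rw [← h] at h0; exact besselJ_zero_zero.ne' h0
    · exact ht.2.ne (huniq t ⟨h, ht.2.trans hρI.2⟩ h0)
  have hdρ : besselD 0 ρ / ρ < 0 := by
    have hne : besselD 0 ρ / ρ ≠ 0 := div_ne_zero (besselD_zero_ne_zero hρI.1 hρ0) hρI.1.ne'
    refine lt_of_le_of_ne (not_lt.1 fun hcon => ?_) hne
    have h1 := eventually_neg_left_of_hasDerivAt (eulerPair_bessel le_rfl ρ hρI.1).1 hρ0 hcon
    have h2 : ∀ᶠ s in 𝓝[<] ρ, s ∈ Set.Ioo 0 ρ := Ioo_mem_nhdsLT hρI.1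
    obtain ⟨s, hs1, hs2⟩ := (h1.and h2).exists
    exact absurd (hpos s ⟨hs2.1.le, hs2.2⟩) (not_lt.2 hs1.le)
  have hneg : ∀ t ∈ Set.Ioo ρ z, besselJ 0 t < 0 := by
    have h1 := eventually_neg_right_of_hasDerivAt (eulerPair_bessel le_rfl ρ hρI.1).1 hρ0 hdρ
    have h2 : ∀ᶠ s in 𝓝[>] ρ, s ∈ Set.Ioo ρ z := Ioo_mem_nhdsGT hρI.2
    obtain ⟨s, hs1, hs2⟩ := (h1.and h2).exists
    have := pos_of_ne_zero_of_preconnected (f := fun t => -besselJ 0 t) isPreconnected_Ioo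
      hcJ.neg.continuousOn
      (fun t (ht : t ∈ Set.Ioo ρ z) h0 => ht.1.ne'
        (huniq t ⟨hρI.1.trans ht.1, ht.2⟩ (neg_eq_zero.1 h0))) hs2 (by simpa using hs1)
    exact fun t ht => neg_pos.1 (this t ht)
  have hdz : 0 < besselD 0 z / z := by
    have hne : besselD 0 z / z ≠ 0 := div_ne_zero (besselD_zero_ne_zero hz0 hJz) hz0.ne'
    refine lt_of_le_of_ne (not_lt.1 fun hcon => ?_) hne.symm
    have h1 := eventually_neg_left_of_hasDerivAt
      (eulerPair_bessel le_rfl z hz0).1.neg (by simpa using hJz) (neg_pos.2 hcon)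
    have h2 : ∀ᶠ s in 𝓝[<] z, s ∈ Set.Ioo ρ z := Ioo_mem_nhdsLT hρI.2
    obtain ⟨s, hs1, hs2⟩ := (h1.and h2).exists
    have := hneg s hs2
    simp only [Pi.neg_apply] at hs1
    linarith
  refine ⟨ρ, hρI, hpos, hρ0, hneg, hJz, ?_⟩
  have h1 := eventually_neg_right_of_hasDerivAt
    (eulerPair_bessel le_rfl z hz0).1.neg (by simpa using hJz) (neg_neg_iff_pos.2 hdz)
  obtain ⟨u, hu, hsub⟩ := mem_nhdsGT_iff_exists_Ioc_subset.1 h1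
  refine ⟨u - z, sub_pos.2 hu, fun t ht => ?_⟩
  have := hsub (by simpa using ht : t ∈ Set.Ioc z u)
  simpa using this

/-- The normalized radial Lane–Emden initial value problem on `[0, c]`, with `d = t w'`. -/
structure LaneEmdenPair (p c : ℝ) (w d : ℝ → ℝ) : Prop where
  one_lt : 1 < p
  pos : 0 < c
  euler : EulerPair w d (fun t => t ^ 2 * |w t| ^ (p - 1)) (Set.Ioo 0 c)
  cont : ContinuousOn w (Set.Icc 0 c)
  init : w 0 = 1
  lim : Tendsto d (𝓝[>] 0) (𝓝 0)

lemma le_of_deriv_nonpos_of_tendsto {f f' : ℝ → ℝ} {a c L : ℝ}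
    (hf : ∀ t ∈ Set.Ioo a c, HasDerivAt f (f' t) t) (hf' : ∀ t ∈ Set.Ioo a c, f' t ≤ 0)
    (hL : Tendsto f (𝓝[>] a) (𝓝 L)) : ∀ t ∈ Set.Ioo a c, f t ≤ L := by
  have hanti : AntitoneOn f (Set.Ioo a c) := by
    refine antitoneOn_of_deriv_nonpos (convex_Ioo a c)
      (fun t ht => (hf t ht).continuousAt.continuousWithinAt) ?_ ?_
    · rw [interior_Ioo]
      exact fun t ht => (hf t ht).differentiableAt.differentiableWithinAt
    · rw [interior_Ioo]
      intro t ht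
      rw [(hf t ht).deriv]
      exact hf' t ht
  intro t ht
  refine ge_of_tendsto hL ?_
  have : ∀ᶠ s in 𝓝[>] a, s ∈ Set.Ioo a t := Ioo_mem_nhdsGT ht.1
  filter_upwards [this] with s hs
  exact hanti ⟨hs.1, hs.2.trans ht.2⟩ ht hs.2.le

lemma abs_rpow_mul_self_sub_le {p x : ℝ} (hp : 1 < p) (hx : |x| ≤ 1) :
    |(|x| ^ (p - 1) * x) - x| ≤ p - 1 := by
  have h1 : |x| ^ (p - 1) * x - x = -((1 - |x| ^ (p - 1)) * x) := by ring
  have h2 : |x| ^ (p - 1) ≤ 1 := Real.rpow_le_one (abs_nonneg x) hx (by linarith)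
  rw [h1, abs_neg, abs_mul, abs_of_nonneg (by linarith)]
  rcases (abs_nonneg x).eq_or_lt with h | h
  · rw [← h]; simp; linarith
  · have h3 : 1 + (p - 1) * Real.log |x| ≤ |x| ^ (p - 1) := by
      rw [Real.rpow_def_of_pos h, add_comm, mul_comm]
      exact Real.add_one_le_exp _
    have h4 : 1 - |x|⁻¹ ≤ Real.log |x| := Real.one_sub_inv_le_log_of_pos h
    have h5 : (1 - |x|⁻¹) * |x| = |x| - 1 := by field_simp
    calc (1 - |x| ^ (p - 1)) * |x| ≤ (-((p - 1) * (1 - |x|⁻¹))) * |x| := by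
          gcongr; nlinarith
      _ = (p - 1) * (1 - |x|) := by linear_combination -(p - 1) * h5
      _ ≤ p - 1 := by nlinarith

namespace LaneEmdenPair

variable {p c : ℝ} {w d : ℝ → ℝ}

lemma abs_le_sq (H : LaneEmdenPair p c w d) :
    ∃ K, ∀ t ∈ Set.Ioo 0 c, |d t| ≤ K * t ^ 2 := by
  obtain ⟨M, hM⟩ := (isCompact_Icc (a := (0 : ℝ)) (b := c)).exists_bound_of_continuousOn H.cont
  have hM0 : 0 ≤ M := (norm_nonneg _).trans (hM 0 ⟨le_rfl, H.pos.le⟩)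
  have hp := H.one_lt
  set K := M ^ (p - 1) * M with hK
  have hbound : ∀ t ∈ Set.Ioo 0 c, |(-(t ^ 2 * |w t| ^ (p - 1) * w t) / t)| ≤ K * t := by
    intro t ht
    have h0 : 0 < t := ht.1
    have hw : |w t| ≤ M := hM t ⟨ht.1.le, ht.2.le⟩
    have e : -(t ^ 2 * |w t| ^ (p - 1) * w t) / t = -(t * (|w t| ^ (p - 1) * w t)) := by
      field_simp
    rw [e, abs_neg, abs_mul, abs_mul, abs_of_pos h0,
      abs_of_nonneg (Real.rpow_nonneg (abs_nonneg _) _), mul_comm]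
    have : |w t| ^ (p - 1) * |w t| ≤ K := by
      rw [hK]
      exact mul_le_mul (Real.rpow_le_rpow (abs_nonneg _) hw (by linarith)) hw (abs_nonneg _)
        (Real.rpow_nonneg hM0 _)
    exact mul_le_mul_of_nonneg_right this h0.le
  have hsq : ∀ t : ℝ, HasDerivAt (fun t : ℝ => K / 2 * t ^ 2) (K * t) t := by
    intro t
    have := (hasDerivAt_pow 2 t).const_mul (K / 2)
    convert! this using 1
    simp; ring
  have hl : Tendsto (fun t : ℝ => K / 2 * t ^ 2) (𝓝[>] 0) (𝓝 0) := by
    have : Continuous fun t : ℝ => K / 2 * t ^ 2 := by fun_prop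
    simpa using (this.tendsto 0).mono_left nhdsWithin_le_nhds
  have h1 := le_of_deriv_nonpos_of_tendsto (f := fun t => d t - K / 2 * t ^ 2) (c := c)
    (fun t ht => (H.euler t ht).2.sub (hsq t))
    (fun t ht => by have := abs_le.1 (hbound t ht); linarith) (H.lim.sub hl)
  have h2 := le_of_deriv_nonpos_of_tendsto (f := fun t => -d t - K / 2 * t ^ 2) (c := c)
    (fun t ht => (H.euler t ht).2.neg.sub (hsq t))
    (fun t ht => by have := abs_le.1 (hbound t ht); linarith) (H.lim.neg.sub hl)
  refine ⟨K / 2, fun t ht => abs_le.2 ⟨?_, ?_⟩⟩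
  · have := h2 t ht; simp only [neg_zero, sub_zero] at this; linarith
  · have := h1 t ht; simp only [sub_zero] at this; linarith

lemma tendsto_deriv (H : LaneEmdenPair p c w d) :
    Tendsto (fun t => d t / t) (𝓝[>] 0) (𝓝 0) := by
  obtain ⟨K, hK⟩ := H.abs_le_sq
  refine squeeze_zero_norm' (a := fun t => K * t) ?_ ?_
  · have : ∀ᶠ s in 𝓝[>] (0 : ℝ), s ∈ Set.Ioo 0 c := Ioo_mem_nhdsGT H.pos
    filter_upwards [this] with t ht
    rw [Real.norm_eq_abs, abs_div, abs_of_pos ht.1, div_le_iff₀ ht.1]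
    calc |d t| ≤ K * t ^ 2 := hK t ht
      _ = K * t * t := by ring
  · have : Continuous fun t : ℝ => K * t := by fun_prop
    simpa using (this.tendsto 0).mono_left nhdsWithin_le_nhds

lemma tendsto_init (H : LaneEmdenPair p c w d) : Tendsto w (𝓝[>] 0) (𝓝 1) := by
  have h := (H.cont 0 ⟨le_rfl, H.pos.le⟩).tendsto
  rw [H.init] at h
  refine h.mono_left ?_
  rw [← nhdsWithin_Ioo_eq_nhdsGT H.pos]
  exact nhdsWithin_mono _ Set.Ioo_subset_Icc_self

lemma hasDerivAt_quotient (H : LaneEmdenPair p c w d) {t : ℝ} (ht : t ∈ Set.Ioo 0 c) :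
    HasDerivAt (fun t => d t / t) (-(|w t| ^ (p - 1) * w t) - (d t / t) / t) t := by
  have h0 : t ≠ 0 := ht.1.ne'
  have := (H.euler t ht).2.div (hasDerivAt_id t) h0
  convert! this using 1
  simp only [id]
  field_simp

lemma abs_le_one (H : LaneEmdenPair p c w d) : ∀ t ∈ Set.Icc 0 c, |w t| ≤ 1 := by
  have hp := H.one_lt
  have key : ∀ t ∈ Set.Ioo 0 c, |w t| ≤ 1 := by
    have hder : ∀ t ∈ Set.Ioo 0 c,
        HasDerivAt (fun t => (d t / t) ^ 2 / 2 + |w t| ^ (p + 1) / (p + 1))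
          (-((d t / t) ^ 2 / t)) t := by
      intro t ht
      have h0 : t ≠ 0 := ht.1.ne'
      have h1 := ((H.hasDerivAt_quotient ht).pow 2).div_const 2
      have h2 := ((hasDerivAt_abs_rpow (w t) (p := p + 1) (by linarith)).comp t
        (H.euler t ht).1).div_const (p + 1)
      convert! h1.add h2 using 1
      rw [show p + 1 - 2 = p - 1 by ring]
      have : p + 1 ≠ 0 := by linarith
      generalize d t / t = q
      field_simp
      push_cast
      ring
    have hlim : Tendsto (fun t => (d t / t) ^ 2 / 2 + |w t| ^ (p + 1) / (p + 1)) (𝓝[>] 0)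
        (𝓝 (0 ^ 2 / 2 + |1| ^ (p + 1) / (p + 1))) := by
      have h1 := (H.tendsto_deriv.pow 2).div_const 2
      have h2 := ((H.tendsto_init.abs.rpow_const (p := p + 1)
        (Or.inr (by linarith))).div_const (p + 1))
      exact h1.add h2
    have := le_of_deriv_nonpos_of_tendsto hder
      (fun t ht => by have := ht.1; have : 0 ≤ (d t / t) ^ 2 / t := by positivity
                      linarith) hlim
    intro t ht
    have h := this t ht
    simp only [abs_one, Real.one_rpow] at h
    have h3 : |w t| ^ (p + 1) / (p + 1) ≤ 1 / (p + 1) := by nlinarith [sq_nonneg (d t / t)]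
    have h4 : |w t| ^ (p + 1) ≤ 1 := by
      rwa [div_le_div_iff_of_pos_right (by linarith)] at h3
    by_contra hcon
    exact absurd h4 (not_le.2 (Real.one_lt_rpow (not_le.1 hcon) (by linarith)))
  have hcl : Set.Icc 0 c ⊆ closure (Set.Ioo 0 c) := by rw [closure_Ioo H.pos.ne]
  intro t ht
  have hcont : ContinuousOn (fun t => |w t|) (closure (Set.Ioo 0 c)) := by
    rw [closure_Ioo H.pos.ne]; exact H.cont.abs
  exact le_on_closure key hcont continuousOn_const (hcl ht)

end LaneEmdenPair

lemma tendsto_besselD_zero_div : Tendsto (fun t => besselD 0 t / t) (𝓝[>] 0) (𝓝 0) := by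
  have hc : Continuous fun t : ℝ => -(t / 2 * besselG (0 + 1) ((t / 2) ^ 2)) := by
    have := continuous_besselG (β := 0 + 1) (by norm_num)
    fun_prop
  have h : Tendsto (fun t : ℝ => -(t / 2 * besselG (0 + 1) ((t / 2) ^ 2))) (𝓝[>] 0) (𝓝 0) := by
    simpa using (hc.tendsto 0).mono_left nhdsWithin_le_nhds
  refine h.congr' ?_
  filter_upwards [self_mem_nhdsWithin] with t ht
  have ht0 : t ≠ 0 := ne_of_gt ht
  rw [besselD, Real.rpow_zero]
  field_simp
  ring

lemma besselJ_zero_apply_zero : besselJ 0 0 = 1 := by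
  rw [besselJ_eq, besselG, tsum_eq_single 0]
  · simp [besselCoeff]
  · intro k hk; simp [hk]

lemma tendsto_besselJ_zero : Tendsto (besselJ 0) (𝓝[>] 0) (𝓝 1) := by
  have := ((continuous_besselJ (β := 0) le_rfl).tendsto 0).mono_left
    (nhdsWithin_le_nhds (s := Set.Ioi 0))
  rwa [besselJ_zero_apply_zero] at this

lemma lt_of_deriv_nonpos_of_exists {f f' : ℝ → ℝ} {a b : ℝ}
    (hf : ∀ t ∈ Set.Icc a b, HasDerivAt f (f' t) t) (hf' : ∀ t ∈ Set.Ioo a b, f' t ≤ 0)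
    {t : ℝ} (ht : t ∈ Set.Ioo a b) (hlt : f' t < 0) : f b < f a := by
  have hanti : AntitoneOn f (Set.Icc a b) := by
    refine antitoneOn_of_deriv_nonpos (convex_Icc a b)
      (fun t ht => (hf t ht).continuousAt.continuousWithinAt) ?_ ?_
    · rw [interior_Icc]
      exact fun t ht => (hf t (Set.Ioo_subset_Icc_self ht)).differentiableAt.differentiableWithinAt
    · rw [interior_Icc]
      intro t ht
      rw [(hf t (Set.Ioo_subset_Icc_self ht)).deriv]
      exact hf' t ht
  have hab : a ≤ b := (ht.1.trans ht.2).le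
  by_contra hcon
  have hconst : ∀ s ∈ Set.Ioo a b, f s = f a := by
    intro s hs
    have hs' := Set.Ioo_subset_Icc_self hs
    have h1 := hanti ⟨le_rfl, hab⟩ hs' hs.1.le
    have h2 := hanti hs' ⟨hab, le_rfl⟩ hs.2.le
    linarith
  have hev : f =ᶠ[𝓝 t] fun _ => f a := by
    filter_upwards [Ioo_mem_nhds ht.1 ht.2] with s hs using hconst s hs
  have h0 := (hf t (Set.Ioo_subset_Icc_self ht)).unique
    ((hasDerivAt_const t (f a)).congr_of_eventuallyEq hev)
  exact hlt.ne h0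

namespace LaneEmdenPair

variable {p c : ℝ} {w d : ℝ → ℝ}

/-- As `p → 1`, the solution is close to the Bessel function `J_0`. -/
lemma sq_sub_besselJ_le (H : LaneEmdenPair p c w d) :
    ∀ t ∈ Set.Ioo 0 c, (w t - besselJ 0 t) ^ 2 ≤ (p - 1) ^ 2 * Real.exp (3 * t) := by
  have hp := H.one_lt
  set δ := p - 1 with hδ
  set q : ℝ → ℝ := fun t => w t - besselJ 0 t with hq
  set v : ℝ → ℝ := fun t => d t / t - besselD 0 t / t with hv
  set f : ℝ → ℝ := fun t => Real.exp (-3 * t) * (q t ^ 2 + v t ^ 2 + δ ^ 2 / 3) with hf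
  set F : ℝ → ℝ := fun t => |w t| ^ (p - 1) * w t with hF
  have hder : ∀ t ∈ Set.Ioo 0 c, HasDerivAt f
      (Real.exp (-3 * t) * (2 * q t * v t + 2 * v t * (-(F t - besselJ 0 t) - v t / t)
        - 3 * (q t ^ 2 + v t ^ 2 + δ ^ 2 / 3))) t := by
    intro t ht
    have h0 : t ≠ 0 := ht.1.ne'
    obtain ⟨hJ1, hJ2⟩ := eulerPair_bessel le_rfl t ht.1
    have hq' : HasDerivAt q (v t) t := (H.euler t ht).1.sub hJ1
    have hJ2' : HasDerivAt (fun t => besselD 0 t / t)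
        (-besselJ 0 t - (besselD 0 t / t) / t) t := by
      have := hJ2.div (hasDerivAt_id t) h0
      convert! this using 1
      simp only [id]
      field_simp
      ring
    have hv' : HasDerivAt v (-(F t - besselJ 0 t) - v t / t) t := by
      have := (H.hasDerivAt_quotient ht).sub hJ2'
      convert! this using 1
      simp only [hv, hF]
      ring
    have he : HasDerivAt (fun t : ℝ => Real.exp (-3 * t)) (Real.exp (-3 * t) * (-3)) t := by
      have := ((hasDerivAt_id t).const_mul (-3)).exp
      simpa using this
    have := he.mul (((hq'.pow 2).add (hv'.pow 2)).add_const (δ ^ 2 / 3))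
    convert! this using 1
    simp
    ring
  have hneg : ∀ t ∈ Set.Ioo 0 c, Real.exp (-3 * t) * (2 * q t * v t
      + 2 * v t * (-(F t - besselJ 0 t) - v t / t) - 3 * (q t ^ 2 + v t ^ 2 + δ ^ 2 / 3)) ≤ 0 := by
    intro t ht
    have hw : |w t| ≤ 1 := H.abs_le_one t ⟨ht.1.le, ht.2.le⟩
    have h1 := abs_rpow_mul_self_sub_le hp hw
    have h2 : 0 ≤ v t ^ 2 / t := div_nonneg (sq_nonneg _) ht.1.le
    have h3 : v t * (v t / t) = v t ^ 2 / t := by ring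
    set e := F t - w t with he
    have h4 : F t - besselJ 0 t = e + q t := by simp only [he, hq]; ring
    have h5 : e ^ 2 ≤ δ ^ 2 := sq_le_sq' (by linarith [(abs_le.1 h1).1]) (abs_le.1 h1).2
    refine mul_nonpos_of_nonneg_of_nonpos (Real.exp_pos _).le ?_
    rw [h4]
    nlinarith [sq_nonneg (e + v t), sq_nonneg (q t)]
  have hlim : Tendsto f (𝓝[>] 0) (𝓝 (δ ^ 2 / 3)) := by
    have h1 : Tendsto q (𝓝[>] 0) (𝓝 (1 - 1)) := H.tendsto_init.sub tendsto_besselJ_zero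
    have h2 : Tendsto v (𝓝[>] 0) (𝓝 (0 - 0)) := H.tendsto_deriv.sub tendsto_besselD_zero_div
    have h3 : Tendsto (fun t : ℝ => Real.exp (-3 * t)) (𝓝[>] 0) (𝓝 (Real.exp (-3 * 0))) := by
      have : Continuous fun t : ℝ => Real.exp (-3 * t) := by fun_prop
      exact (this.tendsto 0).mono_left nhdsWithin_le_nhds
    have := h3.mul (((h1.pow 2).add (h2.pow 2)).add_const (δ ^ 2 / 3))
    convert! this using 2
    simp
  intro t ht
  have h := le_of_deriv_nonpos_of_tendsto hder hneg hlim t ht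
  have h1 : Real.exp (-3 * t) * Real.exp (3 * t) = 1 := by
    rw [← Real.exp_add]; simp
  have h2 : 1 ≤ Real.exp (3 * t) := Real.one_le_exp (by linarith [ht.1])
  have h3 : f t * Real.exp (3 * t) = q t ^ 2 + v t ^ 2 + δ ^ 2 / 3 := by
    simp only [hf]; linear_combination (q t ^ 2 + v t ^ 2 + δ ^ 2 / 3) * h1
  have h4 : f t * Real.exp (3 * t) ≤ δ ^ 2 / 3 * Real.exp (3 * t) := by gcongr
  have h5 : 0 ≤ δ ^ 2 * Real.exp (3 * t) := by positivity
  nlinarith [sq_nonneg (v t), sq_nonneg δ]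

lemma hasDerivAt_wronskian (H : LaneEmdenPair p c w d) {t : ℝ} (ht : t ∈ Set.Ioo 0 c) :
    HasDerivAt (fun t => w t * besselD 0 t - besselJ 0 t * d t)
      (t * (w t * besselJ 0 t) * (|w t| ^ (p - 1) - 1)) t := by
  have h0 : t ≠ 0 := ht.1.ne'
  obtain ⟨hJ1, hJ2⟩ := eulerPair_bessel le_rfl t ht.1
  have := ((H.euler t ht).1.mul hJ2).sub (hJ1.mul (H.euler t ht).2)
  convert! this using 1
  field_simp
  ring

/-- If `w` vanishes at an endpoint of `(a, b)`, it is not of absolute value one on all of it. -/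
lemma exists_rpow_lt_one (H : LaneEmdenPair p c w d) {a b : ℝ} (ha : 0 ≤ a) (hab : a < b)
    (hb : b ≤ c) (hwb : w b = 0) : ∃ t ∈ Set.Ioo a b, |w t| ^ (p - 1) < 1 := by
  have hp := H.one_lt
  have hc := (H.cont b ⟨ha.trans hab.le, hb⟩).tendsto.abs
  rw [hwb, abs_zero] at hc
  have h1 : ∀ᶠ t in 𝓝[Set.Icc 0 c] b, |w t| < 1 := hc.eventually (gt_mem_nhds one_pos)
  have h2 : 𝓝[Set.Ioo a b] b ≤ 𝓝[Set.Icc 0 c] b :=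
    nhdsWithin_mono _ fun t ht => ⟨ha.trans ht.1.le, ht.2.le.trans hb⟩
  rw [nhdsWithin_Ioo_eq_nhdsLT hab] at h2
  have h3 : ∀ᶠ t in 𝓝[<] b, t ∈ Set.Ioo a b := Ioo_mem_nhdsLT hab
  obtain ⟨t, ht1, ht2⟩ := ((h1.filter_mono h2).and h3).exists
  exact ⟨t, ht2, Real.rpow_lt_one (abs_nonneg _) ht1 (by linarith)⟩

/-- Sturm comparison for the first zero. -/
lemma first_zero_le (H : LaneEmdenPair p c w d) {ρ σ : ℝ}
    (hJ : ∀ t ∈ Set.Ico 0 ρ, 0 < besselJ 0 t) (hσ : σ ∈ Set.Ioo 0 c) (hwσ : w σ = 0)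
    (hpos : ∀ t ∈ Set.Ico 0 σ, 0 < w t) : ρ ≤ σ := by
  by_contra hcon
  have hp := H.one_lt
  have hσρ : σ < ρ := not_le.1 hcon
  set W : ℝ → ℝ := fun t => w t * besselD 0 t - besselJ 0 t * d t with hW
  have hle : ∀ t ∈ Set.Ioo 0 c, |w t| ^ (p - 1) ≤ 1 := fun t ht =>
    Real.rpow_le_one (abs_nonneg _) (H.abs_le_one t ⟨ht.1.le, ht.2.le⟩) (by linarith)
  have hd : d σ / σ ≤ 0 := by
    by_contra hd
    have h1 := eventually_neg_left_of_hasDerivAt (H.euler σ hσ).1 hwσ (not_le.1 hd)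
    have h2 : ∀ᶠ s in 𝓝[<] σ, s ∈ Set.Ioo 0 σ := Ioo_mem_nhdsLT hσ.1
    obtain ⟨s, hs1, hs2⟩ := (h1.and h2).exists
    exact absurd (hpos s ⟨hs2.1.le, hs2.2⟩) (not_lt.2 hs1.le)
  have hdσ : d σ ≤ 0 := by
    rw [div_le_iff₀ hσ.1, zero_mul] at hd; exact hd
  have hWσ : 0 ≤ W σ := by
    simp only [hW, hwσ]
    nlinarith [hJ σ ⟨hσ.1.le, hσρ⟩]
  obtain ⟨t₀, ht₀, hlt⟩ := H.exists_rpow_lt_one le_rfl hσ.1 hσ.2.le hwσ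
  have hder : ∀ t ∈ Set.Ioc 0 σ, HasDerivAt W
      (t * (w t * besselJ 0 t) * (|w t| ^ (p - 1) - 1)) t := fun t ht =>
    H.hasDerivAt_wronskian ⟨ht.1, ht.2.trans_lt hσ.2⟩
  have hpos' : ∀ t ∈ Set.Ioo 0 σ, 0 < t * (w t * besselJ 0 t) := fun t ht =>
    mul_pos ht.1 (mul_pos (hpos t ⟨ht.1.le, ht.2⟩) (hJ t ⟨ht.1.le, ht.2.trans hσρ⟩))
  have hder' : ∀ t ∈ Set.Ioo 0 σ, t * (w t * besselJ 0 t) * (|w t| ^ (p - 1) - 1) ≤ 0 := by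
    intro t ht
    have h2 := hle t ⟨ht.1, ht.2.trans hσ.2⟩
    nlinarith [hpos' t ht]
  have hlim : Tendsto W (𝓝[>] 0) (𝓝 0) := by
    have h1 : Tendsto (besselD 0) (𝓝[>] 0) (𝓝 (besselD 0 0)) :=
      ((continuous_besselD (β := 0) le_rfl).tendsto 0).mono_left nhdsWithin_le_nhds
    have h2 : besselD 0 0 = 0 := by simp [besselD]
    rw [h2] at h1
    simpa using (H.tendsto_init.mul h1).sub (tendsto_besselJ_zero.mul H.lim)
  have h1 := le_of_deriv_nonpos_of_tendsto (fun t ht => hder t ⟨ht.1, ht.2.le⟩) hder' hlim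
    (t₀ / 2) ⟨by linarith [ht₀.1], by linarith [ht₀.1, ht₀.2]⟩
  have h2 := lt_of_deriv_nonpos_of_exists (a := t₀ / 2) (b := σ)
    (fun t ht => hder t ⟨by linarith [ht₀.1, ht.1], ht.2⟩)
    (fun t ht => hder' t ⟨by linarith [ht₀.1, ht.1], ht.2⟩)
    (t := t₀) ⟨by linarith [ht₀.1], ht₀.2⟩ (by nlinarith [hpos' t₀ ht₀])
  linarith

/-- Sturm comparison for the second zero. -/
lemma second_zero_le (H : LaneEmdenPair p c w d) {ρ σ z s : ℝ}
    (hJρ : besselJ 0 ρ = 0) (hJ : ∀ t ∈ Set.Ioo ρ z, besselJ 0 t < 0)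
    (hσ : σ ∈ Set.Ioo 0 c) (hρσ : ρ ≤ σ) (hwσ : w σ = 0) (hwc : w c = 0)
    (hpos : ∀ t ∈ Set.Ioo σ c, 0 < s * w t) : z ≤ c := by
  by_contra hcon
  have hp := H.one_lt
  have hcz : c < z := not_le.1 hcon
  set f : ℝ → ℝ := fun t => -s * (w t * besselD 0 t - besselJ 0 t * d t) with hf
  have hle : ∀ t ∈ Set.Ioo 0 c, |w t| ^ (p - 1) ≤ 1 := fun t ht =>
    Real.rpow_le_one (abs_nonneg _) (H.abs_le_one t ⟨ht.1.le, ht.2.le⟩) (by linarith)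
  have hJσ : besselJ 0 σ ≤ 0 := by
    rcases hρσ.eq_or_lt with h | h
    · rw [← h, hJρ]
    · exact (hJ σ ⟨h, hσ.2.trans hcz⟩).le
  have hd : 0 ≤ s * (d σ / σ) := by
    by_contra hd
    have h1 := eventually_neg_right_of_hasDerivAt ((H.euler σ hσ).1.const_mul s)
      (by simp [hwσ]) (not_le.1 hd)
    have h2 : ∀ᶠ s in 𝓝[>] σ, s ∈ Set.Ioo σ c := Ioo_mem_nhdsGT hσ.2
    obtain ⟨r, hr1, hr2⟩ := (h1.and h2).exists
    exact absurd (hpos r hr2) (not_lt.2 hr1.le)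
  have hdσ : 0 ≤ s * d σ := by
    have : s * d σ = s * (d σ / σ) * σ := by have := hσ.1.ne'; field_simp
    rw [this]; exact mul_nonneg hd hσ.1.le
  have hfσ : f σ ≤ 0 := by
    simp only [hf, hwσ]
    nlinarith
  obtain ⟨t₀, ht₀, hlt⟩ := H.exists_rpow_lt_one hσ.1.le hσ.2 le_rfl hwc
  have hder : ∀ t ∈ Set.Ico σ c, HasDerivAt f
      (-s * (t * (w t * besselJ 0 t) * (|w t| ^ (p - 1) - 1))) t := fun t ht =>
    (H.hasDerivAt_wronskian ⟨hσ.1.trans_le ht.1, ht.2⟩).const_mul _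
  have hneg' : ∀ t ∈ Set.Ioo σ c, t * (s * w t * besselJ 0 t) < 0 := fun t ht =>
    mul_neg_of_pos_of_neg (hσ.1.trans ht.1)
      (mul_neg_of_pos_of_neg (hpos t ht) (hJ t ⟨hρσ.trans_lt ht.1, ht.2.trans hcz⟩))
  have hder' : ∀ t ∈ Set.Ioo σ c,
      -s * (t * (w t * besselJ 0 t) * (|w t| ^ (p - 1) - 1)) ≤ 0 := by
    intro t ht
    have h2 := hle t ⟨hσ.1.trans ht.1, ht.2⟩
    nlinarith [hneg' t ht]
  set b₀ := (t₀ + c) / 2 with hb₀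
  have hb₀c : b₀ < c := by linarith [ht₀.2]
  have hσb₀ : σ < b₀ := by linarith [ht₀.1, ht₀.2]
  have h1 : f b₀ < f σ := lt_of_deriv_nonpos_of_exists
    (fun t ht => hder t ⟨ht.1, ht.2.trans_lt hb₀c⟩)
    (fun t ht => hder' t ⟨ht.1, ht.2.trans hb₀c⟩)
    (t := t₀) ⟨ht₀.1, by linarith [ht₀.2]⟩ (by nlinarith [hneg' t₀ ht₀])
  have hwD : Tendsto (fun t => s * (w t * besselD 0 t)) (𝓝[<] c) (𝓝 0) := by
    have h1 := (H.cont c ⟨H.pos.le, le_rfl⟩).tendsto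
    have h2 : 𝓝[Set.Ioo 0 c] c ≤ 𝓝[Set.Icc 0 c] c := nhdsWithin_mono _ Set.Ioo_subset_Icc_self
    rw [nhdsWithin_Ioo_eq_nhdsLT H.pos] at h2
    have h3 : Tendsto (besselD 0) (𝓝[<] c) (𝓝 (besselD 0 c)) :=
      ((continuous_besselD (β := 0) le_rfl).tendsto c).mono_left nhdsWithin_le_nhds
    have := ((h1.mono_left h2).mul h3).const_mul s
    simpa [hwc] using this
  have hev : ∀ᶠ t in 𝓝[<] c, s * (w t * besselD 0 t) < -f b₀ :=
    hwD.eventually (gt_mem_nhds (by linarith))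
  obtain ⟨l, hl, hsub⟩ := mem_nhdsLT_iff_exists_Ioo_subset.1 hev
  set b₁ := max ((l + c) / 2) b₀ with hb₁
  have hb₁c : b₁ < c := max_lt (by linarith [Set.mem_Iio.1 hl]) hb₀c
  have hlb₁ : l < b₁ := lt_of_lt_of_le (by linarith [Set.mem_Iio.1 hl]) (le_max_left _ _)
  have hb₀₁ : b₀ ≤ b₁ := le_max_right _ _
  obtain ⟨t, ht, hslope⟩ := exists_hasDerivAt_eq_slope w (fun t => d t / t) hb₁c
    (H.cont.mono (Set.Icc_subset_Icc (hσ.1.le.trans (hσb₀.le.trans hb₀₁)) le_rfl))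
    (fun t ht => (H.euler t ⟨hσ.1.trans (hσb₀.trans_le (hb₀₁.trans ht.1.le)), ht.2⟩).1)
  have ht0 : 0 < t := hσ.1.trans (hσb₀.trans (hb₀₁.trans_lt ht.1))
  have hsd : s * d t ≤ 0 := by
    have e : d t = (w c - w b₁) / (c - b₁) * t := by rw [← hslope]; field_simp
    rw [e, hwc]
    have h3 : 0 < s * w b₁ := hpos b₁ ⟨hσb₀.trans_le hb₀₁, hb₁c⟩
    have h4 : s * ((0 - w b₁) / (c - b₁) * t) = -((s * w b₁) * (t / (c - b₁))) := by ring
    rw [h4]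
    have h5 : 0 ≤ t / (c - b₁) := div_nonneg ht0.le (by linarith)
    nlinarith
  have hJt : besselJ 0 t < 0 :=
    hJ t ⟨hρσ.trans_lt (hσb₀.trans (hb₀₁.trans_lt ht.1)), ht.2.trans hcz⟩
  have hft : f t ≤ f b₀ := by
    have hanti : AntitoneOn f (Set.Ico σ c) := by
      refine antitoneOn_of_deriv_nonpos (convex_Ico σ c)
        (fun t ht => (hder t ht).continuousAt.continuousWithinAt) ?_ ?_
      · rw [interior_Ico]
        exact fun t ht => (hder t (Set.Ioo_subset_Ico_self
          ht)).differentiableAt.differentiableWithinAt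
      · rw [interior_Ico]
        intro t ht
        rw [(hder t (Set.Ioo_subset_Ico_self ht)).deriv]
        exact hder' t ht
    exact hanti ⟨hσb₀.le, hb₀c⟩ ⟨(hσb₀.trans (hb₀₁.trans_lt ht.1)).le, ht.2⟩
      (hb₀₁.trans ht.1.le)
  have h6 : s * (w t * besselD 0 t) < -f b₀ := hsub ⟨hlb₁.trans ht.1, ht.2⟩
  have h7 : f t = -(s * (w t * besselD 0 t)) + besselJ 0 t * (s * d t) := by
    simp only [hf]; ring
  nlinarith [mul_nonneg_of_nonpos_of_nonpos hJt.le hsd]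

end LaneEmdenPair

/-- As `p → 1`, the second zero of the normalized solution tends to that of `J_0`, from above. -/
theorem laneEmden_second_zero {z : ℝ} (hz : IsNthZero 0 2 z) {ε : ℝ} (hε : 0 < ε) :
    ∃ pbar : ℝ, 1 < pbar ∧ ∀ p ∈ Set.Ioo 1 pbar, ∀ (c : ℝ) (w d : ℝ → ℝ),
      LaneEmdenPair p c w d → w c = 0 →
      (∃ σ ∈ Set.Ioo 0 c, w σ = 0 ∧ ∀ t ∈ Set.Ioo 0 c, w t = 0 → t = σ) →
      z ≤ c ∧ c ≤ z + ε := by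
  obtain ⟨ρ, hρ, hJpos, hJρ, hJneg, hJz, ε₀, hε₀, hJpos'⟩ := besselJ_zero_sign hz
  set ε₁ := min ε ε₀ with hε₁
  have hε₁0 : 0 < ε₁ := lt_min hε hε₀
  set s₂ := (ρ + z) / 2 with hs₂
  have hs₂I : s₂ ∈ Set.Ioo ρ z := ⟨by linarith [hρ.2], by linarith [hρ.2]⟩
  have hJ2 : besselJ 0 s₂ < 0 := hJneg s₂ hs₂I
  set s₃ := z + ε₁ with hs₃
  have hJ3 : 0 < besselJ 0 s₃ := hJpos' s₃ ⟨by linarith, by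
    have := min_le_right ε ε₀; linarith⟩
  set m := min (-besselJ 0 s₂) (besselJ 0 s₃) with hm
  have hm0 : 0 < m := lt_min (by linarith) hJ3
  have hev : ∀ᶠ p in 𝓝 (1 : ℝ), (p - 1) ^ 2 * Real.exp (3 * s₃) < m ^ 2 := by
    have : Continuous fun p : ℝ => (p - 1) ^ 2 * Real.exp (3 * s₃) := by fun_prop
    refine (this.tendsto 1).eventually (gt_mem_nhds ?_)
    simp; positivity
  obtain ⟨η, hη, hball⟩ := Metric.eventually_nhds_iff.1 hev
  refine ⟨1 + η, by linarith, fun p hp c w d H hwc ⟨σ, hσ, hwσ, huniq⟩ => ?_⟩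
  have hsmall := hball (show dist p 1 < η by
    rw [Real.dist_eq, abs_of_pos (by linarith [hp.1])]; linarith [hp.2])
  have hcw := H.cont
  constructor
  · have hpos : ∀ t ∈ Set.Ico 0 σ, 0 < w t := by
      refine pos_of_ne_zero_of_preconnected isPreconnected_Ico
        (hcw.mono fun t ht => ⟨ht.1, (ht.2.trans hσ.2).le⟩) ?_ (x₀ := 0) ⟨le_rfl, hσ.1⟩
        (by rw [H.init]; exact one_pos)
      intro t ht h0
      rcases ht.1.eq_or_lt with h | h
      · rw [← h, H.init] at h0; exact one_ne_zero h0
      · exact ht.2.ne (huniq t ⟨h, ht.2.trans hσ.2⟩ h0)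
    have hρσ := H.first_zero_le hJpos hσ hwσ hpos
    have hne : ∀ t ∈ Set.Ioo σ c, w t ≠ 0 := fun t ht h0 =>
      ht.1.ne' (huniq t ⟨hσ.1.trans ht.1, ht.2⟩ h0)
    set m' := (σ + c) / 2 with hm'
    have hm'I : m' ∈ Set.Ioo σ c := ⟨by linarith [hσ.2], by linarith [hσ.2]⟩
    refine H.second_zero_le (s := w m') hJρ hJneg hσ hρσ hwσ hwc ?_
    refine pos_of_ne_zero_of_preconnected isPreconnected_Ioo
      (continuousOn_const.mul (hcw.mono fun t ht => ⟨(hσ.1.trans ht.1).le, ht.2.le⟩))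
      (fun t ht => mul_ne_zero (hne m' hm'I) (hne t ht)) hm'I ?_
    exact mul_self_pos.2 (hne m' hm'I)
  · by_contra hcon
    have hs₃c : s₃ < c := by
      have := min_le_left ε ε₀; linarith [not_le.1 hcon]
    have hs₂0 : 0 < s₂ := hρ.1.trans hs₂I.1
    have hs₂₃ : s₂ < s₃ := by linarith [hs₂I.2]
    have key : ∀ t ∈ Set.Ioc 0 s₃, |w t - besselJ 0 t| < m := by
      intro t ht
      refine abs_lt_of_sq_lt_sq ?_ hm0.le
      refine lt_of_le_of_lt (H.sq_sub_besselJ_le t ⟨ht.1, ht.2.trans_lt hs₃c⟩)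
        (lt_of_le_of_lt ?_ hsmall)
      gcongr
      exact ht.2
    have h2 : w s₂ < 0 := by
      have := abs_lt.1 (key s₂ ⟨hs₂0, hs₂₃.le⟩)
      have := min_le_left (-besselJ 0 s₂) (besselJ 0 s₃)
      linarith
    have h3 : 0 < w s₃ := by
      have := abs_lt.1 (key s₃ ⟨hs₂0.trans hs₂₃, le_rfl⟩)
      have := min_le_right (-besselJ 0 s₂) (besselJ 0 s₃)
      linarith
    obtain ⟨t₁, ht₁, hw₁⟩ := intermediate_value_Icc' hs₂0.le
      (hcw.mono (Set.Icc_subset_Icc le_rfl (hs₂₃.trans hs₃c).le))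
      (show (0 : ℝ) ∈ Set.Icc (w s₂) (w 0) from ⟨h2.le, by rw [H.init]; exact zero_le_one⟩)
    obtain ⟨t₂, ht₂, hw₂⟩ := intermediate_value_Icc hs₂₃.le
      (hcw.mono (Set.Icc_subset_Icc hs₂0.le hs₃c.le))
      (show (0 : ℝ) ∈ Set.Icc (w s₂) (w s₃) from ⟨h2.le, h3.le⟩)
    have h4 : t₁ ≠ s₂ := fun h => by rw [h] at hw₁; exact h2.ne hw₁
    have h5 : t₂ ≠ s₂ := fun h => by rw [h] at hw₂; exact h2.ne hw₂
    have h6 : t₁ ≠ 0 := fun h => by rw [h, H.init] at hw₁; exact one_ne_zero hw₁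
    have h7 : t₁ < s₂ := lt_of_le_of_ne ht₁.2 h4
    have h8 : s₂ < t₂ := lt_of_le_of_ne ht₂.1 h5.symm
    have h9 := huniq t₁ ⟨lt_of_le_of_ne ht₁.1 h6.symm, h7.trans (hs₂₃.trans hs₃c)⟩ hw₁
    have h10 := huniq t₂ ⟨hs₂0.trans h8, ht₂.2.trans_lt hs₃c⟩ hw₂
    linarith

/-- The point `(a, b)` of the Euclidean plane. -/
def pt (a b : ℝ) : E2 := !₂[a, b]

lemma pt_eq (a b : ℝ) : pt a b = a • EuclideanSpace.single 0 1 + b • EuclideanSpace.single 1 1 := by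
  ext i; fin_cases i <;> simp [pt]

lemma norm_pt (a b : ℝ) : ‖pt a b‖ = √(a ^ 2 + b ^ 2) := by
  simp [pt, EuclideanSpace.norm_eq, Fin.sum_univ_two]

lemma hasDerivAt_pt_left (a b : ℝ) :
    HasDerivAt (fun a => pt a b) (EuclideanSpace.single 0 1) a := by
  simp only [pt_eq]
  simpa using ((hasDerivAt_id a).smul_const (EuclideanSpace.single 0 1 : E2)).add_const
    (b • EuclideanSpace.single 1 1)

lemma hasDerivAt_pt_right (a b : ℝ) :
    HasDerivAt (fun b => pt a b) (EuclideanSpace.single 1 1) b := by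
  simp only [pt_eq]
  simpa using ((hasDerivAt_id b).smul_const (EuclideanSpace.single 1 1 : E2)).const_add
    (a • EuclideanSpace.single 0 1)

lemma norm_pt_zero_of_nonneg {r : ℝ} (hr : 0 ≤ r) : ‖pt r 0‖ = r := by
  simp [norm_pt, Real.sqrt_sq hr]

section Radial

variable {u : E2 → ℝ} {f : ℝ → ℝ}

lemma differentiableAt_fderiv_of_contDiffOn_two (hu : ContDiffOn ℝ 2 u (ball 0 1)) {x : E2}
    (hx : x ∈ ball (0 : E2) 1) : DifferentiableAt ℝ u x ∧ DifferentiableAt ℝ (fderiv ℝ u) x := by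
  have h := hu.contDiffAt (isOpen_ball.mem_nhds hx)
  refine ⟨h.differentiableAt (by norm_num), ?_⟩
  exact (h.fderiv_right (m := 1) (by norm_num)).differentiableAt (by norm_num)

lemma hasDerivAt_radial (hu : ContDiffOn ℝ 2 u (ball 0 1))
    (hf : ∀ x ∈ closedBall (0 : E2) 1, u x = f ‖x‖) {r : ℝ} (hr : r ∈ Set.Ioo 0 1) :
    HasDerivAt f (fderiv ℝ u (pt r 0) (EuclideanSpace.single 0 1)) r := by
  have hmem : pt r 0 ∈ ball (0 : E2) 1 := by
    rw [mem_ball_zero_iff, norm_pt_zero_of_nonneg hr.1.le]; exact hr.2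
  have h := (differentiableAt_fderiv_of_contDiffOn_two hu hmem).1.hasFDerivAt.comp_hasDerivAt r
    (hasDerivAt_pt_left r 0)
  refine h.congr_of_eventuallyEq ?_
  filter_upwards [isOpen_Ioo.mem_nhds hr] with s hs
  have := hf (pt s 0) (by
    rw [mem_closedBall_zero_iff, norm_pt_zero_of_nonneg hs.1.le]; exact hs.2.le)
  simp [this, norm_pt_zero_of_nonneg hs.1.le]

lemma lap_radial (hu : ContDiffOn ℝ 2 u (ball 0 1))
    (hf : ∀ x ∈ closedBall (0 : E2) 1, u x = f ‖x‖) {r : ℝ} (hr : r ∈ Set.Ioo 0 1) :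
    HasDerivAt (fun r => r * fderiv ℝ u (pt r 0) (EuclideanSpace.single 0 1))
      (r * lap u (pt r 0)) r := by
  set g' : ℝ → ℝ := fun r => fderiv ℝ u (pt r 0) (EuclideanSpace.single 0 1) with hg'
  have hmem : pt r 0 ∈ ball (0 : E2) 1 := by
    rw [mem_ball_zero_iff, norm_pt_zero_of_nonneg hr.1.le]; exact hr.2
  have hD := (differentiableAt_fderiv_of_contDiffOn_two hu hmem).2
  have hDi : ∀ i : Fin 2, DifferentiableAt ℝ
      (fun y => fderiv ℝ u y (EuclideanSpace.single i 1)) (pt r 0) :=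
    fun i => hD.clm_apply (differentiableAt_const _)
  have h1 : HasDerivAt g' (fderiv ℝ (fun y => fderiv ℝ u y (EuclideanSpace.single 0 1)) (pt r 0)
      (EuclideanSpace.single 0 1)) r :=
    HasFDerivAt.comp_hasDerivAt (f := fun r => pt r 0) r (hDi 0).hasFDerivAt
      (hasDerivAt_pt_left r 0)
  have h2 : HasDerivAt (fun b => fderiv ℝ u (pt r b) (EuclideanSpace.single 1 1))
      (fderiv ℝ (fun y => fderiv ℝ u y (EuclideanSpace.single 1 1)) (pt r 0)
      (EuclideanSpace.single 1 1)) 0 :=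
    HasFDerivAt.comp_hasDerivAt (f := fun b => pt r b) (0 : ℝ) (hDi 1).hasFDerivAt
      (hasDerivAt_pt_right r 0)
  have hρ : ∀ b : ℝ, HasDerivAt (fun b : ℝ => √(r ^ 2 + b ^ 2)) (b / √(r ^ 2 + b ^ 2)) b := by
    intro b
    have hpos : r ^ 2 + b ^ 2 ≠ 0 := by nlinarith [sq_nonneg b, mul_pos hr.1 hr.1]
    have := (((hasDerivAt_id b).pow 2).const_add (r ^ 2)).sqrt hpos
    refine this.congr_deriv ?_
    simp; field_simp
  have hρ0 : √(r ^ 2 + (0 : ℝ) ^ 2) = r := by simp [Real.sqrt_sq hr.1.le]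
  have hev : ∀ᶠ b in 𝓝 (0 : ℝ), √(r ^ 2 + b ^ 2) ∈ Set.Ioo (0 : ℝ) 1 := by
    refine (hρ 0).continuousAt.eventually_mem ?_
    rw [hρ0]; exact isOpen_Ioo.mem_nhds hr
  have h3 : (fun b => fderiv ℝ u (pt r b) (EuclideanSpace.single 1 1)) =ᶠ[𝓝 0]
      fun b => g' (√(r ^ 2 + b ^ 2)) * (b / √(r ^ 2 + b ^ 2)) := by
    filter_upwards [hev, hev.eventually_nhds] with b hb hb'
    have hm : pt r b ∈ ball (0 : E2) 1 := by rw [mem_ball_zero_iff, norm_pt]; exact hb.2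
    have e1 := (differentiableAt_fderiv_of_contDiffOn_two hu hm).1.hasFDerivAt.comp_hasDerivAt b
      (hasDerivAt_pt_right r b)
    have e2 := (hasDerivAt_radial hu hf hb).comp b (hρ b)
    refine (e1.congr_of_eventuallyEq ?_).unique e2
    filter_upwards [hb'] with b hb
    simp only [Function.comp]
    rw [hf (pt r b) (by rw [mem_closedBall_zero_iff, norm_pt]; exact hb.2.le), norm_pt]
  have h4 : HasDerivAt (fun b => g' (√(r ^ 2 + b ^ 2)) * (b / √(r ^ 2 + b ^ 2)))
      (g' r / r) 0 := by
    have hg1 := (hρ0 ▸ h1 : HasDerivAt g' _ (√(r ^ 2 + (0 : ℝ) ^ 2))).comp (0 : ℝ) (hρ 0)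
    have := hg1.mul ((hasDerivAt_id (0 : ℝ)).div (hρ 0) (by rw [hρ0]; exact hr.1.ne'))
    refine this.congr_deriv ?_
    simp only [id, Function.comp_apply, hρ0]
    have := hr.1.ne'
    field_simp
    simp [mul_comm]
  have h5 := h2.unique (h4.congr_of_eventuallyEq h3)
  refine ((hasDerivAt_id r).mul h1).congr_deriv ?_
  rw [lap, Fin.sum_univ_two, h5]
  have := hr.1.ne'
  simp only [id]
  field_simp
  simp [hg', add_comm]

end Radial

lemma exists_laneEmdenPair {α p : ℝ} (hα : 0 ≤ α) (hp : 1 < p) {u : E2 → ℝ}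
    (hu : IsRadialNodalSol α p 2 u) :
    ∃ c w d, LaneEmdenPair p c w d ∧ w c = 0 ∧
      (∃ σ ∈ Set.Ioo 0 c, w σ = 0 ∧ ∀ t ∈ Set.Ioo 0 c, w t = 0 → t = σ) ∧
      ∀ x ∈ closedBall (0 : E2) 1, |u x| ^ (p - 1) =
        ((2 + α) / 2) ^ 2 * c ^ 2 * |w (c * ‖x‖ ^ ((2 + α) / 2))| ^ (p - 1) := by
  obtain ⟨⟨hC2, -, hpde, hbd⟩, f, hfc, huf, hf0, hcard⟩ := hu
  set κ := (2 + α) / 2 with hκ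
  have hκ0 : 0 < κ := by positivity
  set k : ℝ → ℝ := fun r => r * fderiv ℝ u (pt r 0) (EuclideanSpace.single 0 1) with hk
  set μ := |f 0| ^ (p - 1) with hμ
  have hμ0 : 0 < μ := Real.rpow_pos_of_pos (abs_pos.2 hf0) _
  set c := √μ / κ with hc
  have hc0 : 0 < c := by positivity
  have hcμ : κ ^ 2 * c ^ 2 = μ := by
    rw [show κ ^ 2 * c ^ 2 = (√μ) ^ 2 by rw [← mul_pow, hc, mul_div_cancel₀ _ hκ0.ne'],
      Real.sq_sqrt hμ0.le]
  have hE : EulerPair f k (fun r => r ^ (2 * κ) * |f r| ^ (p - 1)) (Set.Ioo 0 1) := by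
    intro r hr
    have hr0 := hr.1.ne'
    refine ⟨(hasDerivAt_radial hC2 huf hr).congr_deriv (by simp only [hk]; field_simp), ?_⟩
    refine (lap_radial hC2 huf hr).congr_deriv ?_
    have hmem : pt r 0 ∈ ball (0 : E2) 1 := by
      rw [mem_ball_zero_iff, norm_pt_zero_of_nonneg hr.1.le]; exact hr.2
    have e := hpde _ hmem
    rw [huf _ (ball_subset_closedBall hmem), norm_pt_zero_of_nonneg hr.1.le] at e
    have e2 : r ^ (2 * κ) = r ^ 2 * r ^ α := by
      rw [show 2 * κ = 2 + α by rw [hκ]; ring, Real.rpow_add hr.1, Real.rpow_two]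
    simp only [e2]
    field_simp
    linear_combination (-1) * e
  have hφ : ∀ t : ℝ, 0 ≤ t → c * ((t / c) ^ (1 / κ)) ^ κ = t := fun t ht => by
    rw [← Real.rpow_mul (by positivity), one_div, inv_mul_cancel₀ hκ0.ne', Real.rpow_one]
    field_simp
  have hφ1 : ∀ t ∈ Set.Ioo 0 c, (t / c) ^ (1 / κ) ∈ Set.Ioo (0 : ℝ) 1 := fun t ht =>
    ⟨Real.rpow_pos_of_pos (div_pos ht.1 hc0) _,
      Real.rpow_lt_one (div_nonneg ht.1.le hc0.le) ((div_lt_one hc0).2 ht.2) (by positivity)⟩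
  have hφ2 : ∀ t ∈ Set.Icc 0 c, (t / c) ^ (1 / κ) ∈ Set.Icc (0 : ℝ) 1 := fun t ht =>
    ⟨Real.rpow_nonneg (div_nonneg ht.1 hc0.le) _,
      Real.rpow_le_one (div_nonneg ht.1 hc0.le) ((div_le_one hc0).2 ht.2) (by positivity)⟩
  have hψ : ∀ r : ℝ, 0 ≤ r → (c * r ^ κ / c) ^ (1 / κ) = r := fun r hr => by
    rw [mul_div_cancel_left₀ _ hc0.ne', ← Real.rpow_mul hr, mul_one_div_cancel hκ0.ne',
      Real.rpow_one]
  set w : ℝ → ℝ := fun t => f ((t / c) ^ (1 / κ)) / f 0 with hw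
  have hf1 : f 1 = 0 := by
    have := huf (pt 1 0) (by simp [norm_pt])
    rw [hbd (pt 1 0) (by simp [norm_pt])] at this
    simpa [norm_pt] using this.symm
  have hpow : ∀ r : ℝ, |f r| ^ (p - 1) = μ * |f r / f 0| ^ (p - 1) := fun r => by
    rw [abs_div, Real.div_rpow (abs_nonneg _) (abs_nonneg _), ← hμ]
    field_simp
  have hcont : ContinuousOn (fun t : ℝ => (t / c) ^ (1 / κ)) (Set.Icc 0 c) :=
    ((Real.continuous_rpow_const (by positivity)).comp (continuous_id.div_const c)).continuousOn
  refine ⟨c, w, fun t => 1 / κ * k ((t / c) ^ (1 / κ)) / f 0, ⟨hp, hc0, ?_, ?_, ?_, ?_⟩, ?_, ?_, ?_⟩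
  · have h1 : EulerPair (fun t => f ((t / c) ^ (1 / κ))) (fun t => 1 / κ * k ((t / c) ^ (1 / κ)))
        (fun t => t ^ 2 * |w t| ^ (p - 1)) (Set.Ioo 0 c) := by
      have hE' := hE.comp_rpow (s' := Set.Ioo (0 : ℝ) c) (c := c⁻¹ ^ (1 / κ)) (κ := 1 / κ)
        (by positivity) (fun t ht => ⟨ht.1, by
          have := hφ1 t ht
          rwa [div_eq_inv_mul, Real.mul_rpow (by positivity) ht.1.le] at this⟩)
      intro t ht
      have e : ∀ s : ℝ, 0 < s → c⁻¹ ^ (1 / κ) * s ^ (1 / κ) = (s / c) ^ (1 / κ) := fun s hs => by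
        rw [div_eq_inv_mul s, Real.mul_rpow (by positivity) hs.le]
      have hev : ∀ᶠ s in 𝓝 t, c⁻¹ ^ (1 / κ) * s ^ (1 / κ) = (s / c) ^ (1 / κ) := by
        filter_upwards [lt_mem_nhds ht.1] with s hs using e s hs
      have := hE' t ht
      simp only [e t ht.1] at this
      refine ⟨this.1.congr_of_eventuallyEq ?_, (this.2.congr_of_eventuallyEq ?_).congr_deriv ?_⟩
      · filter_upwards [hev] with s hs; rw [hs]
      · filter_upwards [hev] with s hs; rw [hs]
      · have e2 : ((t / c) ^ (1 / κ)) ^ (2 * κ) = t ^ 2 / c ^ 2 := by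
          rw [← Real.rpow_mul (div_nonneg ht.1.le hc0.le),
            show 1 / κ * (2 * κ) = 2 by field_simp, Real.rpow_two, div_pow]
        rw [e2, hpow, ← hcμ]
        simp only [hw]
        field_simp
    intro t ht
    have h2 := h1 t ht
    refine ⟨(h2.1.div_const (f 0)).congr_deriv (by ring),
      (h2.2.div_const (f 0)).congr_deriv (by simp only [hw]; ring)⟩
  · exact (hfc.comp hcont hφ2).div_const _
  · simp only [hw, zero_div]
    rw [Real.zero_rpow (by positivity), div_self hf0]
  · have hk0 : Tendsto k (𝓝 0) (𝓝 0) := by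
      have h0 : (0 : E2) ∈ ball (0 : E2) 1 := by simp
      have hD := (differentiableAt_fderiv_of_contDiffOn_two hC2 h0).2.continuousAt
      have hp0 : pt 0 0 = 0 := by ext i; fin_cases i <;> simp [pt]
      have h1 : ContinuousAt (fun r => fderiv ℝ u (pt r 0)) 0 := by
        refine ContinuousAt.comp (g := fderiv ℝ u) (by rwa [hp0])
          (hasDerivAt_pt_left 0 0).continuousAt
      have h2 : ContinuousAt k 0 := continuousAt_id.mul (h1.clm_apply continuousAt_const)
      simpa [hk] using h2.tendsto
    have h3 : Tendsto (fun t : ℝ => (t / c) ^ (1 / κ)) (𝓝[>] 0) (𝓝 0) := by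
      have : ContinuousAt (fun t : ℝ => (t / c) ^ (1 / κ)) 0 :=
        ((Real.continuous_rpow_const (by positivity)).comp
          (continuous_id.div_const c)).continuousAt
      have h := this.tendsto
      simp only [zero_div] at h
      rw [Real.zero_rpow (by positivity)] at h
      exact h.mono_left nhdsWithin_le_nhds
    simpa using ((hk0.comp h3).const_mul (1 / κ)).div_const (f 0)
  · simp only [hw, div_self hc0.ne', Real.one_rpow, hf1, zero_div]
  · have hset : {s : ℝ | s ∈ Set.Ioc (0 : ℝ) 1 ∧ f s = 0} =
        insert 1 {s : ℝ | s ∈ Set.Ioo (0 : ℝ) 1 ∧ f s = 0} := by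
      ext s
      simp only [Set.mem_ofPred_eq, Set.mem_insert_iff, Set.mem_Ioc, Set.mem_Ioo]
      constructor
      · rintro ⟨⟨h1, h2⟩, h3⟩
        rcases h2.eq_or_lt with h | h
        · exact Or.inl h
        · exact Or.inr ⟨⟨h1, h⟩, h3⟩
      · rintro (rfl | ⟨⟨h1, h2⟩, h3⟩)
        · exact ⟨by norm_num, hf1⟩
        · exact ⟨⟨h1, h2.le⟩, h3⟩
    rw [hset, Set.encard_insert_of_notMem (by simp)] at hcard
    have hone : {s : ℝ | s ∈ Set.Ioo (0 : ℝ) 1 ∧ f s = 0}.encard = 1 := by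
      have h2 : ((2 : ℕ) : ℕ∞) = 1 + 1 := by norm_num
      rw [h2] at hcard
      exact by simpa using hcard
    obtain ⟨r₀, hr₀⟩ := Set.encard_eq_one.1 hone
    have hr₀m : r₀ ∈ {s : ℝ | s ∈ Set.Ioo (0 : ℝ) 1 ∧ f s = 0} := by rw [hr₀]; simp
    obtain ⟨⟨ha, hb⟩, hfr⟩ := hr₀m
    refine ⟨c * r₀ ^ κ, ⟨by positivity, ?_⟩, ?_, ?_⟩
    · exact mul_lt_of_lt_one_right hc0 (Real.rpow_lt_one ha.le hb hκ0)
    · simp only [hw]; rw [hψ r₀ ha.le, hfr, zero_div]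
    · intro t ht hwt
      have hmem : (t / c) ^ (1 / κ) ∈ {s : ℝ | s ∈ Set.Ioo (0 : ℝ) 1 ∧ f s = 0} :=
        ⟨hφ1 t ht, (div_eq_zero_iff.1 hwt).resolve_right hf0⟩
      rw [hr₀, Set.mem_singleton_iff] at hmem
      rw [← hmem, hφ t ht.1.le]
  · intro x hx
    simp only [hw]
    rw [hψ _ (norm_nonneg x), huf x hx, hcμ, hpow]

/-- The zeros and the endpoint of the normalized profile are the only facts about a two-zone
solution that are used: `w` vanishes at `c` and has exactly one zero in `(0, c)`. -/
structure TwoZonePair (p c : ℝ) (w d : ℝ → ℝ) : Prop extends LaneEmdenPair p c w d where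
  apply_right : w c = 0
  exists_zero : ∃ σ ∈ Set.Ioo 0 c, w σ = 0 ∧ ∀ t ∈ Set.Ioo 0 c, w t = 0 → t = σ

lemma mul_rpow_mem_Ioo {c κ r : ℝ} (hc : 0 < c) (hκ : 0 < κ) (hr : r ∈ Set.Ioo (0 : ℝ) 1) :
    c * r ^ κ ∈ Set.Ioo 0 c :=
  ⟨mul_pos hc (Real.rpow_pos_of_pos hr.1 _),
    mul_lt_of_lt_one_right hc (Real.rpow_lt_one hr.1.le hr.2 hκ)⟩

lemma mul_rpow_mem_Icc {c κ r : ℝ} (hc : 0 < c) (hκ : 0 < κ) (hr : r ∈ Set.Icc (0 : ℝ) 1) :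
    c * r ^ κ ∈ Set.Icc 0 c :=
  ⟨mul_nonneg hc.le (Real.rpow_nonneg hr.1 _),
    mul_le_of_le_one_right hc.le (Real.rpow_le_one hr.1 hr.2 hκ.le)⟩

lemma LaneEmdenPair.continuousOn_abs_rpow {p c κ : ℝ} {w d : ℝ → ℝ} (H : LaneEmdenPair p c w d)
    (hκ : 0 < κ) : ContinuousOn (fun r => |w (c * r ^ κ)| ^ (p - 1)) (Set.Icc 0 1) := by
  have h1 : ContinuousOn (fun r : ℝ => c * r ^ κ) (Set.Icc 0 1) :=
    (continuous_const.mul (Real.continuous_rpow_const hκ.le)).continuousOn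
  have h2 : ContinuousOn (fun r : ℝ => w (c * r ^ κ)) (Set.Icc 0 1) :=
    H.cont.comp h1 fun r hr => mul_rpow_mem_Icc H.pos hκ hr
  exact h2.abs.rpow_const fun _ _ => Or.inr (by linarith [H.one_lt])

lemma twoZonePair_limit {z κ ε : ℝ} (hz : IsNthZero 0 2 z) (hκ : 0 < κ) (hε : 0 < ε) :
    ∃ pbar > 1, ∀ p ∈ Set.Ioo 1 pbar, ∀ c w d, TwoZonePair p c w d →
      z ≤ c ∧ c ≤ z + ε ∧ ∫ r in (0 : ℝ)..1, (1 - |w (c * r ^ κ)| ^ (p - 1)) ≤ ε := by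
  have hz0 : 0 < z := hz.1
  obtain ⟨p₁, hp₁, H₁⟩ := laneEmden_second_zero hz hε
  suffices h : ∃ pbar > 1, ∀ p ∈ Set.Ioo 1 pbar, ∀ c w d, TwoZonePair p c w d →
      ∫ r in (0 : ℝ)..1, (1 - |w (c * r ^ κ)| ^ (p - 1)) ≤ ε by
    obtain ⟨p₂, hp₂, H₂⟩ := h
    refine ⟨min p₁ p₂, lt_min hp₁ hp₂, fun p hp c w d H => ?_⟩
    obtain ⟨h1, h2⟩ := H₁ p ⟨hp.1, hp.2.trans_le (min_le_left _ _)⟩ c w d H.toLaneEmdenPair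
      H.apply_right H.exists_zero
    exact ⟨h1, h2, H₂ p ⟨hp.1, hp.2.trans_le (min_le_right _ _)⟩ c w d H⟩
  by_contra hcon
  push Not at hcon
  have hseq : ∀ n : ℕ, ∃ p c w d, p ∈ Set.Ioo 1 (1 + 1 / ((n : ℝ) + 1)) ∧ TwoZonePair p c w d ∧
      ε < ∫ r in (0 : ℝ)..1, (1 - |w (c * r ^ κ)| ^ (p - 1)) := fun n => by
    obtain ⟨p, hp, c, w, d, h⟩ := hcon (1 + 1 / ((n : ℝ) + 1)) (by
      have : 0 < 1 / ((n : ℝ) + 1) := Nat.one_div_pos_of_nat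
      linarith)
    exact ⟨p, c, w, d, hp, h⟩
  choose p c w d hp H hInt using hseq
  have hplim : Tendsto p atTop (𝓝 1) := by
    refine tendsto_of_tendsto_of_tendsto_of_le_of_le (g := fun _ => (1 : ℝ)) tendsto_const_nhds
      (h := fun n : ℕ => 1 + 1 / ((n : ℝ) + 1)) ?_ (fun n => (hp n).1.le) (fun n => (hp n).2.le)
    simpa using tendsto_one_div_add_atTop_nhds_zero_nat.const_add (1 : ℝ)
  have hev : ∀ δ > 0, ∀ᶠ n in atTop, z ≤ c n ∧ c n ≤ z + δ := by
    intro δ hδ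
    obtain ⟨q, hq, Hq⟩ := laneEmden_second_zero hz hδ
    filter_upwards [hplim.eventually (gt_mem_nhds hq)] with n hn
    exact Hq (p n) ⟨(hp n).1, hn⟩ _ _ _ (H n).toLaneEmdenPair (H n).apply_right (H n).exists_zero
  have hclim : Tendsto c atTop (𝓝 z) := by
    rw [Metric.tendsto_nhds]
    intro δ hδ
    filter_upwards [hev (δ / 2) (by positivity)] with n hn
    rw [Real.dist_eq, abs_lt]
    constructor <;> linarith [hn.1, hn.2]
  obtain ⟨ρ, hρ, hpos, hJρ, hneg, -, -⟩ := besselJ_zero_sign hz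
  have hpt : ∀ r ∈ Set.Ioo (0 : ℝ) 1, z * r ^ κ ≠ ρ →
      Tendsto (fun n => |w n (c n * r ^ κ)| ^ (p n - 1)) atTop (𝓝 1) := by
    intro r hr hrρ
    have hmem := mul_rpow_mem_Ioo hz0 hκ hr
    have hJ : besselJ 0 (z * r ^ κ) ≠ 0 := by
      rcases lt_or_gt_of_ne hrρ with h | h
      · exact (hpos _ ⟨hmem.1.le, h⟩).ne'
      · exact (hneg _ ⟨h, hmem.2⟩).ne
    have h1 : Tendsto (fun n => besselJ 0 (c n * r ^ κ)) atTop (𝓝 (besselJ 0 (z * r ^ κ))) :=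
      ((continuous_besselJ le_rfl).tendsto _).comp (hclim.mul_const _)
    have h2 : Tendsto (fun n => w n (c n * r ^ κ) - besselJ 0 (c n * r ^ κ)) atTop (𝓝 0) := by
      have hb : ∀ n, |w n (c n * r ^ κ) - besselJ 0 (c n * r ^ κ)| ≤
          (p n - 1) * √(exp (3 * (c n * r ^ κ))) := fun n => by
        refine abs_le_of_sq_le_sq ?_ (mul_nonneg (by linarith [(hp n).1]) (Real.sqrt_nonneg _))
        rw [mul_pow, Real.sq_sqrt (Real.exp_pos _).le]
        exact (H n).toLaneEmdenPair.sq_sub_besselJ_le _ (mul_rpow_mem_Ioo (H n).pos hκ hr)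
      refine squeeze_zero_norm hb ?_
      have h3 : Tendsto (fun n => √(exp (3 * (c n * r ^ κ)))) atTop
          (𝓝 (√(exp (3 * (z * r ^ κ))))) :=
        ((Real.continuous_sqrt.comp Real.continuous_exp).tendsto _).comp
          ((hclim.mul_const _).const_mul 3)
      simpa using (hplim.sub_const 1).mul h3
    have h3 : Tendsto (fun n => w n (c n * r ^ κ)) atTop (𝓝 (besselJ 0 (z * r ^ κ))) := by
      simpa using h2.add h1
    have h4 := h3.abs.rpow (hplim.sub_const 1) (Or.inl (abs_ne_zero.2 hJ))
    simpa using h4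
  have hae : ∀ᵐ r : ℝ, r ≠ (ρ / z) ^ (1 / κ) ∧ r ≠ 1 := by
    refine (Measure.ae_ne volume _).and (Measure.ae_ne volume _)
  have hlim : Tendsto (fun n => ∫ r in (0 : ℝ)..1, (1 - |w n (c n * r ^ κ)| ^ (p n - 1))) atTop
      (𝓝 (∫ r in (0 : ℝ)..1, (0 : ℝ))) := by
    refine intervalIntegral.tendsto_integral_filter_of_dominated_convergence (fun _ => 1)
      ?_ ?_ ?_ ?_
    · refine Eventually.of_forall fun n => ?_
      rw [Set.uIoc_of_le zero_le_one]
      exact ((continuousOn_const.sub ((H n).continuousOn_abs_rpow hκ)).mono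
        Set.Ioc_subset_Icc_self).aestronglyMeasurable measurableSet_Ioc
    · refine Eventually.of_forall fun n => ae_of_all _ fun r hr => ?_
      rw [Set.uIoc_of_le zero_le_one] at hr
      have h1 := (H n).toLaneEmdenPair.abs_le_one _
        (mul_rpow_mem_Icc (H n).pos hκ ⟨hr.1.le, hr.2⟩)
      have h2 := Real.rpow_le_one (abs_nonneg _) h1 (by linarith [(hp n).1] : 0 ≤ p n - 1)
      have h3 := Real.rpow_nonneg (abs_nonneg (w n (c n * r ^ κ))) (p n - 1)
      rw [Real.norm_eq_abs, abs_le]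
      constructor <;> linarith
    · simp
    · filter_upwards [hae] with r hr1 hr
      rw [Set.uIoc_of_le zero_le_one] at hr
      have := (hpt r ⟨hr.1, lt_of_le_of_ne hr.2 hr1.2⟩ (fun h => hr1.1 ?_)).const_sub 1
      · simpa using this
      · rw [← h, mul_div_cancel_left₀ _ hz0.ne', ← Real.rpow_mul hr.1.le,
          mul_one_div_cancel hκ.ne', Real.rpow_one]
  have hle := ge_of_tendsto' hlim fun n => (hInt n).le
  simp only [intervalIntegral.integral_zero] at hle
  linarith

/-- The radial unit vector at angle `θ`. -/
def eRad (θ : ℝ) : E2 := pt (cos θ) (sin θ)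

/-- The angular unit vector at angle `θ`. -/
def eAng (θ : ℝ) : E2 := pt (-sin θ) (cos θ)

lemma continuous_pt : Continuous fun q : ℝ × ℝ => pt q.1 q.2 := by
  simp only [pt_eq]; fun_prop

@[fun_prop]
lemma continuous_eRad : Continuous eRad :=
  continuous_pt.comp (Real.continuous_cos.prodMk Real.continuous_sin)

@[fun_prop]
lemma continuous_eAng : Continuous eAng :=
  continuous_pt.comp (Real.continuous_sin.neg.prodMk Real.continuous_cos)

lemma norm_eRad (θ : ℝ) : ‖eRad θ‖ = 1 := by simp [eRad, norm_pt]

lemma smul_eRad (r θ : ℝ) : r • eRad θ = pt (r * cos θ) (r * sin θ) := by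
  ext i; fin_cases i <;> simp [pt, eRad]

lemma norm_smul_eRad {r : ℝ} (hr : 0 ≤ r) (θ : ℝ) : ‖r • eRad θ‖ = r := by
  rw [norm_smul, norm_eRad, mul_one, Real.norm_of_nonneg hr]

lemma hasDerivAt_eRad (θ : ℝ) : HasDerivAt eRad (eAng θ) θ := by
  have h : eRad = fun θ => cos θ • EuclideanSpace.single 0 1 + sin θ • EuclideanSpace.single 1 1 :=
    funext fun θ => pt_eq _ _
  rw [h, eAng, pt_eq]
  exact ((Real.hasDerivAt_cos θ).smul_const _).add ((Real.hasDerivAt_sin θ).smul_const _)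

lemma norm_sq_eq_rotated (L : E2 →L[ℝ] ℝ) (θ : ℝ) :
    ‖L‖ ^ 2 = L (eRad θ) ^ 2 + L (eAng θ) ^ 2 := by
  set v := (InnerProductSpace.toDual ℝ E2).symm L with hv
  have h1 : ‖L‖ = ‖v‖ := by simp [hv]
  have h2 : ∀ x, L x = inner ℝ v x := fun x => by
    rw [hv, InnerProductSpace.toDual_symm_apply]
  rw [h1, h2, h2, EuclideanSpace.norm_sq_eq]
  simp only [Real.norm_eq_abs, sq_abs, Fin.sum_univ_two, PiLp.inner_apply, eRad, eAng, pt,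
    RCLike.inner_apply, conj_trivial]
  simp
  linear_combination (-(v 0 ^ 2 + v 1 ^ 2)) * Real.sin_sq_add_cos_sq θ

lemma integral_ball_eq_polar {F : E2 → ℝ} (hF : ContinuousOn F (closedBall 0 1)) :
    ∫ x in ball (0 : E2) 1, F x =
      ∫ r in (0 : ℝ)..1, r * ∫ θ in (-π)..π, F (r • eRad θ) := by
  have hmp : MeasurePreserving (fun x : E2 => (x 0, x 1)) volume (volume : Measure (ℝ × ℝ)) := by
    exact (volume_preserving_finTwoArrow ℝ).comp
      (EuclideanSpace.volume_preserving_symm_measurableEquiv_toLp (Fin 2))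
  have hemb : MeasurableEmbedding (fun x : E2 => (x 0, x 1)) :=
    MeasurableEquiv.finTwoArrow.measurableEmbedding.comp
      (MeasurableEquiv.toLp 2 (Fin 2 → ℝ)).symm.measurableEmbedding
  have hpt : ∀ x : E2, pt (x 0) (x 1) = x := fun x => by
    ext i; fin_cases i <;> simp [pt]
  have h1 : ∫ x in ball (0 : E2) 1, F x =
      ∫ q : ℝ × ℝ, (ball (0 : E2) 1).indicator F (pt q.1 q.2) := by
    rw [← hmp.integral_comp hemb, ← integral_indicator measurableSet_ball]
    simp only [hpt]
  rw [h1, ← integral_comp_polarCoord_symm]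
  have h2 : ∀ q ∈ polarCoord.target, q.1 • (ball (0 : E2) 1).indicator F
      (pt (polarCoord.symm q).1 (polarCoord.symm q).2) =
      (Set.Ioo (0 : ℝ) 1 ×ˢ Set.Ioo (-π) π).indicator (fun q => q.1 * F (q.1 • eRad q.2)) q := by
    intro q hq
    rw [polarCoord_target, Set.mem_prod] at hq
    have hq0 : 0 < q.1 := hq.1
    rw [polarCoord_symm_apply, ← smul_eRad]
    by_cases hlt : q.1 < 1
    · rw [Set.indicator_of_mem (by rwa [mem_ball_zero_iff, norm_smul_eRad hq0.le]),
        Set.indicator_of_mem (show q ∈ Set.Ioo (0 : ℝ) 1 ×ˢ Set.Ioo (-π) π from ⟨⟨hq0, hlt⟩, hq.2⟩),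
        smul_eq_mul]
    · rw [Set.indicator_of_notMem (by rwa [mem_ball_zero_iff, norm_smul_eRad hq0.le]),
        Set.indicator_of_notMem (fun h => hlt h.1.2), smul_zero]
  have hmt : MeasurableSet polarCoord.target := polarCoord.open_target.measurableSet
  have hsub : Set.Ioo (0 : ℝ) 1 ×ˢ Set.Ioo (-π) π ⊆ polarCoord.target := by
    rw [polarCoord_target]
    exact Set.prod_mono Set.Ioo_subset_Ioi_self le_rfl
  rw [setIntegral_congr_fun hmt h2,
    setIntegral_indicator (measurableSet_Ioo.prod measurableSet_Ioo),
    Set.inter_eq_right.2 hsub, Measure.volume_eq_prod, setIntegral_prod]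
  · rw [intervalIntegral.integral_of_le zero_le_one, integral_Ioc_eq_integral_Ioo]
    refine setIntegral_congr_fun measurableSet_Ioo fun r hr => ?_
    simp only
    rw [integral_const_mul, intervalIntegral.integral_of_le (by linarith [Real.pi_pos]),
      integral_Ioc_eq_integral_Ioo]
  · have hcont : ContinuousOn (fun q : ℝ × ℝ => q.1 * F (q.1 • eRad q.2))
        (Set.Icc (0 : ℝ) 1 ×ˢ Set.Icc (-π) π) := by
      refine continuousOn_fst.mul (hF.comp (by fun_prop) fun q hq => ?_)
      rw [mem_closedBall_zero_iff, norm_smul_eRad hq.1.1]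
      exact hq.1.2
    exact (hcont.integrableOn_compact (isCompact_Icc.prod isCompact_Icc)).mono_set
      (Set.prod_mono Set.Ioo_subset_Icc_self Set.Ioo_subset_Icc_self)

/-- `∫ F ^ 2` over the circle. -/
def circleSq (F : ℝ → ℝ → ℝ) (r : ℝ) : ℝ := ∫ θ in (-π)..π, F r θ ^ 2

/-- `ψ` in polar coordinates. -/
def pol (ψ : E2 → ℝ) (r θ : ℝ) : ℝ := ψ (r • eRad θ)

/-- The radial derivative of `ψ`. -/
def polR (ψ : E2 → ℝ) (r θ : ℝ) : ℝ := fderiv ℝ ψ (r • eRad θ) (eRad θ)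

/-- The angular derivative of `ψ`. -/
def polA (ψ : E2 → ℝ) (r θ : ℝ) : ℝ := r * fderiv ℝ ψ (r • eRad θ) (eAng θ)

section Pol

variable {ψ : E2 → ℝ}

lemma continuous_pol (hψ : ContDiff ℝ 1 ψ) :
    Continuous fun q : ℝ × ℝ => pol ψ q.1 q.2 := by
  have := hψ.continuous
  unfold pol; fun_prop

lemma continuous_polR (hψ : ContDiff ℝ 1 ψ) :
    Continuous fun q : ℝ × ℝ => polR ψ q.1 q.2 := by
  have := hψ.continuous_fderiv one_ne_zero
  unfold polR; fun_prop

lemma continuous_polA (hψ : ContDiff ℝ 1 ψ) :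
    Continuous fun q : ℝ × ℝ => polA ψ q.1 q.2 := by
  have := hψ.continuous_fderiv one_ne_zero
  unfold polA; fun_prop

lemma hasDerivAt_pol_left (hψ : ContDiff ℝ 1 ψ) (r θ : ℝ) :
    HasDerivAt (fun r => pol ψ r θ) (polR ψ r θ) r := by
  have h1 : HasDerivAt (fun r : ℝ => r • eRad θ) (eRad θ) r := by
    simpa using (hasDerivAt_id r).smul_const (eRad θ)
  exact HasFDerivAt.comp_hasDerivAt (f := fun r : ℝ => r • eRad θ) r
    ((hψ.differentiable one_ne_zero) _).hasFDerivAt h1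

lemma hasDerivAt_pol_right (hψ : ContDiff ℝ 1 ψ) (r θ : ℝ) :
    HasDerivAt (fun θ => pol ψ r θ) (polA ψ r θ) θ := by
  have h1 : HasDerivAt (fun θ : ℝ => r • eRad θ) (r • eAng θ) θ :=
    (hasDerivAt_eRad θ).const_smul r
  have := HasFDerivAt.comp_hasDerivAt (f := fun θ : ℝ => r • eRad θ) θ
    ((hψ.differentiable one_ne_zero) _).hasFDerivAt h1
  refine this.congr_deriv ?_
  simp [polA]

end Pol

lemma continuous_circleSq {F : ℝ → ℝ → ℝ} (hF : Continuous fun q : ℝ × ℝ => F q.1 q.2) :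
    Continuous (circleSq F) :=
  intervalIntegral.continuous_parametric_intervalIntegral_of_continuous' (hF.pow 2) _ _

/-- The radial density of the quadratic form: `V` is `r ^ 2` times the potential. -/
def radialDensity (V : ℝ → ℝ) (ψ : E2 → ℝ) (r : ℝ) : ℝ :=
  r * circleSq (polR ψ) r + circleSq (polA ψ) r / r - V r * circleSq (pol ψ) r / r

lemma quadForm_eq_integral {α p : ℝ} (hα : 0 ≤ α) {u ψ : E2 → ℝ} {m : ℝ → ℝ}
    (hψ : ContDiff ℝ 1 ψ) (hm : ContinuousOn m (Set.Icc 0 1))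
    (hu : ∀ x ∈ closedBall (0 : E2) 1, |u x| ^ (p - 1) = m ‖x‖) :
    quadForm α p u ψ =
      ∫ r in (0 : ℝ)..1, radialDensity (fun r => p * (r ^ (2 + α) * m r)) ψ r := by
  have hD := hψ.continuous_fderiv one_ne_zero
  have hc0 := hψ.continuous
  have hmn : ContinuousOn (fun x : E2 => m ‖x‖) (closedBall 0 1) :=
    hm.comp continuous_norm.continuousOn fun x hx =>
      ⟨norm_nonneg x, mem_closedBall_zero_iff.1 hx⟩
  have hwt : ContinuousOn (fun x : E2 => ‖x‖ ^ α * m ‖x‖ * ψ x ^ 2) (closedBall 0 1) :=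
    (((continuous_norm.rpow_const fun _ => Or.inr hα).continuousOn.mul hmn).mul
      (hc0.pow 2).continuousOn)
  have h2 : ∫ x in ball (0 : E2) 1, ‖x‖ ^ α * |u x| ^ (p - 1) * ψ x ^ 2 =
      ∫ x in ball (0 : E2) 1, ‖x‖ ^ α * m ‖x‖ * ψ x ^ 2 :=
    setIntegral_congr_fun measurableSet_ball fun x hx => by
      simp only [hu x (ball_subset_closedBall hx)]
  have hint1 : IntegrableOn (fun x => ‖fderiv ℝ ψ x‖ ^ 2) (ball (0 : E2) 1) :=
    ((hD.norm.pow 2).continuousOn.integrableOn_compact (isCompact_closedBall 0 1)).mono_set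
      ball_subset_closedBall
  have hint2 : IntegrableOn (fun x : E2 => ‖x‖ ^ α * m ‖x‖ * ψ x ^ 2) (ball (0 : E2) 1) :=
    (hwt.integrableOn_compact (isCompact_closedBall 0 1)).mono_set ball_subset_closedBall
  rw [quadForm, h2, ← integral_const_mul, ← integral_sub hint1 (hint2.const_mul p)]
  rw [integral_ball_eq_polar (F := fun x => ‖fderiv ℝ ψ x‖ ^ 2 - p * (‖x‖ ^ α * m ‖x‖ * ψ x ^ 2))
    ((hD.norm.pow 2).continuousOn.sub (continuousOn_const.mul hwt))]
  rw [intervalIntegral.integral_of_le zero_le_one, intervalIntegral.integral_of_le zero_le_one]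
  refine setIntegral_congr_fun measurableSet_Ioc fun r hr => ?_
  have hr0 := hr.1.ne'
  have cR : Continuous fun θ => polR ψ r θ ^ 2 :=
    ((continuous_polR hψ).comp (Continuous.prodMk_right r)).pow 2
  have cA : Continuous fun θ => polA ψ r θ ^ 2 :=
    ((continuous_polA hψ).comp (Continuous.prodMk_right r)).pow 2
  have c0 : Continuous fun θ => pol ψ r θ ^ 2 :=
    ((continuous_pol hψ).comp (Continuous.prodMk_right r)).pow 2
  have e : ∀ θ, ‖fderiv ℝ ψ (r • eRad θ)‖ ^ 2 -
      p * (‖r • eRad θ‖ ^ α * m ‖r • eRad θ‖ * ψ (r • eRad θ) ^ 2) =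
      polR ψ r θ ^ 2 + (r ^ 2)⁻¹ * polA ψ r θ ^ 2 - p * r ^ α * m r * pol ψ r θ ^ 2 := fun θ => by
    rw [norm_smul_eRad hr.1.le, norm_sq_eq_rotated _ θ, polR, polA, pol]
    field_simp
  simp only [e]
  rw [intervalIntegral.integral_sub, intervalIntegral.integral_add,
    intervalIntegral.integral_const_mul, intervalIntegral.integral_const_mul]
  · have e2 : r ^ (2 + α) = r ^ 2 * r ^ α := by rw [Real.rpow_add hr.1, Real.rpow_two]
    simp only [radialDensity, circleSq, e2]
    field_simp
  · exact cR.intervalIntegrable _ _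
  · exact (cA.const_mul _).intervalIntegrable _ _
  · exact (cR.add (cA.const_mul _)).intervalIntegrable _ _
  · exact (c0.const_mul _).intervalIntegrable _ _

lemma hasDerivAt_intervalIntegral_of_continuous {E : Type*} [NormedAddCommGroup E]
    [NormedSpace ℝ E] {G G' : ℝ → ℝ → E} {a b : ℝ}
    (hG : Continuous fun q : ℝ × ℝ => G q.1 q.2) (hG' : Continuous fun q : ℝ × ℝ => G' q.1 q.2)
    (hd : ∀ r θ, HasDerivAt (fun r => G r θ) (G' r θ) r) (r : ℝ) :
    HasDerivAt (fun r => ∫ θ in a..b, G r θ) (∫ θ in a..b, G' r θ) r := by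
  obtain ⟨M, hM⟩ := ((isCompact_Icc (a := r - 1) (b := r + 1)).prod
    (isCompact_uIcc (a := a) (b := b))).exists_bound_of_continuousOn hG'.continuousOn
  refine (intervalIntegral.hasDerivAt_integral_of_dominated_loc_of_deriv_le
    (s := Set.Icc (r - 1) (r + 1)) (bound := fun _ => M)
    (Icc_mem_nhds (by linarith) (by linarith)) ?_ ?_ ?_ ?_ ?_ ?_).2
  · exact Eventually.of_forall fun s =>
      (hG.comp (Continuous.prodMk_right s)).aestronglyMeasurable
  · exact (hG.comp (Continuous.prodMk_right r)).intervalIntegrable _ _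
  · exact (hG'.comp (Continuous.prodMk_right r)).aestronglyMeasurable
  · exact ae_of_all _ fun θ hθ s hs => hM (s, θ) ⟨hs, Set.uIoc_subset_uIcc hθ⟩
  · simp
  · exact ae_of_all _ fun θ _ s _ => hd s θ

/-- The (unnormalized) `k`-th Fourier coefficient in the angular variable. -/
def angCoeff (F : ℝ → ℝ → ℝ) (k : ℤ) (r : ℝ) : ℂ :=
  ∫ θ in (-π)..π, Complex.exp (-(k * θ) * Complex.I) * (F r θ : ℂ)

lemma hasDerivAt_angCoeff {F F' : ℝ → ℝ → ℝ} (hF : Continuous fun q : ℝ × ℝ => F q.1 q.2)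
    (hF' : Continuous fun q : ℝ × ℝ => F' q.1 q.2)
    (hd : ∀ r θ, HasDerivAt (fun r => F r θ) (F' r θ) r) (k : ℤ) (r : ℝ) :
    HasDerivAt (angCoeff F k) (angCoeff F' k r) r := by
  refine hasDerivAt_intervalIntegral_of_continuous
    (G := fun r θ => Complex.exp (-(k * θ) * Complex.I) * (F r θ : ℂ))
    (G' := fun r θ => Complex.exp (-(k * θ) * Complex.I) * (F' r θ : ℂ)) ?_ ?_ ?_ r
  · have := Complex.continuous_ofReal.comp hF
    simp only [Function.comp_def] at this
    fun_prop
  · have := Complex.continuous_ofReal.comp hF'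
    simp only [Function.comp_def] at this
    fun_prop
  · exact fun r θ => ((hd r θ).ofReal_comp).const_mul _

lemma fourierCoeffOn_eq_angCoeff (F : ℝ → ℝ → ℝ) (k : ℤ) (r : ℝ) :
    fourierCoeffOn (neg_lt_self Real.pi_pos) (fun θ => (F r θ : ℂ)) k =
      (2 * π : ℂ)⁻¹ * angCoeff F k r := by
  rw [fourierCoeffOn_eq_integral, angCoeff]
  have h : ∀ θ : ℝ, fourier (-k) (θ : AddCircle (π - -π)) =
      Complex.exp (-(k * θ) * Complex.I) := fun θ => by
    rw [fourier_coe_apply]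
    congr 1
    have : (π : ℂ) ≠ 0 := by exact_mod_cast Real.pi_ne_zero
    push_cast
    field_simp
    ring
  simp only [h, smul_eq_mul]
  rw [Complex.real_smul]
  congr 1
  push_cast
  ring

lemma hasSum_sq_angCoeff {F : ℝ → ℝ → ℝ} {r : ℝ} (hF : Continuous (F r)) :
    HasSum (fun k : ℤ => ‖angCoeff F k r‖ ^ 2 / (2 * π)) (circleSq F r) := by
  have hmem : MemLp (fun θ => (F r θ : ℂ)) 2 (volume.restrict (Set.Ioc (-π) π)) := by
    have hc : Continuous fun θ => (F r θ : ℂ) := Complex.continuous_ofReal.comp hF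
    obtain ⟨M, hM⟩ :=
      (isCompact_Icc (a := -π) (b := π)).exists_bound_of_continuousOn hc.continuousOn
    refine MemLp.of_bound hc.aestronglyMeasurable M ?_
    filter_upwards [ae_restrict_mem measurableSet_Ioc] with θ hθ
    exact hM θ (Set.Ioc_subset_Icc_self hθ)
  have h := hasSum_sq_fourierCoeffOn (neg_lt_self Real.pi_pos) hmem
  have h2 := h.mul_left (2 * π)
  have hpi := Real.pi_pos
  convert! h2 using 1
  · ext k
    rw [fourierCoeffOn_eq_angCoeff, norm_mul, norm_inv, mul_pow]
    simp [abs_of_pos hpi]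
    field_simp
  · rw [circleSq]
    simp only [Complex.norm_real, Real.norm_eq_abs, sq_abs, smul_eq_mul]
    field_simp
    ring

lemma angCoeff_deriv {F F' : ℝ → ℝ → ℝ} {r : ℝ} (hd : ∀ θ, HasDerivAt (F r) (F' r θ) θ)
    (hF' : Continuous (F' r)) (hper : F r π = F r (-π)) (k : ℤ) :
    angCoeff F' k r = Complex.I * k * angCoeff F k r := by
  rcases eq_or_ne k 0 with rfl | hk
  · have h : ∀ θ ∈ Set.uIcc (-π) π, HasDerivAt (fun θ => (F r θ : ℂ)) (F' r θ : ℂ) θ :=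
      fun θ _ => (hd θ).ofReal_comp
    have := intervalIntegral.integral_eq_sub_of_hasDerivAt h
      ((Complex.continuous_ofReal.comp hF').intervalIntegrable _ _)
    simp [angCoeff, this, hper]
  · have h := fourierCoeffOn_of_hasDerivAt (neg_lt_self Real.pi_pos) hk
      (f := fun θ => (F r θ : ℂ)) (f' := fun θ => (F' r θ : ℂ))
      (fun θ _ => (hd θ).ofReal_comp) ((Complex.continuous_ofReal.comp hF').intervalIntegrable _ _)
    rw [fourierCoeffOn_eq_angCoeff, fourierCoeffOn_eq_angCoeff, hper] at h
    have hpi : (π : ℂ) ≠ 0 := by exact_mod_cast Real.pi_ne_zero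
    have hk' : (k : ℂ) ≠ 0 := by exact_mod_cast hk
    have hI := Complex.I_ne_zero
    push_cast at h
    field_simp at h
    linear_combination -(1 / 2) * h

lemma norm_sq_angCoeff_deriv {F F' : ℝ → ℝ → ℝ} {r : ℝ} (hd : ∀ θ, HasDerivAt (F r) (F' r θ) θ)
    (hF' : Continuous (F' r)) (hper : F r π = F r (-π)) (k : ℤ) :
    ‖angCoeff F' k r‖ ^ 2 = (k : ℝ) ^ 2 * ‖angCoeff F k r‖ ^ 2 := by
  rw [angCoeff_deriv hd hF' hper, norm_mul, norm_mul, Complex.norm_I, one_mul, mul_pow]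
  simp

lemma angCoeff_neg (F : ℝ → ℝ → ℝ) (k : ℤ) (r : ℝ) :
    angCoeff F (-k) r = (starRingEnd ℂ) (angCoeff F k r) := by
  have hpi : -π ≤ π := by linarith [Real.pi_pos]
  rw [angCoeff, angCoeff, intervalIntegral.integral_of_le hpi, intervalIntegral.integral_of_le hpi,
    ← integral_conj]
  congr 1
  ext θ
  rw [map_mul, ← Complex.exp_conj]
  simp

/-- The part of `∫ F ^ 2` not carried by the angular modes `|k| ≤ K`. -/
def highSq (K : ℕ) (F : ℝ → ℝ → ℝ) (r : ℝ) : ℝ :=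
  circleSq F r - ∑ k ∈ Finset.Icc (-(K : ℤ)) K, ‖angCoeff F k r‖ ^ 2 / (2 * π)

lemma highSq_nonneg (K : ℕ) {F : ℝ → ℝ → ℝ} {r : ℝ} (hF : Continuous (F r)) :
    0 ≤ highSq K F r :=
  sub_nonneg.2 (sum_le_hasSum _ (fun _ _ => by positivity) (hasSum_sq_angCoeff hF))

/-- Wirtinger's inequality with the low modes separated. -/
lemma le_circleSq_deriv (K : ℕ) {F F' : ℝ → ℝ → ℝ} {r : ℝ}
    (hd : ∀ θ, HasDerivAt (F r) (F' r θ) θ) (hF' : Continuous (F' r))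
    (hper : F r π = F r (-π)) :
    ∑ k ∈ Finset.Icc (-(K : ℤ)) K, (k : ℝ) ^ 2 * (‖angCoeff F k r‖ ^ 2 / (2 * π)) +
      ((K : ℝ) + 1) ^ 2 * highSq K F r ≤ circleSq F' r := by
  have hF : Continuous (F r) := continuous_iff_continuousAt.2 fun θ => (hd θ).continuousAt
  have h1 := hasSum_sq_angCoeff hF
  have h2 := hasSum_sq_angCoeff hF'
  simp only [norm_sq_angCoeff_deriv hd hF' hper] at h2
  have h3 := sum_le_hasSum (Finset.Icc (-(K : ℤ)) K) ?_ (h2.sub (h1.mul_left (((K : ℝ) + 1) ^ 2)))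
  · rw [Finset.sum_sub_distrib, ← Finset.mul_sum] at h3
    rw [highSq]
    simp only [mul_div_assoc] at h3
    linarith
  · intro k hk
    have hk' : ((K : ℝ) + 1) ^ 2 ≤ (k : ℝ) ^ 2 := by
      have : (K : ℤ) + 1 ≤ |k| := by
        rw [Finset.mem_Icc, ← abs_le] at hk; omega
      have h : ((K : ℝ) + 1) ≤ |(k : ℝ)| := by exact_mod_cast this
      rw [← sq_abs (k : ℝ)]
      gcongr
    have : 0 ≤ ‖angCoeff F k r‖ ^ 2 / (2 * π) := by positivity
    have e : (k : ℝ) ^ 2 * ‖angCoeff F k r‖ ^ 2 / (2 * π) -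
      ((K : ℝ) + 1) ^ 2 * (‖angCoeff F k r‖ ^ 2 / (2 * π)) =
      ((k : ℝ) ^ 2 - ((K : ℝ) + 1) ^ 2) * (‖angCoeff F k r‖ ^ 2 / (2 * π)) := by ring
    rw [e]
    exact mul_nonneg (by linarith) this

lemma sub_le_integral_of_hasDerivAt_off_finset {B B' φ : ℝ → ℝ} (Z : Finset ℝ) :
    ∀ {a b : ℝ}, a ≤ b → ContinuousOn B (Set.Icc a b) →
      (∀ r ∈ Set.Ioo a b, r ∉ Z → HasDerivAt B (B' r) r ∧ B' r ≤ φ r) →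
      IntervalIntegrable φ volume a b → B b - B a ≤ ∫ r in a..b, φ r := by
  classical
  induction Z using Finset.induction with
  | empty =>
    intro a b hab hB hd hφ
    refine intervalIntegral.sub_le_integral_of_hasDeriv_right_of_le hab hB
      (fun r hr => (hd r hr (by simp)).1.hasDerivWithinAt) ?_ (fun r hr => (hd r hr (by simp)).2)
    exact (intervalIntegrable_iff_integrableOn_Icc_of_le hab).1 hφ
  | insert ζ Z hζ ih =>
    intro a b hab hB hd hφ
    by_cases hmem : ζ ∈ Set.Ioo a b
    · have hζ' : ζ ∈ Set.uIcc a b := by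
        rw [Set.uIcc_of_le hab]; exact Set.Ioo_subset_Icc_self hmem
      have i1 : IntervalIntegrable φ volume a ζ :=
        hφ.mono_set (Set.uIcc_subset_uIcc Set.left_mem_uIcc hζ')
      have i2 : IntervalIntegrable φ volume ζ b :=
        hφ.mono_set (Set.uIcc_subset_uIcc hζ' Set.right_mem_uIcc)
      have h1 := ih hmem.1.le (hB.mono (Set.Icc_subset_Icc_right hmem.2.le))
        (fun r hr hrZ => hd r ⟨hr.1, hr.2.trans hmem.2⟩
          (by simp [hrZ, hr.2.ne])) i1
      have h2 := ih hmem.2.le (hB.mono (Set.Icc_subset_Icc_left hmem.1.le))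
        (fun r hr hrZ => hd r ⟨hmem.1.trans hr.1, hr.2⟩
          (by simp [hrZ, hr.1.ne'])) i2
      rw [← intervalIntegral.integral_add_adjacent_intervals i1 i2]
      linarith
    · refine ih hab hB (fun r hr hrZ => hd r hr ?_) hφ
      rw [Finset.mem_insert, not_or]
      exact ⟨fun h => hmem (h ▸ hr), hrZ⟩

lemma tendsto_div_of_hasDerivAt_of_eq_zero {S h : ℝ → ℝ} {h' x : ℝ} (hS : HasDerivAt S 0 x)
    (hS0 : S x = 0) (hh : HasDerivAt h h' x) (hh0 : h x = 0) (hh' : h' ≠ 0) :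
    Tendsto (fun r => S r / h r) (𝓝 x) (𝓝 0) := by
  have h1 := (hasDerivAt_iff_tendsto_slope.1 hS).div (hasDerivAt_iff_tendsto_slope.1 hh) hh'
  rw [zero_div] at h1
  have h2 : Tendsto (fun r => S r / h r) (𝓝[≠] x) (𝓝 0) := by
    refine h1.congr' ?_
    filter_upwards [self_mem_nhdsWithin] with r hr
    have : r - x ≠ 0 := sub_ne_zero.2 hr
    simp only [Pi.div_apply, slope_def_field, hS0, hh0, sub_zero]
    field_simp
  have h3 : ContinuousAt (fun r => S r / h r) x := by
    rw [continuousAt_iff_punctured_nhds]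
    simpa [hS0] using h2
  simpa [ContinuousAt, hS0] using h3

/-- Picone's inequality: the quotient `S k / h` has derivative at most `r S₁ - P S / r`, and it
is continuous across simple zeros of `h` at which `S` vanishes to second order or identically. -/
lemma EulerPair.picone {h k P S S' S₁ φ : ℝ → ℝ} (H : EulerPair h k P (Set.Ioi 0))
    (hS : ∀ r, HasDerivAt S (S' r) r) (hq : ∀ r q, 0 ≤ S₁ r - q * S' r + q ^ 2 * S r)
    {a b : ℝ} (ha : 0 < a) (hab : a ≤ b) (Z : Finset ℝ)
    (hZ : ∀ r ∈ Set.Icc a b, h r = 0 →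
      r ∈ Z ∧ ((S r = 0 ∧ S' r = 0 ∧ k r ≠ 0) ∨ S =ᶠ[𝓝 r] 0))
    (hφ : IntervalIntegrable φ volume a b)
    (hle : ∀ r ∈ Set.Ioo a b, r * S₁ r - P r * S r / r ≤ φ r) :
    S b * k b / h b - S a * k a / h a ≤ ∫ r in a..b, φ r := by
  refine sub_le_integral_of_hasDerivAt_off_finset (B := fun r => S r * k r / h r)
    (B' := fun r => k r / h r * S' r - P r * S r / r - (k r / h r) ^ 2 * S r / r) Z hab ?_ ?_ hφ
  · intro r hr
    have hr0 : 0 < r := ha.trans_le hr.1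
    obtain ⟨h1, h2⟩ := H r hr0
    refine ContinuousAt.continuousWithinAt ?_
    by_cases hhr : h r = 0
    · rcases (hZ r hr hhr).2 with ⟨hSr, hS'r, hkr⟩ | hS0
      swap
      · refine (continuousAt_const (y := (0 : ℝ))).congr ?_
        filter_upwards [hS0] with s hs
        simp [hs]
      have h3 := tendsto_div_of_hasDerivAt_of_eq_zero (hS'r ▸ hS r) hSr h1 hhr
        (div_ne_zero hkr hr0.ne')
      have h4 := h3.mul h2.continuousAt.tendsto
      have e : (fun r => S r * k r / h r) = fun r => S r / h r * k r := by ext; ring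
      rw [e, ContinuousAt]
      simpa [hSr] using h4
    · exact ((hS r).continuousAt.mul h2.continuousAt).div h1.continuousAt hhr
  · intro r hr hrZ
    have hr0 : 0 < r := ha.trans hr.1
    have hhr : h r ≠ 0 := fun h0 => hrZ (hZ r (Set.Ioo_subset_Icc_self hr) h0).1
    obtain ⟨h1, h2⟩ := H r hr0
    constructor
    · refine (((hS r).mul h2).div h1 hhr).congr_deriv ?_
      simp only [Pi.mul_apply]
      field_simp
      ring
    · refine le_trans ?_ (hle r hr)
      have := mul_nonneg hr0.le (hq r (k r / h r / r))
      have e : r * (S₁ r - k r / h r / r * S' r + (k r / h r / r) ^ 2 * S r) =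
          r * S₁ r - k r / h r * S' r + (k r / h r) ^ 2 * S r / r := by
        field_simp
      linarith

lemma norm_sq_sub_nonneg (c c' : ℂ) (q : ℝ) :
    0 ≤ ‖c'‖ ^ 2 - q * (2 * (c.re * c'.re + c.im * c'.im)) + q ^ 2 * ‖c‖ ^ 2 := by
  have h1 : ‖c‖ ^ 2 = c.re ^ 2 + c.im ^ 2 := by rw [Complex.sq_norm, Complex.normSq_apply]; ring
  have h2 : ‖c'‖ ^ 2 = c'.re ^ 2 + c'.im ^ 2 := by
    rw [Complex.sq_norm, Complex.normSq_apply]; ring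
  rw [h1, h2]
  nlinarith [sq_nonneg (c'.re - q * c.re), sq_nonneg (c'.im - q * c.im)]

lemma hasDerivAt_norm_sq_complex {c : ℝ → ℂ} {c' : ℂ} {r : ℝ} (hc : HasDerivAt c c' r) :
    HasDerivAt (fun r => ‖c r‖ ^ 2) (2 * ((c r).re * c'.re + (c r).im * c'.im)) r := by
  have h := hc.norm_sq
  refine h.congr_deriv ?_
  rw [Complex.inner]
  simp [Complex.mul_re]
  ring

lemma tendsto_besselD_div_besselJ {β : ℝ} (hβ : 0 ≤ β) :
    Tendsto (fun t => besselD β t / besselJ β t) (𝓝[>] 0) (𝓝 β) := by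
  have c0 := continuous_besselG hβ
  have c1 := continuous_besselG (β := β + 1) (by positivity)
  have hne : besselG β ((0 / 2) ^ 2) ≠ 0 := by
    simpa using (besselG_zero_pos hβ).ne'
  have h : ContinuousAt (fun t : ℝ => (β * besselG β ((t / 2) ^ 2) -
      t ^ 2 / 2 * besselG (β + 1) ((t / 2) ^ 2)) / besselG β ((t / 2) ^ 2)) 0 :=
    ContinuousAt.div (by fun_prop) (by fun_prop) hne
  have h' := h.tendsto
  have e : (β * besselG β (((0 : ℝ) / 2) ^ 2) - (0 : ℝ) ^ 2 / 2 *
      besselG (β + 1) (((0 : ℝ) / 2) ^ 2)) / besselG β (((0 : ℝ) / 2) ^ 2) = β := by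
    simp only [zero_div, ne_eq, OfNat.ofNat_ne_zero, not_false_eq_true, zero_pow, zero_mul,
      sub_zero]
    exact mul_div_cancel_right₀ _ (besselG_zero_pos hβ).ne'
  rw [e] at h'
  refine (h'.mono_left nhdsWithin_le_nhds).congr' ?_
  filter_upwards [self_mem_nhdsWithin] with t ht
  have : t ^ β ≠ 0 := (Real.rpow_pos_of_pos ht β).ne'
  rw [besselD, besselJ_eq, mul_div_mul_left _ _ this]

lemma eulerPair_bessel_rpow {β c : ℝ} (hβ : 0 ≤ β) (hc : 0 < c) (κ : ℝ) :
    EulerPair (fun r => besselJ β (c * r ^ κ)) (fun r => κ * besselD β (c * r ^ κ))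
      (fun r => κ ^ 2 * ((c * r ^ κ) ^ 2 - β ^ 2)) (Set.Ioi 0) :=
  (eulerPair_bessel hβ).comp_rpow hc fun _ hr =>
    ⟨hr, mul_pos hc (Real.rpow_pos_of_pos hr κ)⟩

lemma tendsto_mul_rpow_nhdsGT {c κ : ℝ} (hc : 0 < c) (hκ : 0 < κ) :
    Tendsto (fun r : ℝ => c * r ^ κ) (𝓝[>] 0) (𝓝[>] 0) := by
  rw [tendsto_nhdsWithin_iff]
  constructor
  · have h : ContinuousAt (fun r : ℝ => c * r ^ κ) 0 :=
      (continuous_const.mul (Real.continuous_rpow_const hκ.le)).continuousAt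
    have h' := h.tendsto
    simp only [Real.zero_rpow hκ.ne', mul_zero] at h'
    exact h'.mono_left nhdsWithin_le_nhds
  · filter_upwards [self_mem_nhdsWithin] with r hr
    exact mul_pos hc (Real.rpow_pos_of_pos hr κ)

/-- The quadratic form of one angular mode with density `S` and radial derivative `S₁` is
nonnegative up to a boundary term which vanishes at the origin. -/
def ModeBound (W : ℝ → ℝ) (m : ℝ) (S S₁ : ℝ → ℝ) : Prop :=
  ∃ B : ℝ → ℝ, Tendsto B (𝓝[>] 0) (𝓝 0) ∧ ∀ δ ∈ Set.Ioo (0 : ℝ) 1,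
    IntervalIntegrable (fun r => r * S₁ r + (m - W r) * S r / r) volume δ 1 ∧
    -B δ ≤ ∫ r in δ..1, (r * S₁ r + (m - W r) * S r / r)

/-- Lower bound for one angular mode by comparison with a Bessel function. -/
lemma exists_mode_lower_bound {β c κ m : ℝ} (hβ : 0 ≤ β) (hc : 0 < c) (hκ : 0 < κ)
    {S S' S₁ W : ℝ → ℝ} (hS : ∀ r, HasDerivAt S (S' r) r)
    (hq : ∀ r q, 0 ≤ S₁ r - q * S' r + q ^ 2 * S r) (hS₁ : Continuous S₁) (hnn : ∀ r, 0 ≤ S r)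
    (h1 : S =ᶠ[𝓝 1] 0) (h0 : S 0 * β = 0) (hW : ContinuousOn W (Set.Ioc 0 1))
    (hWle : ∀ r ∈ Set.Ioo (0 : ℝ) 1, W r - m ≤ κ ^ 2 * ((c * r ^ κ) ^ 2 - β ^ 2)) (Z : Finset ℝ)
    (hZ : ∀ r ∈ Set.Ioo (0 : ℝ) 1, besselJ β (c * r ^ κ) = 0 →
      r ∈ Z ∧ S r = 0 ∧ S' r = 0 ∧ besselD β (c * r ^ κ) ≠ 0) :
    ModeBound W m S S₁ := by
  have hSc : Continuous S := continuous_iff_continuousAt.2 fun r => (hS r).continuousAt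
  refine ⟨fun r => S r * (κ * besselD β (c * r ^ κ)) / besselJ β (c * r ^ κ), ?_, ?_⟩
  · have h2 := ((tendsto_besselD_div_besselJ hβ).comp (tendsto_mul_rpow_nhdsGT hc hκ)).const_mul κ
    have h3 := ((hSc.tendsto 0).mono_left nhdsWithin_le_nhds).mul h2
    rw [show S 0 * (κ * β) = 0 by linear_combination κ * h0] at h3
    refine h3.congr fun r => ?_
    simp only [Function.comp]
    ring
  · intro δ hδ
    have hInt : IntervalIntegrable (fun r => r * S₁ r + (m - W r) * S r / r) volume δ 1 := by
      refine ContinuousOn.intervalIntegrable ?_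
      rw [Set.uIcc_of_le hδ.2.le]
      have hsub : Set.Icc δ 1 ⊆ Set.Ioc (0 : ℝ) 1 := fun r hr => ⟨hδ.1.trans_le hr.1, hr.2⟩
      refine (continuousOn_id.mul hS₁.continuousOn).add (ContinuousOn.div
        ((continuousOn_const.sub (hW.mono hsub)).mul hSc.continuousOn) continuousOn_id
        fun r hr => (hδ.1.trans_le hr.1).ne')
    refine ⟨hInt, ?_⟩
    have h2 := (eulerPair_bessel_rpow hβ hc κ).picone hS hq hδ.1 hδ.2.le (insert 1 Z) ?_ hInt ?_
    · simp only [h1.self_of_nhds, Pi.zero_apply, zero_mul, zero_div, zero_sub] at h2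
      exact h2
    · intro r hr hr0
      rcases hr.2.eq_or_lt with rfl | hlt
      · exact ⟨Finset.mem_insert_self _ _, Or.inr h1⟩
      · obtain ⟨a1, a2, a3, a4⟩ := hZ r ⟨hδ.1.trans_le hr.1, hlt⟩ hr0
        exact ⟨Finset.mem_insert_of_mem a1, Or.inl ⟨a2, a3, mul_ne_zero hκ.ne' a4⟩⟩
    · intro r hr
      have hr0 : 0 < r := hδ.1.trans hr.1
      have h3 := mul_le_mul_of_nonneg_right (hWle r ⟨hr0, hr.2⟩) (hnn r)
      have h4 := div_le_div_of_nonneg_right h3 hr0.le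
      have e : (m - W r) * S r / r = -((W r - m) * S r / r) := by ring
      rw [e]
      linarith

lemma continuous_angCoeff {F : ℝ → ℝ → ℝ} (hF : Continuous fun q : ℝ × ℝ => F q.1 q.2) (k : ℤ) :
    Continuous (angCoeff F k) := by
  refine intervalIntegral.continuous_parametric_intervalIntegral_of_continuous'
    (f := fun r θ => Complex.exp (-(k * θ) * Complex.I) * (F r θ : ℂ)) ?_ _ _
  have := Complex.continuous_ofReal.comp hF
  simp only [Function.comp_def] at this
  simp only [Function.uncurry_def]
  fun_prop

lemma continuous_highSq (K : ℕ) {F : ℝ → ℝ → ℝ} (hF : Continuous fun q : ℝ × ℝ => F q.1 q.2) :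
    Continuous (highSq K F) := by
  unfold highSq
  have h1 := continuous_circleSq hF
  have h2 := continuous_angCoeff hF
  fun_prop

lemma hasDerivAt_circleSq {F F' : ℝ → ℝ → ℝ} (hF : Continuous fun q : ℝ × ℝ => F q.1 q.2)
    (hF' : Continuous fun q : ℝ × ℝ => F' q.1 q.2)
    (hd : ∀ r θ, HasDerivAt (fun r => F r θ) (F' r θ) r) (r : ℝ) :
    HasDerivAt (circleSq F) (∫ θ in (-π)..π, 2 * (F r θ * F' r θ)) r := by
  refine hasDerivAt_intervalIntegral_of_continuous (G := fun r θ => F r θ ^ 2)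
    (G' := fun r θ => 2 * (F r θ * F' r θ)) (by fun_prop) (by fun_prop) (fun r θ => ?_) r
  refine ((hd r θ).pow 2).congr_deriv ?_
  simp; ring

/-- The derivative of `highSq K F`, where `F'` is the radial derivative of `F`. -/
def highCross (K : ℕ) (F F' : ℝ → ℝ → ℝ) (r : ℝ) : ℝ :=
  (∫ θ in (-π)..π, 2 * (F r θ * F' r θ)) - ∑ k ∈ Finset.Icc (-(K : ℤ)) K,
    2 * ((angCoeff F k r).re * (angCoeff F' k r).re +
      (angCoeff F k r).im * (angCoeff F' k r).im) / (2 * π)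

lemma hasDerivAt_highSq (K : ℕ) {F F' : ℝ → ℝ → ℝ} (hF : Continuous fun q : ℝ × ℝ => F q.1 q.2)
    (hF' : Continuous fun q : ℝ × ℝ => F' q.1 q.2)
    (hd : ∀ r θ, HasDerivAt (fun r => F r θ) (F' r θ) r) (r : ℝ) :
    HasDerivAt (highSq K F) (highCross K F F' r) r := by
  refine (hasDerivAt_circleSq hF hF' hd r).sub (HasDerivAt.fun_sum fun k _ => ?_)
  exact (hasDerivAt_norm_sq_complex (hasDerivAt_angCoeff hF hF' hd k r)).div_const _

lemma highSq_sub_smul_nonneg (K : ℕ) {F F' : ℝ → ℝ → ℝ} {r : ℝ} (hF : Continuous (F r))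
    (hF' : Continuous (F' r)) (q : ℝ) :
    0 ≤ highSq K F' r - q * highCross K F F' r + q ^ 2 * highSq K F r := by
  have h := highSq_nonneg K (F := fun r θ => F' r θ - q * F r θ) (r := r) (by fun_prop)
  have hc : ∀ k : ℤ, angCoeff (fun r θ => F' r θ - q * F r θ) k r =
      angCoeff F' k r - q * angCoeff F k r := fun k => by
    have cF := Complex.continuous_ofReal.comp hF
    have cF' := Complex.continuous_ofReal.comp hF'
    simp only [Function.comp_def] at cF cF'
    rw [angCoeff, angCoeff, angCoeff, ← intervalIntegral.integral_const_mul,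
      ← intervalIntegral.integral_sub (Continuous.intervalIntegrable (by fun_prop) _ _)
        (Continuous.intervalIntegrable (by fun_prop) _ _)]
    congr 1
    ext θ
    push_cast
    ring
  have hs : circleSq (fun r θ => F' r θ - q * F r θ) r = circleSq F' r -
      q * (∫ θ in (-π)..π, 2 * (F r θ * F' r θ)) + q ^ 2 * circleSq F r := by
    simp only [circleSq]
    rw [← intervalIntegral.integral_const_mul, ← intervalIntegral.integral_const_mul,
      ← intervalIntegral.integral_sub (Continuous.intervalIntegrable (by fun_prop) _ _)
        (Continuous.intervalIntegrable (by fun_prop) _ _),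
      ← intervalIntegral.integral_add (Continuous.intervalIntegrable (by fun_prop) _ _)
        (Continuous.intervalIntegrable (by fun_prop) _ _)]
    congr 1
    ext θ
    ring
  have hn : ∀ k : ℤ, ‖angCoeff F' k r - q * angCoeff F k r‖ ^ 2 / (2 * π) =
      ‖angCoeff F' k r‖ ^ 2 / (2 * π) -
      q * (2 * ((angCoeff F k r).re * (angCoeff F' k r).re +
        (angCoeff F k r).im * (angCoeff F' k r).im) / (2 * π)) +
      q ^ 2 * (‖angCoeff F k r‖ ^ 2 / (2 * π)) := fun k => by
    simp only [Complex.sq_norm, Complex.normSq_apply, Complex.sub_re, Complex.sub_im,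
      Complex.re_ofReal_mul, Complex.im_ofReal_mul]
    ring
  rw [highSq, hs] at h
  simp only [hc, hn] at h
  rw [Finset.sum_add_distrib, Finset.sum_sub_distrib, ← Finset.mul_sum, ← Finset.mul_sum] at h
  simp only [highSq, highCross]
  linarith

lemma modes_le_radialDensity (K : ℕ) {ψ : E2 → ℝ} (hψ : ContDiff ℝ 1 ψ) (W : ℝ → ℝ) {r : ℝ}
    (hr : 0 < r) :
    ∑ k ∈ Finset.Icc (-(K : ℤ)) K, (r * ‖angCoeff (polR ψ) k r‖ ^ 2 +
        ((k : ℝ) ^ 2 - W r) * ‖angCoeff (pol ψ) k r‖ ^ 2 / r) / (2 * π) +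
      (r * highSq K (polR ψ) r + (((K : ℝ) + 1) ^ 2 - W r) * highSq K (pol ψ) r / r) ≤
      radialDensity W ψ r := by
  have hA : Continuous (polA ψ r) := by
    have := continuous_polA hψ
    exact this.comp (by fun_prop : Continuous fun θ : ℝ => (r, θ))
  have h := le_circleSq_deriv K (F := pol ψ) (F' := polA ψ) (r := r)
    (fun θ => hasDerivAt_pol_right hψ r θ) hA (by simp [pol, eRad])
  have h2 := div_le_div_of_nonneg_right h hr.le
  have e : ∑ k ∈ Finset.Icc (-(K : ℤ)) K, (r * ‖angCoeff (polR ψ) k r‖ ^ 2 +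
        ((k : ℝ) ^ 2 - W r) * ‖angCoeff (pol ψ) k r‖ ^ 2 / r) / (2 * π) =
      r * ∑ k ∈ Finset.Icc (-(K : ℤ)) K, ‖angCoeff (polR ψ) k r‖ ^ 2 / (2 * π) +
      (∑ k ∈ Finset.Icc (-(K : ℤ)) K, (k : ℝ) ^ 2 * (‖angCoeff (pol ψ) k r‖ ^ 2 / (2 * π))) / r -
      W r * (∑ k ∈ Finset.Icc (-(K : ℤ)) K, ‖angCoeff (pol ψ) k r‖ ^ 2 / (2 * π)) / r := by
    simp only [Finset.mul_sum, Finset.sum_div, ← Finset.sum_add_distrib,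
      ← Finset.sum_sub_distrib]
    exact Finset.sum_congr rfl fun k _ => by ring
  rw [e]
  simp only [radialDensity, highSq] at h2 ⊢
  rw [add_div] at h2
  have e2 : ∀ a b c S₁ S₀ T : ℝ, a = b →
    r * S₁ + T / r - W r * S₀ / r + (r * (a - S₁) + (((K : ℝ) + 1) ^ 2 - W r) * (c - S₀) / r) =
    r * b + (T / r + ((K : ℝ) + 1) ^ 2 * (c - S₀) / r) - W r * c / r := by
    intro a b c S₁ S₀ T hab
    rw [hab]
    ring
  rw [e2 _ _ _ _ _ _ rfl]
  linarith

lemma integral_radialDensity_nonneg (K : ℕ) {ψ : E2 → ℝ} (hψ : ContDiff ℝ 1 ψ) {W : ℝ → ℝ}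
    (hlow : ∀ k ∈ Finset.Icc (-(K : ℤ)) K, ModeBound W ((k : ℝ) ^ 2)
      (fun r => ‖angCoeff (pol ψ) k r‖ ^ 2) (fun r => ‖angCoeff (polR ψ) k r‖ ^ 2))
    (hhigh : ModeBound W (((K : ℝ) + 1) ^ 2) (highSq K (pol ψ)) (highSq K (polR ψ))) :
    0 ≤ ∫ r in (0 : ℝ)..1, radialDensity W ψ r := by
  by_cases hi : IntervalIntegrable (radialDensity W ψ) volume 0 1
  swap
  · rw [intervalIntegral.integral_undef hi]
  choose! B hB hBle using hlow
  obtain ⟨b, hb, hble⟩ := hhigh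
  have hlim : Tendsto (fun δ => ∫ r in δ..1, radialDensity W ψ r) (𝓝[>] 0)
      (𝓝 (∫ r in (0 : ℝ)..1, radialDensity W ψ r)) := by
    have hc := intervalIntegral.continuousOn_primitive_interval_left (μ := volume)
      (f := radialDensity W ψ) (a := 0) (b := 1)
      ((intervalIntegrable_iff_integrableOn_Icc_of_le zero_le_one).1 hi |>.mono_set
        (by rw [Set.uIcc_of_le zero_le_one]))
    have := hc 0 Set.left_mem_uIcc
    rw [Set.uIcc_of_le zero_le_one] at this
    refine this.tendsto.mono_left ?_
    rw [← nhdsWithin_Ioo_eq_nhdsGT (zero_lt_one' ℝ)]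
    exact nhdsWithin_mono _ Set.Ioo_subset_Icc_self
  have hB0 : Tendsto (fun δ => ∑ k ∈ Finset.Icc (-(K : ℤ)) K, -B k δ / (2 * π) + -b δ)
      (𝓝[>] 0) (𝓝 0) := by
    have h1 := (tendsto_finsetSum (Finset.Icc (-(K : ℤ)) K) fun k hk =>
      ((hB k hk).neg.div_const (2 * π))).add hb.neg
    simpa using h1
  refine le_of_tendsto_of_tendsto hB0 hlim ?_
  filter_upwards [Ioo_mem_nhdsGT (zero_lt_one' ℝ)] with δ hδ
  have hi' : IntervalIntegrable (radialDensity W ψ) volume δ 1 :=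
    hi.mono_set (by
      rw [Set.uIcc_of_le zero_le_one, Set.uIcc_of_le hδ.2.le]
      exact Set.Icc_subset_Icc_left hδ.1.le)
  have hs : IntervalIntegrable (fun r => ∑ k ∈ Finset.Icc (-(K : ℤ)) K,
      (r * ‖angCoeff (polR ψ) k r‖ ^ 2 +
        ((k : ℝ) ^ 2 - W r) * ‖angCoeff (pol ψ) k r‖ ^ 2 / r) / (2 * π)) volume δ 1 := by
    have := IntervalIntegrable.sum (μ := volume) (a := δ) (b := 1) (Finset.Icc (-(K : ℤ)) K)
      (f := fun k r => (r * ‖angCoeff (polR ψ) k r‖ ^ 2 +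
        ((k : ℝ) ^ 2 - W r) * ‖angCoeff (pol ψ) k r‖ ^ 2 / r) / (2 * π))
      fun k hk => ((hBle k hk δ hδ).1.div_const _)
    rwa [Finset.sum_fn] at this
  calc _ ≤ ∑ k ∈ Finset.Icc (-(K : ℤ)) K, (∫ r in δ..1, (r * ‖angCoeff (polR ψ) k r‖ ^ 2 +
        ((k : ℝ) ^ 2 - W r) * ‖angCoeff (pol ψ) k r‖ ^ 2 / r)) / (2 * π) +
      ∫ r in δ..1, (r * highSq K (polR ψ) r +
        (((K : ℝ) + 1) ^ 2 - W r) * highSq K (pol ψ) r / r) :=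
        add_le_add (Finset.sum_le_sum fun k hk => div_le_div_of_nonneg_right (hBle k hk δ hδ).2
          (by positivity)) (hble δ hδ).2
    _ = ∫ r in δ..1, (∑ k ∈ Finset.Icc (-(K : ℤ)) K, (r * ‖angCoeff (polR ψ) k r‖ ^ 2 +
        ((k : ℝ) ^ 2 - W r) * ‖angCoeff (pol ψ) k r‖ ^ 2 / r) / (2 * π) +
        (r * highSq K (polR ψ) r +
        (((K : ℝ) + 1) ^ 2 - W r) * highSq K (pol ψ) r / r)) := by
      rw [intervalIntegral.integral_add hs (hble δ hδ).1, intervalIntegral.integral_finsetSum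
        fun k hk => ((hBle k hk δ hδ).1.div_const _)]
      simp only [intervalIntegral.integral_div]
    _ ≤ _ := intervalIntegral.integral_mono_on hδ.2.le (hs.add (hble δ hδ).1) hi'
      fun r hr => modes_le_radialDensity K hψ W (hδ.1.trans_le hr.1)

lemma modeBound_angCoeff {β c κ m : ℝ} (hβ : 0 ≤ β) (hc : 0 < c) (hκ : 0 < κ) {ψ : E2 → ℝ}
    (hψ : ContDiff ℝ 1 ψ) (hsupp : ∀ᶠ r in 𝓝 (1 : ℝ), ∀ θ, pol ψ r θ = 0) (k : ℤ)
    (h0 : angCoeff (pol ψ) k 0 = 0 ∨ β = 0) {W : ℝ → ℝ}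
    (hW : ContinuousOn W (Set.Ioc 0 1))
    (hWle : ∀ r ∈ Set.Ioo (0 : ℝ) 1, W r - m ≤ κ ^ 2 * ((c * r ^ κ) ^ 2 - β ^ 2)) (Z : Finset ℝ)
    (hZ : ∀ r ∈ Set.Ioo (0 : ℝ) 1, besselJ β (c * r ^ κ) = 0 →
      r ∈ Z ∧ angCoeff (pol ψ) k r = 0 ∧ besselD β (c * r ^ κ) ≠ 0) :
    ModeBound W m (fun r => ‖angCoeff (pol ψ) k r‖ ^ 2)
      (fun r => ‖angCoeff (polR ψ) k r‖ ^ 2) := by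
  have c0 := continuous_pol hψ
  have cR := continuous_polR hψ
  refine exists_mode_lower_bound hβ hc hκ
    (S' := fun r => 2 * ((angCoeff (pol ψ) k r).re * (angCoeff (polR ψ) k r).re +
      (angCoeff (pol ψ) k r).im * (angCoeff (polR ψ) k r).im))
    (fun r => hasDerivAt_norm_sq_complex
      (hasDerivAt_angCoeff c0 cR (hasDerivAt_pol_left hψ) k r))
    (fun r q => norm_sq_sub_nonneg _ _ q) ((continuous_angCoeff cR k).norm.pow 2)
    (fun r => by positivity) ?_ ?_ hW hWle Z fun r hr h => ?_
  · filter_upwards [hsupp] with r hr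
    simp [angCoeff, hr]
  · rcases h0 with h0 | h0 <;> simp [h0]
  · obtain ⟨h1, h2, h3⟩ := hZ r hr h
    exact ⟨h1, by simp [h2], by simp [h2], h3⟩

lemma modeBound_highSq {β c κ m : ℝ} (hβ : 0 ≤ β) (hc : 0 < c) (hκ : 0 < κ) {ψ : E2 → ℝ}
    (hψ : ContDiff ℝ 1 ψ) (hsupp : ∀ᶠ r in 𝓝 (1 : ℝ), ∀ θ, pol ψ r θ = 0) (K : ℕ) {W : ℝ → ℝ}
    (hW : ContinuousOn W (Set.Ioc 0 1))
    (hWle : ∀ r ∈ Set.Ioo (0 : ℝ) 1, W r - m ≤ κ ^ 2 * ((c * r ^ κ) ^ 2 - β ^ 2))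
    (hpos : ∀ r ∈ Set.Ioo (0 : ℝ) 1, 0 < besselJ β (c * r ^ κ)) :
    ModeBound W m (highSq K (pol ψ)) (highSq K (polR ψ)) := by
  have c0 := continuous_pol hψ
  have cR := continuous_polR hψ
  have cr : ∀ r, Continuous (pol ψ r) := fun r =>
    c0.comp (by fun_prop : Continuous fun θ : ℝ => (r, θ))
  have cRr : ∀ r, Continuous (polR ψ r) := fun r =>
    cR.comp (by fun_prop : Continuous fun θ : ℝ => (r, θ))
  refine exists_mode_lower_bound hβ hc hκ
    (fun r => hasDerivAt_highSq K c0 cR (hasDerivAt_pol_left hψ) r)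
    (fun r q => highSq_sub_smul_nonneg K (cr r) (cRr r) q) (continuous_highSq K cR)
    (fun r => highSq_nonneg K (cr r)) ?_ ?_ hW hWle ∅ fun r hr h => absurd h (hpos r hr).ne'
  · filter_upwards [hsupp] with r hr
    simp [highSq, circleSq, angCoeff, hr]
  · have h := le_circleSq_deriv K (F := pol ψ) (F' := polA ψ) (r := 0)
      (fun θ => hasDerivAt_pol_right hψ 0 θ)
        ((continuous_polA hψ).comp (by fun_prop : Continuous fun θ : ℝ => ((0 : ℝ), θ)))
      (by simp [pol])
    have h1 : circleSq (polA ψ) 0 = 0 := by simp [circleSq, polA]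
    rw [h1] at h
    have h2 : 0 ≤ ∑ k ∈ Finset.Icc (-(K : ℤ)) K,
        (k : ℝ) ^ 2 * (‖angCoeff (pol ψ) k 0‖ ^ 2 / (2 * π)) :=
      Finset.sum_nonneg fun k _ => by positivity
    have h3 := highSq_nonneg K (cr 0)
    have h4 : highSq K (pol ψ) 0 = 0 := by
      have : ((K : ℝ) + 1) ^ 2 * highSq K (pol ψ) 0 ≤ 0 := by linarith
      have hK : 0 < ((K : ℝ) + 1) ^ 2 := by positivity
      nlinarith
    rw [h4, zero_mul]

lemma integral_radialDensity_nonneg_of_angCoeff {β κ z c₀ : ℝ} (hβ : 0 < β) (hκ : 0 < κ)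
    (hz : 0 < z) (hc₀ : 0 < c₀) {K : ℕ} {ψ : E2 → ℝ} (hψ : ContDiff ℝ 1 ψ)
    (hsupp : ∀ᶠ r in 𝓝 (1 : ℝ), ∀ θ, pol ψ r θ = 0) {W : ℝ → ℝ}
    (hW : ContinuousOn W (Set.Ioc 0 1))
    (hW₀ : ∀ r ∈ Set.Ioo (0 : ℝ) 1, W r ≤ κ ^ 2 * (c₀ * r ^ κ) ^ 2)
    (hW₁ : ∀ r ∈ Set.Ioo (0 : ℝ) 1, W r - 1 ≤ κ ^ 2 * (z * r ^ κ) ^ 2)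
    (hW₂ : ∀ r ∈ Set.Ioo (0 : ℝ) 1, W r - (K + 1) ^ 2 ≤ κ ^ 2 * ((z * r ^ κ) ^ 2 - β ^ 2))
    (hpos : ∀ r ∈ Set.Ioo (0 : ℝ) 1, 0 < besselJ β (z * r ^ κ)) {a : Fin 2 → ℝ}
    (ha : ∀ r ∈ Set.Ioo (0 : ℝ) 1, besselJ 0 (c₀ * r ^ κ) = 0 → ∃ i, a i = r) {r₁ : ℝ}
    (hr₁ : ∀ r ∈ Set.Ioo (0 : ℝ) 1, besselJ 0 (z * r ^ κ) = 0 → r = r₁)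
    (h₀ : ∀ i, angCoeff (pol ψ) 0 (a i) = 0)
    (h₁ : ∀ k ∈ Finset.Icc (1 : ℤ) K, angCoeff (pol ψ) k r₁ = 0) :
    0 ≤ ∫ r in (0 : ℝ)..1, radialDensity W ψ r := by
  classical
  refine integral_radialDensity_nonneg K hψ (fun k hk => ?_)
    (modeBound_highSq hβ.le hz hκ hψ hsupp K hW hW₂ hpos)
  rw [Finset.mem_Icc] at hk
  rcases eq_or_ne k 0 with rfl | hk0
  · refine modeBound_angCoeff le_rfl hc₀ hκ hψ hsupp 0 (Or.inr rfl) hW (fun r hr => ?_)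
      (Finset.univ.image a) fun r hr h => ?_
    · simpa using hW₀ r hr
    · obtain ⟨i, rfl⟩ := ha r hr h
      exact ⟨Finset.mem_image_of_mem _ (Finset.mem_univ _), h₀ i,
        besselD_zero_ne_zero (mul_pos hc₀ (Real.rpow_pos_of_pos hr.1 _)) h⟩
  · refine modeBound_angCoeff le_rfl hz hκ hψ hsupp k (Or.inr rfl) hW (fun r hr => ?_)
      {r₁} fun r hr h => ?_
    · have : (1 : ℝ) ≤ (k : ℝ) ^ 2 := by
        have : 1 ≤ k ^ 2 := by
          rw [one_le_sq_iff_one_le_abs]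
          exact Int.one_le_abs hk0
        exact_mod_cast this
      have := hW₁ r hr
      simp only [ne_eq, OfNat.ofNat_ne_zero, not_false_eq_true, zero_pow, sub_zero]
      linarith
    · refine ⟨by simp [hr₁ r hr h], ?_,
        besselD_zero_ne_zero (mul_pos hz (Real.rpow_pos_of_pos hr.1 _)) h⟩
      rw [hr₁ r hr h]
      rcases hk0.lt_or_gt with hneg | hpos'
      · rw [← neg_neg k, angCoeff_neg, h₁ (-k) (Finset.mem_Icc.2 ⟨by omega, by omega⟩), map_zero]
      · exact h₁ k (Finset.mem_Icc.2 ⟨by omega, by omega⟩)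

/-- A space of functions on which the form is negative while it is nonnegative under `2 + 2 * K`
real linear constraints has dimension at most `2 + 2 * K`. -/
lemma finrank_le_of_nonneg_of_angCoeff {Q : (E2 → ℝ) → ℝ} {V : Submodule ℝ (E2 → ℝ)}
    (hV : ∀ ψ ∈ V, ContDiff ℝ 1 ψ) (hneg : ∀ ψ ∈ V, ψ ≠ 0 → Q ψ < 0) (a : Fin 2 → ℝ) (r₁ : ℝ)
    (K : ℕ) (h : ∀ ψ ∈ V, (∀ i, angCoeff (pol ψ) 0 (a i) = 0) →
      (∀ k ∈ Finset.Icc (1 : ℤ) K, angCoeff (pol ψ) k r₁ = 0) → 0 ≤ Q ψ) :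
    Module.finrank ℝ V ≤ 2 + 2 * K := by
  have hcont : ∀ ψ ∈ V, ∀ r, Continuous fun θ => ((pol ψ r θ : ℝ) : ℂ) := fun ψ hψ r =>
    Complex.continuous_ofReal.comp
      ((continuous_pol (hV ψ hψ)).comp (by fun_prop : Continuous fun θ : ℝ => (r, θ)))
  have hadd : ∀ ψ ∈ V, ∀ φ ∈ V, ∀ k r, angCoeff (pol (ψ + φ)) k r =
      angCoeff (pol ψ) k r + angCoeff (pol φ) k r := fun ψ hψ φ hφ k r => by
    have h1 := hcont ψ hψ r
    have h2 := hcont φ hφ r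
    rw [angCoeff, angCoeff, angCoeff, ← intervalIntegral.integral_add
      (Continuous.intervalIntegrable (by fun_prop) _ _)
      (Continuous.intervalIntegrable (by fun_prop) _ _)]
    congr 1
    ext θ
    simp only [pol, Pi.add_apply]
    push_cast
    ring
  have hsmul : ∀ (c : ℝ) (ψ : E2 → ℝ) k r, angCoeff (pol (c • ψ)) k r =
      c * angCoeff (pol ψ) k r := fun c ψ k r => by
    rw [angCoeff, angCoeff, ← intervalIntegral.integral_const_mul]
    congr 1
    ext θ
    simp only [pol, Pi.smul_apply, smul_eq_mul]
    push_cast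
    ring
  let T : V →ₗ[ℝ] (Fin 2 → ℝ) × (Fin K → ℂ) :=
    { toFun := fun ψ => (fun i => (angCoeff (pol ψ) 0 (a i)).re,
        fun j => angCoeff (pol ψ) ((j : ℤ) + 1) r₁)
      map_add' := fun ψ φ => by
        ext <;> simp [hadd ψ ψ.2 φ φ.2]
      map_smul' := fun c ψ => by
        ext <;> simp [hsmul] }
  by_contra! hlt
  have : FiniteDimensional ℝ V := FiniteDimensional.of_finrank_pos (by omega)
  have hker : LinearMap.ker T ≠ ⊥ := by
    refine LinearMap.ker_ne_bot_of_finrank_lt ?_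
    rw [Module.finrank_prod, Module.finrank_pi, Module.finrank_pi_fintype]
    simp only [Complex.finrank_real_complex, Fintype.card_fin, Finset.sum_const, Finset.card_univ,
      smul_eq_mul]
    omega
  obtain ⟨ψ, hψ, hne⟩ := (Submodule.ne_bot_iff _).1 hker
  have hT : T ψ = 0 := hψ
  have hne' : (ψ : E2 → ℝ) ≠ 0 := fun h0 => hne (Subtype.ext h0)
  refine (hneg ψ ψ.2 hne').not_ge (h ψ ψ.2 (fun i => ?_) fun k hk => ?_)
  · refine Complex.ext (congrFun (congrArg Prod.fst hT) i) ?_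
    have := congrArg Complex.im (angCoeff_neg (pol ψ) 0 (a i))
    simp only [neg_zero, Complex.conj_im] at this
    simp only [Complex.zero_im]
    linarith
  · rw [Finset.mem_Icc] at hk
    have := congrFun (congrArg Prod.snd hT) ⟨(k - 1).toNat, by omega⟩
    simp only [T, LinearMap.coe_mk, AddHom.coe_mk, Prod.snd_zero, Pi.zero_apply] at this
    rwa [Int.toNat_of_nonneg (by omega), sub_add_cancel] at this

lemma eq_rpow_inv_of_mul_rpow_eq {c κ r t : ℝ} (hc : 0 < c) (hκ : 0 < κ) (hr : 0 ≤ r)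
    (h : c * r ^ κ = t) : (t / c) ^ κ⁻¹ = r := by
  rw [← h, mul_div_cancel_left₀ _ hc.ne', Real.rpow_rpow_inv hr hκ.ne']

lemma eventually_pol_eq_zero {ψ : E2 → ℝ} (hψ : tsupport ψ ⊆ ball 0 1) :
    ∀ᶠ r in 𝓝 (1 : ℝ), ∀ θ, pol ψ r θ = 0 := by
  obtain ⟨R, hR, hsub⟩ := exists_lt_subset_ball (isClosed_tsupport ψ) hψ
  filter_upwards [Ioi_mem_nhds (max_lt hR (zero_lt_one' ℝ))] with r hr θ
  rw [Set.mem_Ioi, max_lt_iff] at hr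
  by_contra h
  have := hsub (subset_tsupport ψ h)
  rw [mem_ball_zero_iff, norm_smul_eRad hr.2.le] at this
  linarith

lemma LaneEmdenPair.rpow_abs_le_one {p c : ℝ} {w d : ℝ → ℝ} (H : LaneEmdenPair p c w d) {t : ℝ}
    (ht : t ∈ Set.Icc 0 c) : |w t| ^ (p - 1) ≤ 1 :=
  Real.rpow_le_one (abs_nonneg _) (H.abs_le_one t ht) (by linarith [H.one_lt])

/-- For exponents close to `1` the Morse index is at most `2 + 2 * K`. -/
lemma exists_morseSet_le {α β z : ℝ} (hα : 0 ≤ α) (hβ : 0 < β) (hz₁ : IsNthZero β 1 z)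
    (hz₂ : IsNthZero 0 2 z) {K : ℕ} (hK : (2 + α) / 2 * β < K + 1) :
    ∃ η > 0, ∀ p c w d u, LaneEmdenPair p c w d → p * c ^ 2 ≤ z ^ 2 + η →
      (∀ x ∈ closedBall (0 : E2) 1, |u x| ^ (p - 1) =
        ((2 + α) / 2) ^ 2 * c ^ 2 * |w (c * ‖x‖ ^ ((2 + α) / 2))| ^ (p - 1)) →
      ∀ n ∈ morseSet α p u, n ≤ 2 + 2 * K := by
  obtain ⟨ρ, hρ, hpos, hρ0, hneg, hz0, ε, hε, hε'⟩ := besselJ_zero_sign hz₂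
  have hz : 0 < z := hz₁.1
  set κ := (2 + α) / 2 with hκdef
  have hκ : 0 < κ := by positivity
  have hgap : 0 < ((K : ℝ) + 1) ^ 2 - κ ^ 2 * β ^ 2 := by
    have : 0 ≤ κ * β := by positivity
    nlinarith
  obtain ⟨η, hη, hη1, hη2, hη3⟩ : ∃ η > 0, κ ^ 2 * η ≤ 1 ∧
      κ ^ 2 * η ≤ ((K : ℝ) + 1) ^ 2 - κ ^ 2 * β ^ 2 ∧ η ≤ ε ^ 2 := by
    refine ⟨min (min (1 / κ ^ 2) ((((K : ℝ) + 1) ^ 2 - κ ^ 2 * β ^ 2) / κ ^ 2)) (ε ^ 2),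
      by positivity, ?_, ?_, min_le_right _ _⟩
    · rw [← le_div_iff₀' (by positivity)]
      exact (min_le_left _ _).trans (min_le_left _ _)
    · rw [← le_div_iff₀' (by positivity)]
      exact (min_le_left _ _).trans (min_le_right _ _)
  refine ⟨η, hη, fun p c w d u H hpc hu n ⟨V, hVn, hVs, hVneg⟩ => ?_⟩
  set c₀ := √(z ^ 2 + η) with hc₀def
  have hc₀sq : c₀ ^ 2 = z ^ 2 + η := Real.sq_sqrt (by positivity)
  have hc₀ : 0 < c₀ := Real.sqrt_pos.2 (by positivity)
  have hc₀le : c₀ ≤ z + ε := by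
    rw [hc₀def, Real.sqrt_le_left (by positivity)]
    nlinarith
  have hm := (H.continuousOn_abs_rpow hκ).const_mul (κ ^ 2 * c ^ 2)
  set m : ℝ → ℝ := fun r => κ ^ 2 * c ^ 2 * |w (c * r ^ κ)| ^ (p - 1) with hmdef
  have hp0 : 0 < p := by linarith [H.one_lt]
  have hWle : ∀ r ∈ Set.Ioo (0 : ℝ) 1, p * (r ^ (2 + α) * m r) ≤
      κ ^ 2 * (z ^ 2 + η) * (r ^ κ) ^ 2 := fun r hr => by
    have h1 := H.rpow_abs_le_one
      (mul_rpow_mem_Icc H.pos hκ (Set.Ioo_subset_Icc_self hr))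
    have e : r ^ (2 + α) = (r ^ κ) ^ 2 := by
      rw [← Real.rpow_natCast, ← Real.rpow_mul hr.1.le, hκdef]
      congr 1
      push_cast
      ring
    rw [e, hmdef]
    calc _ = (κ ^ 2 * (r ^ κ) ^ 2) * (p * c ^ 2) * |w (c * r ^ κ)| ^ (p - 1) := by ring
      _ ≤ (κ ^ 2 * (r ^ κ) ^ 2) * (p * c ^ 2) * 1 := by gcongr
      _ ≤ (κ ^ 2 * (r ^ κ) ^ 2) * (z ^ 2 + η) * 1 := by gcongr
      _ = _ := by ring
  have hx : ∀ r ∈ Set.Ioo (0 : ℝ) 1, κ ^ 2 * η * (r ^ κ) ^ 2 ≤ κ ^ 2 * η := fun r hr => by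
    have h1 : (r ^ κ) ^ 2 ≤ 1 :=
      pow_le_one₀ (Real.rpow_nonneg hr.1.le _) (Real.rpow_le_one hr.1.le hr.2.le hκ.le)
    exact mul_le_of_le_one_right (by positivity) h1
  rw [← hVn]
  refine finrank_le_of_nonneg_of_angCoeff (fun ψ hψ => (hVs ψ hψ).1.of_le (by norm_num)) hVneg
    ![(ρ / c₀) ^ κ⁻¹, (z / c₀) ^ κ⁻¹] ((ρ / z) ^ κ⁻¹) K fun ψ hψ h₀ h₁ => ?_
  have hψ1 : ContDiff ℝ 1 ψ := (hVs ψ hψ).1.of_le (by norm_num)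
  rw [quadForm_eq_integral hα hψ1 hm hu]
  refine integral_radialDensity_nonneg_of_angCoeff hβ hκ hz hc₀ hψ1
    (eventually_pol_eq_zero (hVs ψ hψ).2.2) ?_ (fun r hr => ?_) (fun r hr => ?_) (fun r hr => ?_)
    (fun r hr => besselJ_pos_of_isNthZero_one hβ.le hz₁ _ (mul_rpow_mem_Ioo hz hκ hr))
    (fun r hr h => ?_) (fun r hr h => ?_) h₀ h₁
  · refine continuousOn_const.mul (ContinuousOn.mul ?_ (hm.mono Set.Ioc_subset_Icc_self))
    exact (Real.continuous_rpow_const (by positivity)).continuousOn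
  · have := hWle r hr
    rw [mul_pow, hc₀sq]
    linarith
  · have := hWle r hr
    have := hx r hr
    rw [mul_pow]
    linarith
  · have := hWle r hr
    have := hx r hr
    rw [mul_pow]
    linarith
  · have hmem := mul_rpow_mem_Ioo hc₀ hκ hr
    set t := c₀ * r ^ κ with ht
    have : t = ρ ∨ t = z := by
      rcases lt_trichotomy t ρ with h1 | h1 | h1
      · exact absurd h (hpos t ⟨hmem.1.le, h1⟩).ne'
      · exact Or.inl h1
      · rcases lt_trichotomy t z with h2 | h2 | h2
        · exact absurd h (hneg t ⟨h1, h2⟩).ne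
        · exact Or.inr h2
        · exact absurd h (hε' t ⟨h2, hmem.2.le.trans hc₀le⟩).ne'
    rcases this with h1 | h1
    · exact ⟨0, eq_rpow_inv_of_mul_rpow_eq hc₀ hκ hr.1.le h1⟩
    · exact ⟨1, eq_rpow_inv_of_mul_rpow_eq hc₀ hκ hr.1.le h1⟩
  · have hmem := mul_rpow_mem_Ioo hz hκ hr
    refine (eq_rpow_inv_of_mul_rpow_eq hz hκ hr.1.le ?_).symm
    rcases lt_trichotomy (z * r ^ κ) ρ with h1 | h1 | h1
    · exact absurd h (hpos _ ⟨hmem.1.le, h1⟩).ne'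
    · exact h1
    · exact absurd h (hneg _ ⟨h1, hmem.2⟩).ne

/-- A continuous cutoff, vanishing near `0` and near `M`. -/
def cutoff (M : ℝ) (n : ℕ) (t : ℝ) : ℝ := max 0 (min 1 (min (n * t - 1) (n * (M - t) - 1)))

lemma continuous_cutoff (M : ℝ) (n : ℕ) : Continuous (cutoff M n) := by
  unfold cutoff
  fun_prop

lemma cutoff_nonneg (M : ℝ) (n : ℕ) (t : ℝ) : 0 ≤ cutoff M n t := le_max_left _ _

lemma cutoff_le_one (M : ℝ) (n : ℕ) (t : ℝ) : cutoff M n t ≤ 1 :=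
  max_le zero_le_one (min_le_left _ _)

lemma cutoff_eq_zero_of_left {M : ℝ} {n : ℕ} {t : ℝ} (h : n * t ≤ 1) : cutoff M n t = 0 :=
  max_eq_left ((min_le_right _ _).trans ((min_le_left _ _).trans (by linarith)))

lemma cutoff_eq_zero_of_right {M : ℝ} {n : ℕ} {t : ℝ} (h : n * (M - t) ≤ 1) : cutoff M n t = 0 :=
  max_eq_left ((min_le_right _ _).trans ((min_le_right _ _).trans (by linarith)))

lemma tendsto_cutoff {M t : ℝ} (ht : t ∈ Set.Ioo 0 M) :
    Tendsto (fun n => cutoff M n t) atTop (𝓝 1) := by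
  have h1 := (tendsto_natCast_atTop_atTop (R := ℝ)).atTop_mul_const ht.1
  have h2 := (tendsto_natCast_atTop_atTop (R := ℝ)).atTop_mul_const (sub_pos.2 ht.2)
  refine tendsto_const_nhds.congr' ?_
  filter_upwards [h1.eventually_ge_atTop 2, h2.eventually_ge_atTop 2] with n h3 h4
  rw [cutoff, min_eq_left (le_min (by linarith) (by linarith)), max_eq_right zero_le_one]

/-- The primitive of a power of the cutoff. -/
def trunc (M : ℝ) (n q : ℕ) (t : ℝ) : ℝ := ∫ s in (0 : ℝ)..t, cutoff M n s ^ q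

lemma hasDerivAt_trunc (M : ℝ) (n q : ℕ) (t : ℝ) :
    HasDerivAt (trunc M n q) (cutoff M n t ^ q) t :=
  ((continuous_cutoff M n).pow q).integral_hasStrictDerivAt 0 t |>.hasDerivAt

lemma continuous_trunc (M : ℝ) (n q : ℕ) : Continuous (trunc M n q) :=
  continuous_iff_continuousAt.2 fun t => (hasDerivAt_trunc M n q t).continuousAt

lemma trunc_nonneg (M : ℝ) (n q : ℕ) {t : ℝ} (ht : 0 ≤ t) : 0 ≤ trunc M n q t :=
  intervalIntegral.integral_nonneg ht fun s _ => pow_nonneg (cutoff_nonneg M n s) q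

lemma trunc_le (M : ℝ) (n q : ℕ) {t : ℝ} (ht : 0 ≤ t) : trunc M n q t ≤ t := by
  have h := intervalIntegral.integral_mono_on (μ := volume) (a := 0) (b := t)
    (f := fun s => cutoff M n s ^ q) (g := fun _ => 1) ht
    (((continuous_cutoff M n).pow q).intervalIntegrable _ _) (by simp)
    fun s _ => pow_le_one₀ (cutoff_nonneg M n s) (cutoff_le_one M n s)
  simpa [trunc] using h

lemma trunc_eq_zero (M : ℝ) {n q : ℕ} (hq : q ≠ 0) {t : ℝ} (ht : 0 ≤ t) (h : n * t ≤ 1) :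
    trunc M n q t = 0 := by
  refine intervalIntegral.integral_zero_ae (ae_of_all _ fun s hs => ?_)
  rw [Set.uIoc_of_le ht] at hs
  rw [cutoff_eq_zero_of_left ((mul_le_mul_of_nonneg_left hs.2 n.cast_nonneg).trans h),
    zero_pow hq]

lemma trunc_eq_trunc_top {M : ℝ} {n q : ℕ} (hq : q ≠ 0) {t : ℝ} (ht : t ≤ M)
    (h : n * (M - t) ≤ 1) : trunc M n q t = trunc M n q M := by
  have hi : ∀ x y, IntervalIntegrable (fun s => cutoff M n s ^ q) volume x y := fun x y =>
    ((continuous_cutoff M n).pow q).intervalIntegrable x y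
  have h0 : ∫ s in t..M, cutoff M n s ^ q = 0 := by
    refine intervalIntegral.integral_zero_ae (ae_of_all _ fun s hs => ?_)
    rw [Set.uIoc_of_le ht] at hs
    rw [cutoff_eq_zero_of_right ((mul_le_mul_of_nonneg_left (by linarith [hs.1])
      n.cast_nonneg).trans h), zero_pow hq]
  have := intervalIntegral.integral_add_adjacent_intervals (hi 0 t) (hi t M)
  rw [h0, add_zero] at this
  exact this

lemma tendsto_trunc {M t : ℝ} (q : ℕ) (ht : t ∈ Set.Icc 0 M) :
    Tendsto (fun n => trunc M n q t) atTop (𝓝 t) := by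
  have h := intervalIntegral.tendsto_integral_filter_of_dominated_convergence (μ := volume)
    (l := atTop) (a := 0) (b := t) (F := fun n s => cutoff M n s ^ q) (f := fun _ => (1 : ℝ))
    (fun _ => 1) (.of_forall fun n => ((continuous_cutoff M n).pow q).aestronglyMeasurable)
    (.of_forall fun n => ae_of_all _ fun s _ => by
      rw [Real.norm_of_nonneg (pow_nonneg (cutoff_nonneg M n s) q)]
      exact pow_le_one₀ (cutoff_nonneg M n s) (cutoff_le_one M n s))
    (by simp) (by
      have hne : ∀ᵐ s : ℝ, s ≠ M := by simp [ae_iff]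
      filter_upwards [hne] with s hs hmem
      rw [Set.uIoc_of_le ht.1] at hmem
      have := (tendsto_cutoff (M := M) (t := s)
        ⟨hmem.1, lt_of_le_of_ne (hmem.2.trans ht.2) hs⟩).pow q
      simpa using this)
  simpa [trunc] using h

/-- A positive solution of the Euler system on `(a, b)` vanishing at `b`, which at `a` either
vanishes or attains its maximum with zero slope. -/
structure Profile (a b M : ℝ) (h k P : ℝ → ℝ) : Prop where
  nonneg : 0 ≤ a
  lt : a < b
  euler : EulerPair h k P (Set.Ioo a b)
  cont : ContinuousOn h (Set.Icc a b)
  pos : ∀ r ∈ Set.Ioo a b, 0 < h r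
  le : ∀ r ∈ Set.Icc a b, h r ≤ M
  right : h b = 0
  left : h a = 0 ∨ (h a = M ∧ Tendsto k (𝓝[>] a) (𝓝 0))

namespace Profile

variable {a b M : ℝ} {h k P : ℝ → ℝ}

/-- The truncated profile, extended by constants. -/
def fn (a b M : ℝ) (h : ℝ → ℝ) (n : ℕ) (r : ℝ) : ℝ := trunc M n 1 (h (max a (min b r)))

/-- The derivative of the truncated profile. -/
def dfn (a b M : ℝ) (h k : ℝ → ℝ) (n : ℕ) (r : ℝ) : ℝ := by
  classical exact if r ∈ Set.Ioo a b then cutoff M n (h r) * (k r / r) else 0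

lemma tendsto_left (H : Profile a b M h k P) : Tendsto h (𝓝[>] a) (𝓝 (h a)) := by
  rw [← nhdsWithin_Ioo_eq_nhdsGT H.lt]
  exact (H.cont a ⟨le_rfl, H.lt.le⟩).tendsto.mono_left
    (nhdsWithin_mono _ Set.Ioo_subset_Icc_self)

lemma tendsto_right (H : Profile a b M h k P) : Tendsto h (𝓝[<] b) (𝓝 0) := by
  rw [← nhdsWithin_Ioo_eq_nhdsLT H.lt, ← H.right]
  exact (H.cont b ⟨H.lt.le, le_rfl⟩).tendsto.mono_left
    (nhdsWithin_mono _ Set.Ioo_subset_Icc_self)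

lemma exists_left (H : Profile a b M h k P) (n : ℕ) : ∃ a₁ ∈ Set.Ioo a ((a + b) / 2),
    ∀ r ∈ Set.Ioc a a₁, cutoff M n (h r) = 0 ∧ trunc M n 1 (h r) = trunc M n 1 (h a) ∧
      (h a = 0 → trunc M n 2 (h r) = 0) := by
  have key : ∀ᶠ r in 𝓝[>] a, cutoff M n (h r) = 0 ∧ trunc M n 1 (h r) = trunc M n 1 (h a) ∧
      (h a = 0 → trunc M n 2 (h r) = 0) := by
    have hlt := H.lt
    rcases eq_or_ne (h a) 0 with h0 | h0
    · have h1 := (H.tendsto_left.const_mul (n : ℝ)).eventually_lt_const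
        (show (n : ℝ) * h a < 1 by simp [h0])
      filter_upwards [h1, Ioo_mem_nhdsGT H.lt] with r h2 h3
      have h4 := (H.pos r h3).le
      rw [cutoff_eq_zero_of_left h2.le, trunc_eq_zero M one_ne_zero h4 h2.le,
        trunc_eq_zero M two_ne_zero h4 h2.le, h0, trunc_eq_zero M one_ne_zero le_rfl (by simp)]
      simp
    · have hM := (H.left.resolve_left h0).1
      have h1 := ((H.tendsto_left.const_sub M).const_mul (n : ℝ)).eventually_lt_const
        (show (n : ℝ) * (M - h a) < 1 by simp [hM])
      filter_upwards [h1, Ioo_mem_nhdsGT H.lt] with r h2 h3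
      refine ⟨cutoff_eq_zero_of_right h2.le, ?_, fun h => absurd h h0⟩
      rw [trunc_eq_trunc_top one_ne_zero (H.le r (Set.Ioo_subset_Icc_self h3)) h2.le, hM]
  have hlt := H.lt
  have hm : a < (a + b) / 2 := by linarith
  obtain ⟨u, hu, hsub⟩ := (mem_nhdsGT_iff_exists_Ioc_subset).1
    (key.and (Ioo_mem_nhdsGT hm))
  exact ⟨u, (hsub ⟨hu, le_rfl⟩).2, fun r hr => (hsub hr).1⟩

lemma exists_right (H : Profile a b M h k P) (n : ℕ) : ∃ b₁ ∈ Set.Ioo ((a + b) / 2) b,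
    ∀ r ∈ Set.Ico b₁ b, cutoff M n (h r) = 0 ∧ trunc M n 1 (h r) = 0 ∧
      trunc M n 2 (h r) = 0 := by
  have key : ∀ᶠ r in 𝓝[<] b, cutoff M n (h r) = 0 ∧ trunc M n 1 (h r) = 0 ∧
      trunc M n 2 (h r) = 0 := by
    have h1 := (H.tendsto_right.const_mul (n : ℝ)).eventually_lt_const
      (show (n : ℝ) * 0 < 1 by simp)
    filter_upwards [h1, Ioo_mem_nhdsLT H.lt] with r h2 h3
    have h4 := (H.pos r h3).le
    exact ⟨cutoff_eq_zero_of_left h2.le, trunc_eq_zero M one_ne_zero h4 h2.le,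
      trunc_eq_zero M two_ne_zero h4 h2.le⟩
  have hlt := H.lt
  have hm : (a + b) / 2 < b := by linarith
  obtain ⟨u, hu, hsub⟩ := (mem_nhdsLT_iff_exists_Ico_subset).1
    (key.and (Ioo_mem_nhdsLT hm))
  exact ⟨u, (hsub ⟨le_rfl, hu⟩).2, fun r hr => (hsub hr).1⟩

lemma fn_of_mem {r : ℝ} (hr : r ∈ Set.Icc a b) (n : ℕ) : fn a b M h n r = trunc M n 1 (h r) := by
  rw [fn, min_eq_right hr.2, max_eq_right hr.1]

lemma fn_of_le {r : ℝ} (hab : a ≤ b) (hr : r ≤ a) (n : ℕ) :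
    fn a b M h n r = trunc M n 1 (h a) := by
  rw [fn, min_eq_right (hr.trans hab), max_eq_left hr]

lemma fn_of_ge (H : Profile a b M h k P) {r : ℝ} (hr : b ≤ r) (n : ℕ) :
    fn a b M h n r = 0 := by
  rw [fn, min_eq_left hr, max_eq_right H.lt.le, H.right, trunc_eq_zero M one_ne_zero le_rfl
    (by simp)]

lemma dfn_of_mem {r : ℝ} (hr : r ∈ Set.Ioo a b) (n : ℕ) :
    dfn a b M h k n r = cutoff M n (h r) * (k r / r) := if_pos hr

lemma dfn_of_not_mem {r : ℝ} (hr : r ∉ Set.Ioo a b) (n : ℕ) : dfn a b M h k n r = 0 := if_neg hr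

/-- The truncated profile is continuously differentiable and locally constant off a compact
subinterval of `(a, b)`. -/
lemma fn_spec (H : Profile a b M h k P) (n : ℕ) : ∃ a₁ b₁, a < a₁ ∧ a₁ < b₁ ∧ b₁ < b ∧
    (∀ r, HasDerivAt (fn a b M h n) (dfn a b M h k n r) r) ∧ Continuous (dfn a b M h k n) ∧
    (∀ r ≤ a₁, fn a b M h n r = fn a b M h n a) ∧ (h a = 0 → fn a b M h n a = 0) ∧
    ∀ r, b₁ ≤ r → fn a b M h n r = 0 := by
  obtain ⟨a₁, ha₁, hl⟩ := H.exists_left n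
  obtain ⟨b₁, hb₁, hr⟩ := H.exists_right n
  have hlt := H.lt
  have f1 : ∀ r ≤ a₁, fn a b M h n r = fn a b M h n a := fun r hr' => by
    rw [fn_of_le hlt.le le_rfl]
    rcases le_or_gt r a with h1 | h1
    · exact fn_of_le hlt.le h1 n
    · rw [fn_of_mem ⟨h1.le, by linarith [ha₁.2]⟩, (hl r ⟨h1, hr'⟩).2.1]
  have f2 : ∀ r, b₁ ≤ r → fn a b M h n r = 0 := fun r hr' => by
    rcases le_or_gt b r with h1 | h1
    · exact H.fn_of_ge h1 n
    · rw [fn_of_mem ⟨by linarith [hb₁.1], h1.le⟩, (hr r ⟨hr', h1⟩).2.1]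
  have g1 : ∀ r ≤ a₁, dfn a b M h k n r = 0 := fun r hr' => by
    by_cases h1 : r ∈ Set.Ioo a b
    · rw [dfn_of_mem h1, (hl r ⟨h1.1, hr'⟩).1, zero_mul]
    · exact dfn_of_not_mem h1 n
  have g2 : ∀ r, b₁ ≤ r → dfn a b M h k n r = 0 := fun r hr' => by
    by_cases h1 : r ∈ Set.Ioo a b
    · rw [dfn_of_mem h1, (hr r ⟨hr', h1.2⟩).1, zero_mul]
    · exact dfn_of_not_mem h1 n
  have main : ∀ r, HasDerivAt (fn a b M h n) (dfn a b M h k n r) r ∧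
      ContinuousAt (dfn a b M h k n) r := fun r => by
    rcases lt_or_ge r a₁ with h1 | h1
    · have e1 : fn a b M h n =ᶠ[𝓝 r] fun _ => fn a b M h n a := by
        filter_upwards [Iio_mem_nhds h1] with s hs using f1 s (le_of_lt hs)
      have e2 : dfn a b M h k n =ᶠ[𝓝 r] fun _ => 0 := by
        filter_upwards [Iio_mem_nhds h1] with s hs using g1 s (le_of_lt hs)
      rw [g1 r h1.le]
      exact ⟨(hasDerivAt_const r _).congr_of_eventuallyEq e1,
        continuousAt_const.congr e2.symm⟩
    · rcases lt_or_ge b₁ r with h2 | h2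
      · have e1 : fn a b M h n =ᶠ[𝓝 r] fun _ => 0 := by
          filter_upwards [Ioi_mem_nhds h2] with s hs using f2 s (le_of_lt hs)
        have e2 : dfn a b M h k n =ᶠ[𝓝 r] fun _ => 0 := by
          filter_upwards [Ioi_mem_nhds h2] with s hs using g2 s (le_of_lt hs)
        rw [g2 r h2.le]
        exact ⟨(hasDerivAt_const r _).congr_of_eventuallyEq e1,
          continuousAt_const.congr e2.symm⟩
      · have hmem : r ∈ Set.Ioo a b := ⟨ha₁.1.trans_le h1, h2.trans_lt hb₁.2⟩
        have hr0 : r ≠ 0 := (H.nonneg.trans_lt hmem.1).ne'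
        have e1 : fn a b M h n =ᶠ[𝓝 r] fun s => trunc M n 1 (h s) := by
          filter_upwards [isOpen_Ioo.mem_nhds hmem] with s hs
            using fn_of_mem (Set.Ioo_subset_Icc_self hs) n
        have e2 : dfn a b M h k n =ᶠ[𝓝 r] fun s => cutoff M n (h s) * (k s / s) := by
          filter_upwards [isOpen_Ioo.mem_nhds hmem] with s hs using dfn_of_mem hs n
        obtain ⟨d1, d2⟩ := H.euler r hmem
        constructor
        · rw [dfn_of_mem hmem]
          have := (hasDerivAt_trunc M n 1 (h r)).comp r d1
          rw [pow_one] at this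
          exact this.congr_of_eventuallyEq e1
        · refine ContinuousAt.congr ?_ e2.symm
          exact ((continuous_cutoff M n).continuousAt.comp d1.continuousAt).mul
            (d2.continuousAt.div continuousAt_id hr0)
  refine ⟨a₁, b₁, ha₁.1, ha₁.2.trans hb₁.1, hb₁.2, fun r => (main r).1,
    continuous_iff_continuousAt.2 fun r => (main r).2, f1, fun h0 => ?_, f2⟩
  rw [fn_of_le hlt.le le_rfl, h0, trunc_eq_zero M one_ne_zero le_rfl (by simp)]

lemma integral_dfn_sq (H : Profile a b M h k P) (n : ℕ)
    (hInt : IntervalIntegrable (fun r => P r * h r / r * trunc M n 2 (h r)) volume a b) :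
    ∫ r in a..b, r * dfn a b M h k n r ^ 2 =
      ∫ r in a..b, P r * h r / r * trunc M n 2 (h r) := by
  obtain ⟨a₁, b₁, -, -, -, -, hc, -⟩ := H.fn_spec n
  have hi : IntervalIntegrable (fun r => r * dfn a b M h k n r ^ 2) volume a b :=
    Continuous.intervalIntegrable (by fun_prop) _ _
  rw [← sub_eq_zero, ← intervalIntegral.integral_sub hi hInt]
  have hd : ∀ r ∈ Set.Ioo a b, HasDerivAt (fun r => k r * trunc M n 2 (h r))
      (r * dfn a b M h k n r ^ 2 - P r * h r / r * trunc M n 2 (h r)) r := fun r hr => by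
    obtain ⟨d1, d2⟩ := H.euler r hr
    have hr0 : r ≠ 0 := (H.nonneg.trans_lt hr.1).ne'
    refine (d2.mul ((hasDerivAt_trunc M n 2 (h r)).comp r d1)).congr_deriv ?_
    rw [dfn_of_mem hr]
    simp only [Function.comp]
    field_simp
    ring
  rw [intervalIntegral.integral_eq_sub_of_hasDerivAt_of_tendsto H.lt (fa := 0) (fb := 0) hd
    (hi.sub hInt) ?_ ?_, sub_zero]
  · obtain ⟨a₂, ha₂, hl⟩ := H.exists_left n
    rcases H.left with h0 | ⟨-, h0⟩
    · refine tendsto_const_nhds.congr' ?_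
      filter_upwards [Ioc_mem_nhdsGT ha₂.1] with r hr
      rw [(hl r hr).2.2 h0, mul_zero]
    · have := h0.mul (((continuous_trunc M n 2).tendsto _).comp H.tendsto_left)
      rwa [zero_mul] at this
  · obtain ⟨b₂, hb₂, hl⟩ := H.exists_right n
    refine tendsto_const_nhds.congr' ?_
    filter_upwards [Ico_mem_nhdsLT hb₂.2] with r hr
    rw [(hl r hr).2.2, mul_zero]

/-- Truncations of a profile with negative form have negative form. -/
lemma exists_fn_neg (H : Profile a b M h k P) (hP : ContinuousOn P (Set.Ioo a b)) {U : ℝ → ℝ}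
    (hU : ContinuousOn U (Set.Ioo a b))
    (hPi : IntervalIntegrable (fun r => P r * h r ^ 2 / r) volume a b)
    (hUi : IntervalIntegrable (fun r => U r * h r ^ 2) volume a b)
    (hneg : ∫ r in a..b, (P r * h r ^ 2 / r + U r * h r ^ 2) < 0) :
    ∃ n, ∫ r in a..b, (r * dfn a b M h k n r ^ 2 + U r * fn a b M h n r ^ 2) < 0 := by
  have hh : ContinuousOn h (Set.Ioo a b) := H.cont.mono Set.Ioo_subset_Icc_self
  have hr0 : ∀ r ∈ Set.Ioo a b, r ≠ 0 := fun r hr => (H.nonneg.trans_lt hr.1).ne'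
  have hIoo : volume.restrict (Set.uIoc a b) = volume.restrict (Set.Ioo a b) := by
    rw [Set.uIoc_of_le H.lt.le]
    exact (Measure.restrict_congr_set Ioo_ae_eq_Ioc).symm
  have hae : ∀ {p : ℝ → Prop}, (∀ r ∈ Set.Ioo a b, p r) →
      ∀ᵐ r, r ∈ Set.uIoc a b → p r := fun {p} hp => by
    rw [← ae_restrict_iff' measurableSet_uIoc, hIoo]
    exact (ae_restrict_iff' measurableSet_Ioo).2 (ae_of_all _ hp)
  have m1 : ∀ n, AEStronglyMeasurable (fun r => P r * h r / r * trunc M n 2 (h r))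
      (volume.restrict (Set.uIoc a b)) := fun n => by
    rw [hIoo]
    exact (((hP.mul hh).div continuousOn_id hr0).mul
      ((continuous_trunc M n 2).comp_continuousOn hh)).aestronglyMeasurable measurableSet_Ioo
  have m2 : ∀ n, AEStronglyMeasurable (fun r => U r * fn a b M h n r ^ 2)
      (volume.restrict (Set.uIoc a b)) := fun n => by
    rw [hIoo]
    refine ContinuousOn.aestronglyMeasurable (hU.mul (ContinuousOn.pow ?_ 2)) measurableSet_Ioo
    exact ((continuous_trunc M n 1).comp_continuousOn hh).congr
      fun r hr => fn_of_mem (Set.Ioo_subset_Icc_self hr) n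
  have b1 : ∀ n, ∀ᵐ r, r ∈ Set.uIoc a b →
      ‖P r * h r / r * trunc M n 2 (h r)‖ ≤ ‖P r * h r ^ 2 / r‖ := fun n => hae fun r hr => by
    have hp := (H.pos r hr).le
    rw [norm_mul, Real.norm_of_nonneg (trunc_nonneg M n 2 hp),
      show P r * h r ^ 2 / r = P r * h r / r * h r by ring, norm_mul, Real.norm_of_nonneg hp]
    exact mul_le_mul_of_nonneg_left (trunc_le M n 2 hp) (norm_nonneg _)
  have b2 : ∀ n, ∀ᵐ r, r ∈ Set.uIoc a b →
      ‖U r * fn a b M h n r ^ 2‖ ≤ ‖U r * h r ^ 2‖ := fun n => hae fun r hr => by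
    have hp := (H.pos r hr).le
    rw [fn_of_mem (Set.Ioo_subset_Icc_self hr), norm_mul, norm_mul,
      Real.norm_of_nonneg (sq_nonneg _), Real.norm_of_nonneg (sq_nonneg _)]
    exact mul_le_mul_of_nonneg_left (pow_le_pow_left₀ (trunc_nonneg M n 1 hp)
      (trunc_le M n 1 hp) 2) (norm_nonneg _)
  have i1 : ∀ n, IntervalIntegrable (fun r => P r * h r / r * trunc M n 2 (h r)) volume a b :=
    fun n => hPi.norm.mono_fun' (m1 n) ((ae_restrict_iff' measurableSet_uIoc).2 (b1 n))
  have i2 : ∀ n, IntervalIntegrable (fun r => U r * fn a b M h n r ^ 2) volume a b :=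
    fun n => hUi.norm.mono_fun' (m2 n) ((ae_restrict_iff' measurableSet_uIoc).2 (b2 n))
  have t1 : Tendsto (fun n => ∫ r in a..b, P r * h r / r * trunc M n 2 (h r)) atTop
      (𝓝 (∫ r in a..b, P r * h r ^ 2 / r)) :=
    intervalIntegral.tendsto_integral_filter_of_dominated_convergence _ (.of_forall m1)
      (.of_forall b1) hPi.norm (hae fun r hr => by
        have := (tendsto_trunc 2 ⟨(H.pos r hr).le, H.le r (Set.Ioo_subset_Icc_self hr)⟩).const_mul
          (P r * h r / r)
        rwa [show P r * h r / r * h r = P r * h r ^ 2 / r by ring] at this)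
  have t2 : Tendsto (fun n => ∫ r in a..b, U r * fn a b M h n r ^ 2) atTop
      (𝓝 (∫ r in a..b, U r * h r ^ 2)) :=
    intervalIntegral.tendsto_integral_filter_of_dominated_convergence _ (.of_forall m2)
      (.of_forall b2) hUi.norm (hae fun r hr => by
        simp only [fn_of_mem (Set.Ioo_subset_Icc_self hr)]
        exact ((tendsto_trunc 1
          ⟨(H.pos r hr).le, H.le r (Set.Ioo_subset_Icc_self hr)⟩).pow 2).const_mul (U r))
  rw [intervalIntegral.integral_add hPi hUi] at hneg
  obtain ⟨n, hn⟩ := ((t1.add t2).eventually_lt_const hneg).exists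
  refine ⟨n, ?_⟩
  obtain ⟨a₁, b₁, -, -, -, -, hc, -⟩ := H.fn_spec n
  rw [intervalIntegral.integral_add (Continuous.intervalIntegrable (by fun_prop) _ _) (i2 n),
    H.integral_dfn_sq n (i1 n)]
  exact hn

end Profile

lemma exists_smooth_approx {f g : ℝ → ℝ} (hd : ∀ r, HasDerivAt f (g r) r) (hg : Continuous g)
    {f₀ a₁ b₁ δ : ℝ} (hl : ∀ r ≤ a₁, f r = f₀) (hr : ∀ r, b₁ ≤ r → f r = 0) (hδ : 0 < δ) :
    ∃ F : ℝ → ℝ, ContDiff ℝ (⊤ : ℕ∞) F ∧ (∀ r ≤ a₁ - δ, F r = f₀) ∧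
      (∀ r, b₁ + δ ≤ r → F r = 0) ∧
      ∀ r ∈ Set.Icc (0 : ℝ) 1, |F r - f r| ≤ δ ∧ |deriv F r - g r| ≤ δ := by
  have hf : Continuous f := continuous_iff_continuousAt.2 fun r => (hd r).continuousAt
  have huf := (isCompact_Icc (a := (-1 : ℝ)) (b := 2)).uniformContinuousOn_of_continuous
    hf.continuousOn
  have hug := (isCompact_Icc (a := (-1 : ℝ)) (b := 2)).uniformContinuousOn_of_continuous
    hg.continuousOn
  rw [Metric.uniformContinuousOn_iff_le] at huf hug
  obtain ⟨δ₁, hδ₁, hf1⟩ := huf δ hδ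
  obtain ⟨δ₂, hδ₂, hg1⟩ := hug δ hδ
  obtain ⟨ρ, hρ, hρδ, hρ1, hρδ₁, hρδ₂⟩ : ∃ ρ > 0, ρ ≤ δ ∧ ρ ≤ 1 ∧ ρ ≤ δ₁ ∧ ρ ≤ δ₂ :=
    ⟨min (min δ 1) (min δ₁ δ₂), by positivity, (min_le_left _ _).trans (min_le_left _ _),
      (min_le_left _ _).trans (min_le_right _ _), (min_le_right _ _).trans (min_le_left _ _),
      (min_le_right _ _).trans (min_le_right _ _)⟩
  let φ : ContDiffBump (0 : ℝ) := ⟨ρ / 2, ρ, by positivity, by linarith⟩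
  have key : ∀ u : ℝ → ℝ, ∀ x : ℝ,
      (convolution (φ.normed volume) u (ContinuousLinearMap.lsmul ℝ ℝ) volume) x =
        ∫ t in (-1 : ℝ)..1, φ.normed volume t * u (x - t) := fun u x => by
    rw [convolution, ← intervalIntegral.integral_eq_integral_of_support_subset (a := -1) (b := 1)]
    · simp
    · intro t ht
      have h1 : φ.normed volume t ≠ 0 := fun h => ht (by simp [h])
      have h2 : t ∈ ball (0 : ℝ) ρ := by
        rw [← φ.support_normed_eq (μ := volume)]
        exact h1
      rw [mem_ball_zero_iff, Real.norm_eq_abs, abs_lt] at h2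
      exact ⟨by linarith, by linarith⟩
  have hφc : Continuous (φ.normed (volume : Measure ℝ)) := φ.continuous_normed
  have hderiv : ∀ x, HasDerivAt
      (convolution (φ.normed volume) f (ContinuousLinearMap.lsmul ℝ ℝ) volume)
      (convolution (φ.normed volume) g (ContinuousLinearMap.lsmul ℝ ℝ) volume x) x := fun x => by
    rw [funext (key f), key g]
    exact hasDerivAt_intervalIntegral_of_continuous
      (G := fun x t => φ.normed volume t * f (x - t))
      (G' := fun x t => φ.normed volume t * g (x - t)) (by fun_prop) (by fun_prop)
      (fun x t => ((hd (x - t)).comp_sub_const x t).const_mul _) x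
  have happ : ∀ (u : ℝ → ℝ), Continuous u → ∀ (x ε : ℝ),
      (∀ y ∈ ball x ρ, dist (u y) (u x) ≤ ε) →
      dist ((convolution (φ.normed volume) u (ContinuousLinearMap.lsmul ℝ ℝ) volume) x) (u x)
        ≤ ε := fun u hu x ε h =>
    φ.dist_normed_convolution_le hu.aestronglyMeasurable h
  refine ⟨convolution (φ.normed volume) f (ContinuousLinearMap.lsmul ℝ ℝ) volume,
    φ.hasCompactSupport_normed.contDiff_convolution_left _ φ.contDiff_normed
      hf.locallyIntegrable, fun r h => ?_, fun r h => ?_, fun r h => ⟨?_, ?_⟩⟩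
  · have e : f r = f₀ := hl r (by linarith)
    refine (dist_le_zero.1 (happ f hf r 0 fun y hy => ?_)).trans e
    rw [mem_ball, Real.dist_eq, abs_lt] at hy
    rw [e, hl y (by linarith), dist_self]
  · have e : f r = 0 := hr r (by linarith)
    refine (dist_le_zero.1 (happ f hf r 0 fun y hy => ?_)).trans e
    rw [mem_ball, Real.dist_eq, abs_lt] at hy
    rw [e, hr y (by linarith), dist_self]
  · rw [← Real.dist_eq]
    refine happ f hf r δ fun y hy => ?_
    have hy' := hy
    rw [mem_ball, Real.dist_eq, abs_lt] at hy'
    exact hf1 y ⟨by linarith [h.1], by linarith [h.2]⟩ r ⟨by linarith [h.1], by linarith [h.2]⟩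
      ((mem_ball.1 hy).le.trans hρδ₁)
  · rw [(hderiv r).deriv, ← Real.dist_eq]
    refine happ g hg r δ fun y hy => ?_
    have hy' := hy
    rw [mem_ball, Real.dist_eq, abs_lt] at hy'
    exact hg1 y ⟨by linarith [h.1], by linarith [h.2]⟩ r ⟨by linarith [h.1], by linarith [h.2]⟩
      ((mem_ball.1 hy).le.trans hρδ₂)

/-- A `C¹` function with negative form may be replaced by a smooth one. -/
lemma exists_smooth_neg {f g U : ℝ → ℝ} (hd : ∀ r, HasDerivAt f (g r) r) (hg : Continuous g)
    {f₀ a₁ a₂ b₁ b₂ : ℝ} (ha : a₂ < a₁) (hb : b₁ < b₂) (hl : ∀ r ≤ a₁, f r = f₀)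
    (hr : ∀ r, b₁ ≤ r → f r = 0) (hU : ContinuousOn U (Set.Icc 0 1))
    (hneg : ∫ r in (0 : ℝ)..1, (r * g r ^ 2 + U r * f r ^ 2) < 0) :
    ∃ F : ℝ → ℝ, ContDiff ℝ (⊤ : ℕ∞) F ∧ (∀ r ≤ a₂, F r = f₀) ∧ (∀ r, b₂ ≤ r → F r = 0) ∧
      ∫ r in (0 : ℝ)..1, (r * deriv F r ^ 2 + U r * F r ^ 2) < 0 := by
  have hf : Continuous f := continuous_iff_continuousAt.2 fun r => (hd r).continuousAt
  set δ : ℕ → ℝ := fun n => min (1 / ((n : ℝ) + 1)) (min (a₁ - a₂) (b₂ - b₁)) with hδ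
  have hδpos : ∀ n, 0 < δ n := fun n =>
    lt_min (by positivity) (lt_min (sub_pos.2 ha) (sub_pos.2 hb))
  have hδ1 : ∀ n, δ n ≤ 1 := fun n => (min_le_left _ _).trans (by
    rw [div_le_one (by positivity)]
    linarith [n.cast_nonneg (α := ℝ)])
  have hδ0 : Tendsto δ atTop (𝓝 0) :=
    squeeze_zero (fun n => (hδpos n).le) (fun n => min_le_left _ _)
      tendsto_one_div_add_atTop_nhds_zero_nat
  choose F hF hFl hFr hFa using fun n => exists_smooth_approx hd hg hl hr (hδpos n)
  have htF : ∀ r ∈ Set.Icc (0 : ℝ) 1, Tendsto (fun n => F n r) atTop (𝓝 (f r)) := fun r hr' =>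
    tendsto_iff_dist_tendsto_zero.2
      (squeeze_zero (fun _ => dist_nonneg) (fun n => (hFa n r hr').1) hδ0)
  have htG : ∀ r ∈ Set.Icc (0 : ℝ) 1, Tendsto (fun n => deriv (F n) r) atTop (𝓝 (g r)) :=
    fun r hr' => tendsto_iff_dist_tendsto_zero.2
      (squeeze_zero (fun _ => dist_nonneg) (fun n => (hFa n r hr').2) hδ0)
  have hdF : ∀ n, Continuous (deriv (F n)) := fun n => (hF n).continuous_deriv (by simp)
  obtain ⟨A, hA⟩ := isCompact_Icc.exists_bound_of_continuousOn (s := Set.Icc (0 : ℝ) 1)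
    hf.continuousOn
  obtain ⟨B, hB⟩ := isCompact_Icc.exists_bound_of_continuousOn (s := Set.Icc (0 : ℝ) 1)
    hg.continuousOn
  obtain ⟨C, hC⟩ := isCompact_Icc.exists_bound_of_continuousOn (s := Set.Icc (0 : ℝ) 1) hU
  have hlim : Tendsto (fun n => ∫ r in (0 : ℝ)..1, (r * deriv (F n) r ^ 2 + U r * F n r ^ 2))
      atTop (𝓝 (∫ r in (0 : ℝ)..1, (r * g r ^ 2 + U r * f r ^ 2))) := by
    refine intervalIntegral.tendsto_integral_filter_of_dominated_convergence
      (fun _ => 1 * (B + 1) ^ 2 + C * (A + 1) ^ 2) (.of_forall fun n => ?_)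
      (.of_forall fun n => ae_of_all _ fun r hr' => ?_) (by simp) (ae_of_all _ fun r hr' => ?_)
    · rw [Set.uIoc_of_le zero_le_one]
      refine ContinuousOn.aestronglyMeasurable ?_ measurableSet_Ioc
      have h1 := hdF n
      have h2 := (hF n).continuous
      exact (by fun_prop : Continuous fun r => r * deriv (F n) r ^ 2).continuousOn.add
        ((hU.mono Set.Ioc_subset_Icc_self).mul (h2.pow 2).continuousOn)
    · rw [Set.uIoc_of_le zero_le_one] at hr'
      have hr := Set.Ioc_subset_Icc_self hr'
      have h1 := hA r hr
      have h2 := hB r hr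
      have h3 := hC r hr
      rw [Real.norm_eq_abs] at h1 h2
      obtain ⟨h4, h5⟩ := hFa n r hr
      have h6 : |F n r| ≤ A + 1 := by
        calc |F n r| = |(F n r - f r) + f r| := by ring_nf
          _ ≤ _ := (abs_add_le _ _).trans (by linarith [hδ1 n])
      have h7 : |deriv (F n) r| ≤ B + 1 := by
        calc |deriv (F n) r| = |(deriv (F n) r - g r) + g r| := by ring_nf
          _ ≤ _ := (abs_add_le _ _).trans (by linarith [hδ1 n])
      refine (norm_add_le _ _).trans (add_le_add ?_ ?_)
      · rw [norm_mul, norm_pow, Real.norm_eq_abs, Real.norm_eq_abs, abs_of_pos hr'.1]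
        gcongr
        exact hr'.2
      · rw [norm_mul, norm_pow, Real.norm_eq_abs (F n r)]
        gcongr
        exact (norm_nonneg _).trans h3
    · rw [Set.uIoc_of_le zero_le_one] at hr'
      have hr := Set.Ioc_subset_Icc_self hr'
      exact (((htG r hr).pow 2).const_mul r).add (((htF r hr).pow 2).const_mul (U r))
  obtain ⟨n, hn⟩ := (hlim.eventually_lt_const hneg).exists
  refine ⟨F n, hF n, fun r h => hFl n r ?_, fun r h => hFr n r ?_, hn⟩
  · have : δ n ≤ a₁ - a₂ := (min_le_right _ _).trans (min_le_left _ _)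
    linarith
  · have : δ n ≤ b₂ - b₁ := (min_le_right _ _).trans (min_le_right _ _)
    linarith

/-- A profile of negative energy yields a smooth function of negative energy which is constant
near `0` and vanishes near `b`. -/
lemma Profile.exists_smooth {a b M : ℝ} {h k P U : ℝ → ℝ} (H : Profile a b M h k P)
    (hb : b ≤ 1) (hP : ContinuousOn P (Set.Ioo a b)) (hU : ContinuousOn U (Set.Ioc 0 1))
    (hcase : h a = 0 ∨ (a = 0 ∧ ContinuousOn U (Set.Icc 0 1)))
    (hPi : IntervalIntegrable (fun r => P r * h r ^ 2 / r) volume a b)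
    (hUi : IntervalIntegrable (fun r => U r * h r ^ 2) volume a b)
    (hneg : ∫ r in a..b, (P r * h r ^ 2 / r + U r * h r ^ 2) < 0) :
    ∃ (F : ℝ → ℝ) (f₀ a₂ b₂ : ℝ), a < a₂ ∧ b₂ < b ∧ (h a = 0 → f₀ = 0) ∧
      ContDiff ℝ (⊤ : ℕ∞) F ∧ (∀ r ≤ a₂, F r = f₀) ∧ (∀ r, b₂ ≤ r → F r = 0) ∧
      ∫ r in (0 : ℝ)..1, (r * deriv F r ^ 2 + U r * F r ^ 2) < 0 := by
  obtain ⟨n, hn⟩ := H.exists_fn_neg hP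
    (hU.mono fun r hr => ⟨H.nonneg.trans_lt hr.1, hr.2.le.trans hb⟩) hPi hUi hneg
  obtain ⟨a₁, b₁, ha₁, hab, hb₁, hd, hc, hl, h0, hr⟩ := H.fn_spec n
  set f := fn a b M h n
  set g := dfn a b M h k n with hg
  have ha0 := H.nonneg
  obtain ⟨a₂, ha₂, ha₂'⟩ := exists_between ha₁
  obtain ⟨b₂, hb₂, hb₂'⟩ := exists_between hb₁
  obtain ⟨V, hV, hVU, hVa⟩ : ∃ V : ℝ → ℝ, ContinuousOn V (Set.Icc 0 1) ∧
      (∀ r ∈ Set.Ioc (0 : ℝ) 1, V r = U r ∨ (r ≤ a₂ ∧ f a = 0)) ∧ (a = 0 ∨ f a = 0) := by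
    rcases hcase with h1 | ⟨h1, h2⟩
    · refine ⟨fun r => U (max r a₂), hU.comp (by fun_prop) fun r hr =>
        ⟨(ha0.trans_lt ha₂).trans_le (le_max_right _ _), max_le hr.2 (by linarith)⟩,
        fun r hr => ?_, Or.inr (h0 h1)⟩
      rcases le_total r a₂ with h3 | h3
      · exact Or.inr ⟨h3, h0 h1⟩
      · exact Or.inl (by simp only [max_eq_left h3])
    · exact ⟨U, h2, fun r hr => Or.inl rfl, Or.inl h1⟩
  have hn' : ∫ r in (0 : ℝ)..1, (r * g r ^ 2 + V r * f r ^ 2) < 0 := by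
    refine lt_of_eq_of_lt ?_ hn
    rw [intervalIntegral.integral_of_le zero_le_one, intervalIntegral.integral_of_le H.lt.le,
      setIntegral_eq_of_subset_of_forall_sdiff_eq_zero measurableSet_Ioc
        (Set.Ioc_subset_Ioc ha0 hb)]
    · refine setIntegral_congr_fun measurableSet_Ioc fun r hr => ?_
      rcases hVU r (Set.Ioc_subset_Ioc ha0 hb hr) with h1 | ⟨h1, h2⟩
      · rw [h1]
      · rw [hl r (by linarith), h2]
        ring
    · intro r hr'
      have h1 : g r = 0 := Profile.dfn_of_not_mem (fun h => hr'.2 (Set.Ioo_subset_Ioc_self h)) n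
      rcases le_or_gt r a with h2 | h2
      · rcases hVa with h3 | h3
        · exact absurd hr'.1.1 (by linarith)
        · rw [h1, hl r (by linarith), h3]
          ring
      · have h3 : b < r := by
          by_contra h
          exact hr'.2 ⟨h2, not_lt.1 h⟩
        rw [h1, hr r (by linarith)]
        ring
  obtain ⟨F, hF, hFl, hFr, hFn⟩ := exists_smooth_neg hd hc ha₂' hb₂ hl hr hV hn'
  refine ⟨F, f a, a₂, b₂, ha₂, hb₂', h0, hF, hFl, hFr, lt_of_eq_of_lt ?_ hFn⟩
  rw [intervalIntegral.integral_of_le zero_le_one, intervalIntegral.integral_of_le zero_le_one]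
  refine setIntegral_congr_fun measurableSet_Ioc fun r hr => ?_
  rcases hVU r hr with h1 | ⟨h1, h2⟩
  · rw [h1]
  · rw [hFl r h1, h2]
    ring

/-- The potential `p |x|^{2+α} |u|^{p-1}` in terms of the normalized profile. -/
def weight (α p c : ℝ) (w : ℝ → ℝ) (r : ℝ) : ℝ :=
  p * (r ^ (2 + α) * (((2 + α) / 2) ^ 2 * c ^ 2 * |w (c * r ^ ((2 + α) / 2))| ^ (p - 1)))

/-- A smooth function on `(0, 1)` on which the form of the angular mode with eigenvalue `m` is
negative, and which is constant near `a` and vanishes near `b`. -/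
def HasNegMode (m : ℝ) (W : ℝ → ℝ) (a b : ℝ) (Z : Prop) : Prop :=
  ∃ (F : ℝ → ℝ) (f₀ a₂ b₂ : ℝ), a < a₂ ∧ b₂ < b ∧ (Z → f₀ = 0) ∧
    ContDiff ℝ (⊤ : ℕ∞) F ∧ (∀ r ≤ a₂, F r = f₀) ∧ (∀ r, b₂ ≤ r → F r = 0) ∧
    ∫ r in (0 : ℝ)..1, (r * deriv F r ^ 2 + (m - W r) / r * F r ^ 2) < 0

lemma weight_eq (α p c : ℝ) (w : ℝ → ℝ) {r : ℝ} (hr : 0 ≤ r) :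
    weight α p c w r = p * (((2 + α) / 2) ^ 2 * ((c * r ^ ((2 + α) / 2)) ^ 2 *
      |w (c * r ^ ((2 + α) / 2))| ^ (p - 1))) := by
  have e : r ^ (2 + α) = (r ^ ((2 + α) / 2)) ^ 2 := by
    rw [← Real.rpow_natCast, ← Real.rpow_mul hr]
    congr 1
    push_cast
    ring
  rw [weight, e]
  ring

lemma LaneEmdenPair.continuousOn_weight_div {α p c : ℝ} {w d : ℝ → ℝ} (hα : 0 ≤ α)
    (H : LaneEmdenPair p c w d) :
    ContinuousOn (fun r => weight α p c w r / r) (Set.Icc 0 1) := by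
  have h : ContinuousOn (fun r => p * (r ^ (1 + α) * (((2 + α) / 2) ^ 2 * c ^ 2 *
      |w (c * r ^ ((2 + α) / 2))| ^ (p - 1)))) (Set.Icc 0 1) :=
    continuousOn_const.mul ((Real.continuous_rpow_const (by positivity)).continuousOn.mul
      (continuousOn_const.mul (H.continuousOn_abs_rpow (by positivity))))
  refine h.congr fun r hr => ?_
  simp only [weight]
  rcases hr.1.eq_or_lt with rfl | hr0
  · simp [Real.zero_rpow (show 1 + α ≠ 0 by positivity)]
  · rw [show 2 + α = (1 + α) + 1 by ring, Real.rpow_add_one hr0.ne']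
    field_simp

lemma EulerPair.const_mul {h k P : ℝ → ℝ} {s : Set ℝ} (H : EulerPair h k P s) (e : ℝ) :
    EulerPair (fun r => e * h r) (fun r => e * k r) P s := fun r hr =>
  ⟨((H r hr).1.const_mul e).congr_deriv (by ring), ((H r hr).2.const_mul e).congr_deriv (by ring)⟩

/-- Each nodal zone of the solution contributes a negative direction of the radial form. -/
lemma LaneEmdenPair.hasNegMode_zero {α p c : ℝ} {w d : ℝ → ℝ} (hα : 0 ≤ α)
    (H : LaneEmdenPair p c w d) {a b e : ℝ} (ha : 0 ≤ a) (hab : a < b) (hb : b ≤ 1)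
    (he : |e| = 1) (hpos : ∀ r ∈ Set.Ioo a b, 0 < e * w (c * r ^ ((2 + α) / 2)))
    (hwb : w (c * b ^ ((2 + α) / 2)) = 0)
    (hwa : w (c * a ^ ((2 + α) / 2)) = 0 ∨ (a = 0 ∧ e = 1)) :
    HasNegMode 0 (weight α p c w) a b (w (c * a ^ ((2 + α) / 2)) = 0) := by
  have hκ : 0 < (2 + α) / 2 := by positivity
  have hp := H.one_lt
  have hsub : Set.Icc a b ⊆ Set.Icc 0 1 := Set.Icc_subset_Icc ha hb
  have hsub' : Set.Ioo a b ⊆ Set.Ioo 0 1 := Set.Ioo_subset_Ioo ha hb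
  set κ := (2 + α) / 2 with hκd
  set h : ℝ → ℝ := fun r => e * w (c * r ^ κ) with hh
  set P : ℝ → ℝ := fun r => κ ^ 2 * ((c * r ^ κ) ^ 2 * |w (c * r ^ κ)| ^ (p - 1)) with hPd
  have hW : ∀ r, 0 ≤ r → weight α p c w r = p * P r := fun r hr => weight_eq α p c w hr
  have hwc : ContinuousOn h (Set.Icc 0 1) := continuousOn_const.mul (H.cont.comp
    (continuous_const.mul (Real.continuous_rpow_const hκ.le)).continuousOn
    fun r hr => mul_rpow_mem_Icc H.pos hκ hr)
  have hWc := H.continuousOn_weight_div hα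
  have hPc : ContinuousOn (fun r => P r / r) (Set.Icc 0 1) := by
    refine (hWc.const_mul p⁻¹).congr fun r hr => ?_
    simp only [hW r hr.1]
    field_simp
  have hpro : Profile a b 1 h (fun r => e * (κ * d (c * r ^ κ))) P := by
    refine ⟨ha, hab, ?_, hwc.mono hsub, hpos, fun r hr => ?_, ?_, ?_⟩
    · exact (H.euler.comp_rpow H.pos fun r hr =>
        ⟨(hsub' hr).1, mul_rpow_mem_Ioo H.pos hκ (hsub' hr)⟩).const_mul e
    · refine (le_abs_self _).trans ?_
      rw [hh, abs_mul, he, one_mul]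
      exact H.abs_le_one _ (mul_rpow_mem_Icc H.pos hκ (hsub hr))
    · simp only [hh, hwb, mul_zero]
    · rcases hwa with h1 | ⟨rfl, rfl⟩
      · exact Or.inl (by simp only [hh, h1, mul_zero])
      · refine Or.inr ⟨?_, ?_⟩
        · simp only [hh, Real.zero_rpow hκ.ne', mul_zero, H.init, mul_one]
        · have := ((H.lim.comp (tendsto_mul_rpow_nhdsGT H.pos hκ)).const_mul κ).const_mul 1
          simpa using this
  have hPIoo : ContinuousOn P (Set.Ioo a b) :=
    ((hPc.mono (hsub'.trans Set.Ioo_subset_Icc_self)).mul continuousOn_id).congr fun r hr => by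
      have := (hsub' hr).1.ne'
      simp only [Pi.mul_apply, id]
      field_simp
  have hUc : ContinuousOn (fun r => (0 - weight α p c w r) / r) (Set.Icc 0 1) :=
    hWc.neg.congr fun r _ => by
      simp only [Pi.neg_apply]
      ring
  have i1 : ContinuousOn (fun r => P r * h r ^ 2 / r) (Set.Icc 0 1) :=
    (hPc.mul (hwc.pow 2)).congr fun r _ => by
      simp only [Pi.mul_apply, Pi.pow_apply]
      ring
  have i2 := hUc.mul (hwc.pow 2)
  have hu : Set.uIcc a b ⊆ Set.Icc 0 1 := by rwa [Set.uIcc_of_le hab.le]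
  have hcase : h a = 0 ∨ (a = 0 ∧
      ContinuousOn (fun r => (0 - weight α p c w r) / r) (Set.Icc 0 1)) := by
    rcases hwa with h1 | ⟨h1, -⟩
    · exact Or.inl (by simp only [hh, h1, mul_zero])
    · exact Or.inr ⟨h1, hUc⟩
  have hneg : ∫ r in a..b, (P r * h r ^ 2 / r + (0 - weight α p c w r) / r * h r ^ 2) < 0 := by
    have hlt : 0 < ∫ r in a..b, (p - 1) * (P r * h r ^ 2 / r) := by
      refine intervalIntegral.intervalIntegral_pos_of_pos_on
        ((i1.mono hu).intervalIntegrable.const_mul _) (fun r hr => ?_) hab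
      have hr0 := (hsub' hr).1
      have h1 := hpos r hr
      have h2 : 0 < |w (c * r ^ κ)| := abs_pos.2 fun h0 => by simp [h0] at h1
      have h3 := H.pos
      have h4 : 0 < h r := h1
      have h5 : 0 < p - 1 := by linarith
      simp only [hPd]
      positivity
    rw [← neg_pos, ← intervalIntegral.integral_neg]
    refine hlt.trans_eq (intervalIntegral.integral_congr fun r hr => ?_)
    simp only [hW r (hu hr).1]
    ring
  obtain ⟨F, f₀, a₂, b₂, h1, h2, h3, h4⟩ := hpro.exists_smooth hb hPIoo
    (hUc.mono Set.Ioc_subset_Icc_self) hcase ((i1.mono hu).intervalIntegrable)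
    ((i2.mono hu).intervalIntegrable) hneg
  exact ⟨F, f₀, a₂, b₂, h1, h2, fun h5 => h3 (by simp only [hh, h5, mul_zero]), h4⟩

lemma continuousOn_bessel_sq_div {β z κ : ℝ} (hβ : 0 ≤ β) (hz : 0 < z) (hκ : 0 < κ)
    (hs : 1 ≤ κ * β) : ContinuousOn (fun r => besselJ β (z * r ^ κ) ^ 2 / r) (Set.Icc 0 1) := by
  have hG := continuous_besselG hβ
  have hrκ := Real.continuous_rpow_const hκ.le
  have h : Continuous fun r : ℝ => (z ^ β) ^ 2 * (r ^ (2 * (κ * β) - 1) *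
      besselG β ((z * r ^ κ / 2) ^ 2) ^ 2) :=
    continuous_const.mul ((Real.continuous_rpow_const (by linarith)).mul
      ((hG.comp (by fun_prop)).pow 2))
  refine h.continuousOn.congr fun r hr => ?_
  simp only [besselJ_eq]
  rcases hr.1.eq_or_lt with rfl | hr0
  · simp [Real.zero_rpow (show 2 * (κ * β) - 1 ≠ 0 by linarith)]
  · have e : r ^ (2 * (κ * β)) = ((r ^ κ) ^ β) ^ 2 := by
      rw [← Real.rpow_mul hr.1, ← Real.rpow_two, ← Real.rpow_mul hr.1, mul_comm 2]
    rw [Real.mul_rpow hz.le (Real.rpow_nonneg hr.1 _), Real.rpow_sub_one hr0.ne', e]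
    ring

/-- The low angular modes are negative as soon as the solution is close to the limit problem. -/
lemma exists_hasNegMode {α β z k : ℝ} (hα : 0 ≤ α) (hβ : 0 < β) (hz : IsNthZero β 1 z)
    (hk : 1 ≤ k) (hkβ : k < (2 + α) / 2 * β) :
    ∃ ε > 0, ∀ p c w d, LaneEmdenPair p c w d → z ≤ c →
      ∫ r in (0 : ℝ)..1, (1 - |w (c * r ^ ((2 + α) / 2))| ^ (p - 1)) ≤ ε →
      HasNegMode (k ^ 2) (weight α p c w) 0 1 True := by
  have hκ1 : 1 ≤ (2 + α) / 2 := by linarith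
  have hW : ∀ (p c : ℝ) (w : ℝ → ℝ) (r : ℝ), 0 ≤ r → weight α p c w r =
      p * (((2 + α) / 2) ^ 2 * ((c * r ^ ((2 + α) / 2)) ^ 2 *
        |w (c * r ^ ((2 + α) / 2))| ^ (p - 1))) := fun p c w r hr => weight_eq α p c w hr
  set κ := (2 + α) / 2 with hκd
  have hκ : 0 < κ := by linarith
  have hz0 := hz.1
  set h : ℝ → ℝ := fun r => besselJ β (z * r ^ κ) with hh
  set P : ℝ → ℝ := fun r => κ ^ 2 * ((z * r ^ κ) ^ 2 - β ^ 2) with hPd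
  have hrκ := Real.continuous_rpow_const hκ.le
  have hc : Continuous h := (continuous_besselJ hβ.le).comp (by fun_prop)
  have hPc : Continuous P := by fun_prop
  have hdiv : ContinuousOn (fun r => h r ^ 2 / r) (Set.Icc 0 1) :=
    continuousOn_bessel_sq_div hβ.le hz0 hκ (hk.trans hkβ.le)
  obtain ⟨C, hC⟩ := isCompact_Icc.exists_bound_of_continuousOn (s := Set.Icc (0 : ℝ) 1)
    hc.continuousOn
  have hpos : ∀ r ∈ Set.Ioo (0 : ℝ) 1, 0 < h r := fun r hr =>
    besselJ_pos_of_isNthZero_one hβ.le hz _ (mul_rpow_mem_Ioo hz0 hκ hr)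
  have h0 : h 0 = 0 := by
    simp only [hh, besselJ_eq, Real.zero_rpow hκ.ne', mul_zero, Real.zero_rpow hβ.ne', zero_mul]
  have hpro : Profile 0 1 C h (fun r => κ * besselD β (z * r ^ κ)) P :=
    ⟨le_rfl, zero_lt_one, (eulerPair_bessel_rpow hβ.le hz0 κ).mono Set.Ioo_subset_Ioi_self,
      hc.continuousOn, hpos, fun r hr => (le_abs_self _).trans (hC r hr),
      by simp only [hh, Real.one_rpow, mul_one, hz.2.1], Or.inl h0⟩
  have hu : Set.uIcc (0 : ℝ) 1 ⊆ Set.Icc 0 1 := by rw [Set.uIcc_of_le zero_le_one]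
  set I := ∫ r in (0 : ℝ)..1, h r ^ 2 / r with hI
  have hIpos : 0 < I := by
    refine intervalIntegral.intervalIntegral_pos_of_pos_on
      ((hdiv.mono hu).intervalIntegrable) (fun r hr => ?_) zero_lt_one
    have := hpos r hr
    have := hr.1
    positivity
  set D := κ ^ 2 * z ^ 2 * C ^ 2 + 1 with hD
  have hDpos : 0 < D := by positivity
  set γ := (κ * β) ^ 2 - k ^ 2 with hγ
  have hγpos : 0 < γ := by
    rw [hγ, sub_pos]
    gcongr
  refine ⟨γ * I / (2 * D), by positivity, fun p c w d H hzc hInt => ?_⟩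
  have hp := H.one_lt
  have hω := H.continuousOn_abs_rpow hκ
  have hWc := H.continuousOn_weight_div hα
  have hUc : ContinuousOn (fun r => (k ^ 2 - weight α p c w r) / r) (Set.Ioc 0 1) :=
    ((continuousOn_const (c := k ^ 2)).div continuousOn_id fun r hr => hr.1.ne').sub
      (hWc.mono Set.Ioc_subset_Icc_self) |>.congr fun r _ => by
        simp only [Pi.sub_apply, Pi.div_apply, id]
        ring
  have i1 : IntervalIntegrable (fun r => P r * h r ^ 2 / r) volume 0 1 :=
    (((hPc.continuousOn.mul hdiv).congr fun r _ => by
      simp only [Pi.mul_apply]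
      ring).mono hu).intervalIntegrable
  have i2 : IntervalIntegrable (fun r => (k ^ 2 - weight α p c w r) / r * h r ^ 2) volume 0 1 :=
    ((((hdiv.const_mul (k ^ 2)).sub (hWc.mul (hc.pow 2).continuousOn)).congr fun r _ => by
      simp only [Pi.sub_apply, Pi.mul_apply, Pi.pow_apply]
      ring).mono hu).intervalIntegrable
  have i3 : IntervalIntegrable (fun r => 1 - |w (c * r ^ κ)| ^ (p - 1)) volume 0 1 :=
    ((continuousOn_const.sub hω).mono hu).intervalIntegrable
  have i4 : IntervalIntegrable (fun r => h r ^ 2 / r) volume 0 1 :=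
    (hdiv.mono hu).intervalIntegrable
  have hneg : ∫ r in (0 : ℝ)..1,
      (P r * h r ^ 2 / r + (k ^ 2 - weight α p c w r) / r * h r ^ 2) < 0 := by
    have hle : ∫ r in (0 : ℝ)..1,
        (P r * h r ^ 2 / r + (k ^ 2 - weight α p c w r) / r * h r ^ 2) ≤
        ∫ r in (0 : ℝ)..1, (D * (1 - |w (c * r ^ κ)| ^ (p - 1)) - γ * (h r ^ 2 / r)) := by
      refine intervalIntegral.integral_mono_on zero_le_one (i1.add i2)
        ((i3.const_mul D).sub (i4.const_mul γ)) fun r hr => ?_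
      have hω0 : 0 ≤ |w (c * r ^ κ)| ^ (p - 1) := by positivity
      have hω1 := H.rpow_abs_le_one (mul_rpow_mem_Icc H.pos hκ hr)
      rw [hW p c w r hr.1]
      set ω := |w (c * r ^ κ)| ^ (p - 1)
      rcases hr.1.eq_or_lt with rfl | hr0
      · simp only [div_zero, zero_mul, mul_zero, add_zero, sub_zero]
        exact mul_nonneg hDpos.le (by linarith)
      · have e1 : (r ^ κ) ^ 2 / r ≤ 1 := by
          rw [div_le_one hr0]
          have h1 : r ^ κ ≤ r := by
            simpa using Real.rpow_le_rpow_of_exponent_ge hr0 hr.2 hκ1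
          have h2 : 0 ≤ r ^ κ := Real.rpow_nonneg hr.1 _
          nlinarith [hr.2]
        have e2 : h r ^ 2 ≤ C ^ 2 := by
          rw [← sq_abs]
          exact pow_le_pow_left₀ (abs_nonneg _) (hC r hr) 2
        have e3 : z ^ 2 * ω ≤ p * c ^ 2 * ω := by
          refine mul_le_mul_of_nonneg_right ?_ hω0
          nlinarith [H.pos]
        have e4 : 0 ≤ (r ^ κ) ^ 2 / r := by positivity
        have e5 : (r ^ κ) ^ 2 / r * (κ ^ 2 * (z ^ 2 * (1 - ω))) * h r ^ 2 ≤
            1 * (κ ^ 2 * (z ^ 2 * (1 - ω))) * C ^ 2 := by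
          have : 0 ≤ 1 - ω := by linarith
          gcongr
        have e6 : (r ^ κ) ^ 2 / r * (κ ^ 2 * (z ^ 2 - p * c ^ 2 * ω)) * h r ^ 2 ≤
            (r ^ κ) ^ 2 / r * (κ ^ 2 * (z ^ 2 * (1 - ω))) * h r ^ 2 := by
          gcongr
          linarith
        have e7 : P r * h r ^ 2 / r + (k ^ 2 - p * (κ ^ 2 * ((c * r ^ κ) ^ 2 * ω))) / r * h r ^ 2 =
            (r ^ κ) ^ 2 / r * (κ ^ 2 * (z ^ 2 - p * c ^ 2 * ω)) * h r ^ 2 -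
              γ * (h r ^ 2 / r) := by
          simp only [hPd, hγ]
          ring
        rw [e7, hD]
        nlinarith
    refine hle.trans_lt ?_
    rw [intervalIntegral.integral_sub (i3.const_mul D) (i4.const_mul γ),
      intervalIntegral.integral_const_mul, intervalIntegral.integral_const_mul]
    have h1 := mul_le_mul_of_nonneg_left hInt hDpos.le
    have h2 : D * (γ * I / (2 * D)) = γ * I / 2 := by field_simp
    have h3 : 0 < γ * I := by positivity
    rw [h2] at h1
    rw [← hI]
    linarith
  obtain ⟨F, f₀, a₂, b₂, h1, h2, h3, h4⟩ := hpro.exists_smooth le_rfl hPc.continuousOn hUc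
    (Or.inl h0) i1 i2 hneg
  exact ⟨F, f₀, a₂, b₂, h1, h2, fun _ => h3 h0, h4⟩

/-- The function with polar form `F(r) cos(kθ - φ)`. -/
def modeFn (F : ℝ → ℝ) (k : ℕ) (φ : ℝ) (x : E2) : ℝ :=
  F ‖x‖ / ‖x‖ ^ k * (Complex.exp (-φ * Complex.I) * ((x 0 : ℂ) + x 1 * Complex.I) ^ k).re

lemma modeFn_smul_eRad (F : ℝ → ℝ) (k : ℕ) (φ : ℝ) {r : ℝ} (hr : 0 < r) (θ : ℝ) :
    modeFn F k φ (r • eRad θ) = F r * cos (k * θ - φ) := by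
  have e : Complex.exp (-φ * Complex.I) *
      ((((r • eRad θ) 0 : ℝ) : ℂ) + ((r • eRad θ) 1 : ℝ) * Complex.I) ^ k =
      ((r ^ k : ℝ) : ℂ) * Complex.exp ((k * θ - φ : ℝ) * Complex.I) := by
    have e1 : ((((r • eRad θ) 0 : ℝ) : ℂ) + ((r • eRad θ) 1 : ℝ) * Complex.I) =
        r * Complex.exp (θ * Complex.I) := by
      rw [smul_eRad, Complex.exp_mul_I]
      simp only [pt, PiLp.toLp_apply, Matrix.cons_val_zero, Matrix.cons_val_one]
      push_cast
      ring
    rw [e1, mul_pow, ← Complex.exp_nat_mul, mul_left_comm, ← Complex.exp_add]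
    push_cast
    ring_nf
  rw [modeFn, e, Complex.re_ofReal_mul, Complex.exp_ofReal_mul_I_re, norm_smul_eRad hr.le]
  field_simp

lemma contDiff_modeFn {F : ℝ → ℝ} (hF : ContDiff ℝ (⊤ : ℕ∞) F) {k : ℕ} {f₀ a₂ : ℝ}
    (ha : 0 < a₂) (hFa : ∀ r ≤ a₂, F r = f₀) (hk : k ≠ 0 → f₀ = 0) (φ : ℝ) :
    ContDiff ℝ (⊤ : ℕ∞) (modeFn F k φ) := by
  rw [contDiff_iff_contDiffAt]
  intro x
  rcases eq_or_ne x 0 with rfl | hx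
  · have h : modeFn F k φ =ᶠ[𝓝 0] fun _ => modeFn F k φ 0 := by
      filter_upwards [ball_mem_nhds (0 : E2) ha] with x hx
      rw [mem_ball_zero_iff] at hx
      rcases eq_or_ne k 0 with rfl | h0
      · simp [modeFn, hFa _ hx.le, hFa 0 ha.le]
      · simp [modeFn, hFa _ hx.le, hFa 0 ha.le, hk h0]
    exact contDiffAt_const.congr_of_eventuallyEq h
  · have h1 : ContDiffAt ℝ (⊤ : ℕ∞) (fun x : E2 => ‖x‖) x := contDiffAt_norm ℝ hx
    have hc : ∀ i, ContDiff ℝ (⊤ : ℕ∞) fun x : E2 => ((x i : ℝ) : ℂ) := fun i =>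
      Complex.ofRealCLM.contDiff.comp (EuclideanSpace.proj (𝕜 := ℝ) i).contDiff
    have h2 : ContDiff ℝ (⊤ : ℕ∞) fun x : E2 =>
        (Complex.exp (-φ * Complex.I) * ((x 0 : ℂ) + x 1 * Complex.I) ^ k).re :=
      Complex.reCLM.contDiff.comp
        (contDiff_const.mul (((hc 0).add ((hc 1).mul contDiff_const)).pow k))
    exact ((hF.contDiffAt.comp x h1).div (h1.pow k) (pow_ne_zero _ (norm_ne_zero_iff.2 hx))).mul
      h2.contDiffAt

lemma integral_cos_int_mul_sub (m : ℤ) (δ : ℝ) :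
    ∫ θ in (-π)..π, cos (m * θ - δ) = if m = 0 then 2 * π * cos δ else 0 := by
  split_ifs with h
  · simp only [h, Int.cast_zero, zero_mul, zero_sub, Real.cos_neg,
      intervalIntegral.integral_const, smul_eq_mul]
    ring
  · have hm : (m : ℝ) ≠ 0 := Int.cast_ne_zero.2 h
    rw [intervalIntegral.integral_comp_mul_sub (fun x => cos x) hm, integral_cos,
      Real.sin_sub, Real.sin_sub, mul_neg, Real.sin_neg, Real.cos_neg, Real.sin_int_mul_pi]
    simp

lemma integral_cos_mul_cos (k l : ℕ) (φ φ' : ℝ) :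
    ∫ θ in (-π)..π, cos (k * θ - φ) * cos (l * θ - φ') =
      (if k = l then π * cos (φ - φ') else 0) +
        if k + l = 0 then π * cos (φ + φ') else 0 := by
  have e : ∀ θ : ℝ, cos (k * θ - φ) * cos (l * θ - φ') =
      2⁻¹ * cos (((k - l : ℤ) : ℝ) * θ - (φ - φ')) +
        2⁻¹ * cos (((k + l : ℤ) : ℝ) * θ - (φ + φ')) := fun θ => by
    have e1 : ((k - l : ℤ) : ℝ) * θ - (φ - φ') = (k * θ - φ) - (l * θ - φ') := by push_cast; ring
    have e2 : ((k + l : ℤ) : ℝ) * θ - (φ + φ') = (k * θ - φ) + (l * θ - φ') := by push_cast; ring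
    rw [e1, e2, Real.cos_sub (k * θ - φ), Real.cos_add (k * θ - φ)]
    ring
  simp only [e]
  rw [intervalIntegral.integral_add (Continuous.intervalIntegrable (by fun_prop) _ _)
    (Continuous.intervalIntegrable (by fun_prop) _ _), intervalIntegral.integral_const_mul,
    intervalIntegral.integral_const_mul, integral_cos_int_mul_sub, integral_cos_int_mul_sub]
  have e3 : ((k : ℤ) - l = 0) ↔ k = l := by omega
  have e4 : ((k : ℤ) + l = 0) ↔ k + l = 0 := by omega
  simp only [e3, e4]
  split_ifs <;> ring

lemma integral_sin_mul_sin (k l : ℕ) (φ φ' : ℝ) :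
    ∫ θ in (-π)..π, sin (k * θ - φ) * sin (l * θ - φ') =
      (if k = l then π * cos (φ - φ') else 0) -
        if k + l = 0 then π * cos (φ + φ') else 0 := by
  have h := integral_cos_mul_cos k l (φ + π / 2) (φ' + π / 2)
  simp only [← sub_sub, Real.cos_sub_pi_div_two] at h
  rw [h, show φ + π / 2 - φ' = φ - φ' + π / 2 by ring,
    Real.sin_add_pi_div_two, show φ + π / 2 + (φ' + π / 2) = φ + φ' + π by ring, Real.cos_add_pi]
  split_ifs <;> ring

/-- Parseval's identity for a finite orthogonal family. -/
lemma integral_sq_sum {ι : Type*} [Fintype ι] [DecidableEq ι] {c N : ι → ℝ} {χ : ι → ℝ → ℝ}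
    (hχ : ∀ i, Continuous (χ i))
    (h : ∀ i j, c i * c j * ∫ θ in (-π)..π, χ i θ * χ j θ = if i = j then c i ^ 2 * N i else 0) :
    ∫ θ in (-π)..π, (∑ i, c i * χ i θ) ^ 2 = ∑ i, c i ^ 2 * N i := by
  have e : ∀ θ, (∑ i, c i * χ i θ) ^ 2 = ∑ i, ∑ j, c i * c j * (χ i θ * χ j θ) := fun θ => by
    rw [sq, Finset.sum_mul_sum]
    exact Finset.sum_congr rfl fun i _ => Finset.sum_congr rfl fun j _ => by ring
  simp only [e]
  have hij : ∀ i j, Continuous fun θ => c i * c j * (χ i θ * χ j θ) := fun i j =>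
    ((hχ i).mul (hχ j)).const_mul _
  rw [intervalIntegral.integral_finsetSum fun i _ =>
    (continuous_finsetSum _ fun j _ => hij i j).intervalIntegrable _ _]
  refine Finset.sum_congr rfl fun i _ => ?_
  rw [intervalIntegral.integral_finsetSum fun j _ => (hij i j).intervalIntegrable _ _]
  simp only [intervalIntegral.integral_const_mul, h]
  simp

section
variable {ι : Type*} [Fintype ι] [DecidableEq ι] {k : ι → ℕ} {φ : ι → ℝ}

/-- The squared norm of an angular mode on the circle. -/
def modeNorm (k : ℕ) : ℝ := if k = 0 then 2 * π else π

lemma modeNorm_pos (k : ℕ) : 0 < modeNorm k := by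
  unfold modeNorm
  split_ifs <;> positivity

lemma integral_sq_sum_cos {c : ι → ℝ} (hφ : ∀ i, k i = 0 → φ i = 0)
    (hc : ∀ i j, i ≠ j → k i = k j → c i * c j = 0 ∨ (k i ≠ 0 ∧ cos (φ i - φ j) = 0)) :
    ∫ θ in (-π)..π, (∑ i, c i * cos (k i * θ - φ i)) ^ 2 = ∑ i, c i ^ 2 * modeNorm (k i) := by
  refine integral_sq_sum (χ := fun i θ => cos (k i * θ - φ i)) (fun i => by fun_prop)
    fun i j => ?_
  rw [integral_cos_mul_cos]
  split_ifs with h1 h2 h3 h3 h2 h3 h3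
  all_goals first | omega | skip
  · subst h3
    have h0 : k i = 0 := by omega
    rw [hφ i h0, modeNorm, if_pos h0]
    simp
    ring
  · rcases hc i j h3 h1 with h4 | ⟨h4, -⟩
    · rw [h4, zero_mul]
    · omega
  · subst h3
    rw [modeNorm, if_neg (by omega)]
    simp
    ring
  · rcases hc i j h3 h1 with h4 | ⟨h4, h5⟩
    · rw [h4, zero_mul]
    · simp [h5]
  all_goals first | exact absurd (congrArg k h3) h1 | simp

lemma integral_sq_sum_sin {c : ι → ℝ} (hφ : ∀ i, k i = 0 → c i = 0)
    (hc : ∀ i j, i ≠ j → k i = k j → c i * c j = 0 ∨ (k i ≠ 0 ∧ cos (φ i - φ j) = 0)) :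
    ∫ θ in (-π)..π, (∑ i, c i * sin (k i * θ - φ i)) ^ 2 = ∑ i, c i ^ 2 * modeNorm (k i) := by
  refine integral_sq_sum (χ := fun i θ => sin (k i * θ - φ i)) (fun i => by fun_prop)
    fun i j => ?_
  rw [integral_sin_mul_sin]
  split_ifs with h1 h2 h3 h3 h2 h3 h3
  all_goals first | omega | skip
  · simp [hφ i (by omega)]
  · simp [hφ i (by omega)]
  · subst h3
    rw [modeNorm, if_neg (by omega)]
    simp
    ring
  · rcases hc i j h3 h1 with h4 | ⟨h4, h5⟩
    · rw [h4, zero_mul]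
    · simp [h5]
  all_goals first | exact absurd (congrArg k h3) h1 | simp

lemma radialDensity_sum_modeFn {F : ι → ℝ → ℝ} (hF : ∀ i, ContDiff ℝ (⊤ : ℕ∞) (F i))
    (hφ : ∀ i, k i = 0 → φ i = 0)
    (horth : ∀ i j, i ≠ j → k i = k j →
      (∀ r, F i r * F j r = 0 ∧ deriv (F i) r * deriv (F j) r = 0) ∨
        (k i ≠ 0 ∧ cos (φ i - φ j) = 0))
    (a : ι → ℝ) (hψ : ContDiff ℝ 1 (∑ i, a i • modeFn (F i) (k i) (φ i))) (W : ℝ → ℝ) {r : ℝ}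
    (hr : 0 < r) :
    radialDensity W (∑ i, a i • modeFn (F i) (k i) (φ i)) r = ∑ i, a i ^ 2 * modeNorm (k i) *
      (r * deriv (F i) r ^ 2 + ((k i : ℝ) ^ 2 - W r) / r * F i r ^ 2) := by
  set ψ := ∑ i, a i • modeFn (F i) (k i) (φ i) with hψd
  have hpol : ∀ s, 0 < s → ∀ θ, pol ψ s θ = ∑ i, a i * F i s * cos (k i * θ - φ i) :=
    fun s hs θ => by
      simp only [hψd, pol, Finset.sum_apply, Pi.smul_apply, smul_eq_mul,
        modeFn_smul_eRad _ _ _ hs, mul_assoc]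
  have hpolR : ∀ θ, polR ψ r θ = ∑ i, a i * deriv (F i) r * cos (k i * θ - φ i) := fun θ => by
    refine (hasDerivAt_pol_left hψ r θ).unique ?_
    have h : HasDerivAt (fun s => ∑ i, a i * F i s * cos (k i * θ - φ i))
        (∑ i, a i * deriv (F i) r * cos (k i * θ - φ i)) r := by
      refine HasDerivAt.fun_sum fun i _ => ?_
      exact ((((hF i).differentiable (by simp)) r).hasDerivAt.const_mul (a i)).mul_const _
    refine h.congr_of_eventuallyEq ?_
    filter_upwards [lt_mem_nhds hr] with s hs using hpol s hs θ
  have hpolA : ∀ θ, polA ψ r θ = ∑ i, -(a i * F i r * k i) * sin (k i * θ - φ i) := fun θ => by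
    refine (hasDerivAt_pol_right hψ r θ).unique ?_
    have h : HasDerivAt (fun θ => ∑ i, a i * F i r * cos (k i * θ - φ i))
        (∑ i, -(a i * F i r * k i) * sin (k i * θ - φ i)) θ := by
      refine HasDerivAt.fun_sum fun i _ => ?_
      have h1 : HasDerivAt (fun θ : ℝ => k i * θ - φ i) (k i) θ := by
        simpa using ((hasDerivAt_id θ).const_mul (k i : ℝ)).sub_const (φ i)
      exact (h1.cos.const_mul (a i * F i r)).congr_deriv (by ring)
    exact h.congr_of_eventuallyEq (.of_forall fun θ => hpol r hr θ)
  have e1 : circleSq (pol ψ) r = ∑ i, (a i * F i r) ^ 2 * modeNorm (k i) := by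
    simp only [circleSq, hpol r hr]
    refine integral_sq_sum_cos hφ fun i j hij hk => ?_
    rcases horth i j hij hk with h | h
    · exact Or.inl (by linear_combination a i * a j * (h r).1)
    · exact Or.inr h
  have e2 : circleSq (polR ψ) r = ∑ i, (a i * deriv (F i) r) ^ 2 * modeNorm (k i) := by
    simp only [circleSq, hpolR]
    refine integral_sq_sum_cos hφ fun i j hij hk => ?_
    rcases horth i j hij hk with h | h
    · exact Or.inl (by linear_combination a i * a j * (h r).2)
    · exact Or.inr h
  have e3 : circleSq (polA ψ) r = ∑ i, (-(a i * F i r * k i)) ^ 2 * modeNorm (k i) := by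
    simp only [circleSq, hpolA]
    refine integral_sq_sum_sin (fun i h => by simp [h]) fun i j hij hk => ?_
    rcases horth i j hij hk with h | h
    · exact Or.inl (by linear_combination a i * a j * k i * k j * (h r).1)
    · exact Or.inr h
  rw [radialDensity, e1, e2, e3, Finset.mul_sum, Finset.mul_sum, Finset.sum_div, Finset.sum_div,
    ← Finset.sum_add_distrib, ← Finset.sum_sub_distrib]
  exact Finset.sum_congr rfl fun i _ => by ring

/-- A finite orthogonal family of negative modes bounds the Morse index from below. -/
lemma card_mem_morseSet {α p : ℝ} {u : E2 → ℝ} {W : ℝ → ℝ}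
    (hQ : ∀ ψ : E2 → ℝ, ContDiff ℝ 1 ψ →
      quadForm α p u ψ = ∫ r in (0 : ℝ)..1, radialDensity W ψ r)
    (hW : ContinuousOn (fun r => W r / r) (Set.Icc 0 1)) {F : ι → ℝ → ℝ} {f₀ a₂ b₂ : ι → ℝ}
    (hF : ∀ i, ContDiff ℝ (⊤ : ℕ∞) (F i)) (ha : ∀ i, 0 < a₂ i) (hb : ∀ i, b₂ i < 1)
    (hFa : ∀ i, ∀ r ≤ a₂ i, F i r = f₀ i) (hFb : ∀ i r, b₂ i ≤ r → F i r = 0)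
    (hf₀ : ∀ i, k i ≠ 0 → f₀ i = 0) (hφ : ∀ i, k i = 0 → φ i = 0)
    (horth : ∀ i j, i ≠ j → k i = k j →
      (∀ r, F i r * F j r = 0 ∧ deriv (F i) r * deriv (F j) r = 0) ∨
        (k i ≠ 0 ∧ cos (φ i - φ j) = 0))
    (hneg : ∀ i, ∫ r in (0 : ℝ)..1,
      (r * deriv (F i) r ^ 2 + ((k i : ℝ) ^ 2 - W r) / r * F i r ^ 2) < 0) :
    Fintype.card ι ∈ morseSet α p u := by
  set ψ : ι → E2 → ℝ := fun i => modeFn (F i) (k i) (φ i) with hψ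
  have hs : ∀ a : ι → ℝ, ContDiff ℝ (⊤ : ℕ∞) (∑ i, a i • ψ i) := fun a => by
    have : ContDiff ℝ (⊤ : ℕ∞) fun x => ∑ i, a i • ψ i x :=
      ContDiff.sum fun i _ => (contDiff_modeFn (hF i) (ha i) (hFa i) (hf₀ i) (φ i)).const_smul _
    convert this using 1
    ext x
    simp
  have hInt : ∀ i, IntervalIntegrable (fun r => r * deriv (F i) r ^ 2 +
      ((k i : ℝ) ^ 2 - W r) / r * F i r ^ 2) volume 0 1 := fun i => by
    have hc := (hF i).continuous
    have hd : Continuous (deriv (F i)) := (hF i).continuous_deriv (by simp)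
    have h1 : ContinuousOn (fun r => (k i : ℝ) ^ 2 * F i r ^ 2 / r) (Set.Icc 0 1) := by
      rcases eq_or_ne (k i) 0 with h0 | h0
      · simp only [h0, Nat.cast_zero, ne_eq, OfNat.ofNat_ne_zero, not_false_eq_true, zero_pow,
          zero_mul, zero_div]
        exact continuousOn_const
      · have h2 : Continuous fun r => (k i : ℝ) ^ 2 * F i r ^ 2 / max r (a₂ i) :=
          (continuous_const.mul (hc.pow 2)).div (by fun_prop) fun r =>
            ((ha i).trans_le (le_max_right _ _)).ne'
        refine h2.continuousOn.congr fun r _ => ?_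
        rcases le_total r (a₂ i) with h3 | h3
        · simp [hFa i r h3, hf₀ i h0]
        · simp only [max_eq_left h3]
    have h2 : ContinuousOn (fun r => r * deriv (F i) r ^ 2 +
        ((k i : ℝ) ^ 2 - W r) / r * F i r ^ 2) (Set.Icc 0 1) := by
      refine (((by fun_prop : Continuous fun r => r * deriv (F i) r ^ 2).continuousOn.add
        h1).sub (hW.mul (hc.pow 2).continuousOn)).congr fun r _ => ?_
      simp only [Pi.add_apply, Pi.sub_apply, Pi.mul_apply, Pi.pow_apply]
      ring
    refine ContinuousOn.intervalIntegrable ?_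
    rwa [Set.uIcc_of_le zero_le_one]
  have hquad : ∀ a : ι → ℝ, quadForm α p u (∑ i, a i • ψ i) =
      ∑ i, a i ^ 2 * modeNorm (k i) * ∫ r in (0 : ℝ)..1,
        (r * deriv (F i) r ^ 2 + ((k i : ℝ) ^ 2 - W r) / r * F i r ^ 2) := fun a => by
    have hs1 : ContDiff ℝ 1 (∑ i, a i • ψ i) := (hs a).of_le (by exact_mod_cast le_top)
    rw [hQ _ hs1]
    simp only [← intervalIntegral.integral_const_mul]
    rw [← intervalIntegral.integral_finsetSum fun i _ => (hInt i).const_mul _,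
      intervalIntegral.integral_of_le zero_le_one, intervalIntegral.integral_of_le zero_le_one]
    exact setIntegral_congr_fun measurableSet_Ioc fun r hr =>
      radialDensity_sum_modeFn hF hφ horth a hs1 W hr.1
  have hquad_neg : ∀ a : ι → ℝ, a ≠ 0 → quadForm α p u (∑ i, a i • ψ i) < 0 := fun a ha0 => by
    obtain ⟨j, hj⟩ := Function.ne_iff.1 ha0
    rw [hquad]
    refine Finset.sum_neg' (fun i _ => ?_) ⟨j, Finset.mem_univ j, ?_⟩
    · exact mul_nonpos_of_nonneg_of_nonpos (mul_nonneg (sq_nonneg _) (modeNorm_pos _).le)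
        (hneg i).le
    · exact mul_neg_of_pos_of_neg (mul_pos (sq_pos_of_ne_zero hj) (modeNorm_pos _)) (hneg j)
  have hΦ : ∀ a, Fintype.linearCombination ℝ ψ a = ∑ i, a i • ψ i := fun a =>
    Fintype.linearCombination_apply ..
  refine ⟨LinearMap.range (Fintype.linearCombination ℝ ψ), ?_, ?_, ?_⟩
  · rw [LinearMap.finrank_range_of_inj, Module.finrank_fintype_fun_eq_card]
    rw [← LinearMap.ker_eq_bot, LinearMap.ker_eq_bot']
    intro a h
    by_contra h0
    have h1 := hquad_neg a h0
    rw [← hΦ, h] at h1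
    simp [quadForm] at h1
  · rintro _ ⟨a, rfl⟩
    rw [hΦ]
    obtain ⟨B, hB, hB1⟩ := ((Filter.eventually_all.2 fun i => Ico_mem_nhdsLT (hb i)).and
      self_mem_nhdsWithin).exists
    have hsupp : tsupport (∑ i, a i • ψ i) ⊆ closedBall 0 B := by
      refine closure_minimal (fun x hx => ?_) isClosed_closedBall
      by_contra hxB
      rw [mem_closedBall_zero_iff, not_le] at hxB
      refine hx ?_
      simp only [Finset.sum_apply, Pi.smul_apply, smul_eq_mul]
      refine Finset.sum_eq_zero fun i _ => ?_
      simp only [hψ, modeFn, hFb i _ ((hB i).1.trans hxB.le)]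
      simp
    exact ⟨hs a, HasCompactSupport.of_support_subset_isCompact (isCompact_closedBall 0 B)
      (subset_closure.trans hsupp), hsupp.trans (closedBall_subset_ball hB1)⟩
  · rintro _ ⟨a, rfl⟩ h0
    rw [hΦ] at h0 ⊢
    refine hquad_neg a fun h => h0 ?_
    simp [h]

end

lemma HasNegMode.mono {m a b : ℝ} {W : ℝ → ℝ} {Z Z' : Prop} (H : HasNegMode m W a b Z)
    (h : Z' → Z) : HasNegMode m W a b Z' := by
  obtain ⟨F, f₀, a₂, b₂, h1, h2, h3, h4⟩ := H
  exact ⟨F, f₀, a₂, b₂, h1, h2, fun hz => h3 (h hz), h4⟩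

/-- The two nodal zones give two radial negative modes with disjoint supports. -/
lemma TwoZonePair.exists_hasNegMode {α p c : ℝ} {w d : ℝ → ℝ} (hα : 0 ≤ α)
    (H : TwoZonePair p c w d) : ∃ ρ ∈ Set.Ioo (0 : ℝ) 1,
      HasNegMode 0 (weight α p c w) 0 ρ False ∧ HasNegMode 0 (weight α p c w) ρ 1 True := by
  have hκ : 0 < (2 + α) / 2 := by positivity
  obtain ⟨σ, hσ, hwσ, huniq⟩ := H.exists_zero
  have hc := H.pos
  have hzero := @LaneEmdenPair.hasNegMode_zero α p c w d hα H.toLaneEmdenPair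
  set κ := (2 + α) / 2
  have hσc : σ / c ∈ Set.Ioo (0 : ℝ) 1 := ⟨div_pos hσ.1 hc, (div_lt_one hc).2 hσ.2⟩
  set ρ := (σ / c) ^ κ⁻¹ with hρ
  have hρ0 : 0 < ρ := Real.rpow_pos_of_pos hσc.1 _
  have hρ1 : ρ < 1 := Real.rpow_lt_one hσc.1.le hσc.2 (inv_pos.2 hκ)
  have hcρ : c * ρ ^ κ = σ := by
    rw [hρ, Real.rpow_inv_rpow hσc.1.le hκ.ne']
    field_simp
  have hlt : ∀ {r s : ℝ}, 0 ≤ r → r < s → c * r ^ κ < c * s ^ κ := fun hr hrs =>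
    mul_lt_mul_of_pos_left (Real.rpow_lt_rpow hr hrs hκ) hc
  have hw1 : ∀ t ∈ Set.Ico 0 σ, 0 < w t := by
    refine pos_of_ne_zero_of_preconnected isPreconnected_Ico
      (H.cont.mono fun t ht => ⟨ht.1, (ht.2.trans hσ.2).le⟩) (fun t ht h0 => ?_)
      ⟨le_rfl, hσ.1⟩ (by rw [H.init]; exact one_pos)
    rcases ht.1.eq_or_lt with rfl | h1
    · exact one_ne_zero (H.init.symm.trans h0)
    · exact ht.2.ne (huniq t ⟨h1, ht.2.trans hσ.2⟩ h0)
  have hw2 : ∀ t ∈ Set.Ioo σ c, w t ≠ 0 := fun t ht h0 =>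
    ht.1.ne' (huniq t ⟨hσ.1.trans ht.1, ht.2⟩ h0)
  obtain ⟨t₀, ht₀⟩ := exists_between hσ.2
  obtain ⟨e, he, he0⟩ : ∃ e : ℝ, |e| = 1 ∧ 0 < e * w t₀ := by
    rcases lt_or_gt_of_ne (hw2 t₀ ht₀) with h | h
    · exact ⟨-1, by simp, by linarith⟩
    · exact ⟨1, by simp, by linarith⟩
  have hw3 : ∀ t ∈ Set.Ioo σ c, 0 < e * w t := by
    refine pos_of_ne_zero_of_preconnected isPreconnected_Ioo
      (continuousOn_const.mul (H.cont.mono fun t ht => ⟨(hσ.1.trans ht.1).le, ht.2.le⟩))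
      (fun t ht => mul_ne_zero (fun h => by simp [h] at he) (hw2 t ht)) ht₀ he0
  refine ⟨ρ, ⟨hρ0, hρ1⟩, ?_, ?_⟩
  · refine (hzero (a := 0) (b := ρ) (e := 1) le_rfl hρ0 hρ1.le (by simp) (fun r hr => ?_)
      (by rw [hcρ, hwσ]) (Or.inr ⟨rfl, rfl⟩)).mono False.elim
    rw [one_mul]
    refine hw1 _ ⟨mul_nonneg hc.le (Real.rpow_nonneg hr.1.le _), ?_⟩
    rw [← hcρ]
    exact hlt hr.1.le hr.2
  · refine (hzero (a := ρ) (b := 1) (e := e) hρ0.le hρ1 le_rfl he (fun r hr => ?_)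
      (by rw [Real.one_rpow, mul_one, H.apply_right]) (Or.inl (by rw [hcρ, hwσ]))).mono
      fun _ => by rw [hcρ, hwσ]
    refine hw3 _ ⟨?_, (mul_rpow_mem_Ioo hc hκ ⟨hρ0.trans hr.1, hr.2⟩).2⟩
    rw [← hcρ]
    exact hlt hρ0.le hr.1

/-- Two radial modes and two modes for each angular frequency `1, …, K`. -/
lemma TwoZonePair.mem_morseSet {α p c : ℝ} {w d : ℝ → ℝ} {u : E2 → ℝ} (hα : 0 ≤ α)
    (H : TwoZonePair p c w d)
    (hu : ∀ x ∈ closedBall (0 : E2) 1, |u x| ^ (p - 1) =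
      ((2 + α) / 2) ^ 2 * c ^ 2 * |w (c * ‖x‖ ^ ((2 + α) / 2))| ^ (p - 1)) {K : ℕ}
    (hK : ∀ k : ℕ, 1 ≤ k → k ≤ K → HasNegMode ((k : ℝ) ^ 2) (weight α p c w) 0 1 True) :
    2 + 2 * K ∈ morseSet α p u := by
  obtain ⟨ρ, hρ, hin, hout⟩ := H.exists_hasNegMode hα
  have hmode : ∀ i : Fin (K + 1) × Bool, HasNegMode (((i.1 : ℕ) : ℝ) ^ 2) (weight α p c w)
      (if i.1 = 0 ∧ i.2 = true then ρ else 0) (if i.1 = 0 ∧ i.2 = false then ρ else 1)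
      (i.1 ≠ 0 ∨ i.2 = true) := by
    rintro ⟨k, b⟩
    rcases eq_or_ne k 0 with rfl | hk
    · cases b
      · simpa using hin
      · simpa using hout
    · have h := hK k (Nat.one_le_iff_ne_zero.2 (Fin.val_ne_zero_iff.2 hk)) k.is_le
      simpa [hk] using h
  choose F f₀ a₂ b₂ ha hb hf₀ hF hFa hFb hneg using hmode
  have hQ : ∀ ψ : E2 → ℝ, ContDiff ℝ 1 ψ →
      quadForm α p u ψ = ∫ r in (0 : ℝ)..1, radialDensity (weight α p c w) ψ r := fun ψ hψ =>
    quadForm_eq_integral hα hψ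
      (continuousOn_const.mul (H.continuousOn_abs_rpow (by positivity))) hu
  have ha0 : ∀ i, 0 < a₂ i := fun i => lt_of_le_of_lt (by split_ifs <;> linarith [hρ.1]) (ha i)
  have hb1 : ∀ i, b₂ i < 1 := fun i =>
    lt_of_lt_of_le (hb i) (by split_ifs <;> linarith [hρ.2])
  have hdisj : ∀ r, (F (0, false) r = 0 ∧ deriv (F (0, false)) r = 0) ∨
      (F (0, true) r = 0 ∧ deriv (F (0, true)) r = 0) := fun r => by
    have h1 : b₂ (0, false) < ρ := by simpa using hb (0, false)
    have h2 : ρ < a₂ (0, true) := by simpa using ha (0, true)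
    have h3 : f₀ (0, true) = 0 := hf₀ (0, true) (Or.inr rfl)
    rcases lt_or_ge (b₂ (0, false)) r with h | h
    · refine Or.inl ⟨hFb _ r h.le, ?_⟩
      have : F (0, false) =ᶠ[𝓝 r] fun _ => 0 := by
        filter_upwards [lt_mem_nhds h] with s hs using hFb _ s hs.le
      simpa using this.deriv_eq
    · have h4 : r < a₂ (0, true) := by linarith
      refine Or.inr ⟨(hFa _ r h4.le).trans h3, ?_⟩
      have : F (0, true) =ᶠ[𝓝 r] fun _ => 0 := by
        filter_upwards [gt_mem_nhds h4] with s hs using (hFa _ s hs.le).trans h3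
      simpa using this.deriv_eq
  have hcard := card_mem_morseSet (k := fun i : Fin (K + 1) × Bool => (i.1 : ℕ))
    (φ := fun i => if i.1 = 0 then 0 else if i.2 = true then π / 2 else 0) hQ
    (H.continuousOn_weight_div hα) hF ha0 hb1 hFa hFb
    (fun i h => hf₀ i (Or.inl (Fin.val_ne_zero_iff.1 h)))
    (fun i h => if_pos (Fin.val_eq_zero_iff.1 h)) ?_ hneg
  · have e : Fintype.card (Fin (K + 1) × Bool) = 2 + 2 * K := by
      simp only [Fintype.card_prod, Fintype.card_fin, Fintype.card_bool]
      ring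
    rwa [e] at hcard
  · rintro ⟨k, b⟩ ⟨l, b'⟩ hne hkl
    obtain rfl : k = l := Fin.ext hkl
    rcases eq_or_ne k 0 with rfl | hk
    · left
      intro r
      cases b <;> cases b'
      · exact absurd rfl hne
      · rcases hdisj r with h | h <;> simp [h]
      · rcases hdisj r with h | h <;> simp [h]
      · exact absurd rfl hne
    · right
      refine ⟨Fin.val_ne_zero_iff.2 hk, ?_⟩
      cases b <;> cases b'
      · exact absurd rfl hne
      · simp [hk]
      · simp [hk]
      · exact absurd rfl hne

/-- Near `p = 1`, every two-zone profile has negative modes at all frequencies below the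
critical one. -/
lemma exists_forall_hasNegMode {α β z : ℝ} (hα : 0 ≤ α) (hβ : 0 < β) (hz : IsNthZero β 1 z)
    (K : ℕ) (hK : (K : ℝ) < (2 + α) / 2 * β) : ∃ ε > 0, ∀ (p c : ℝ) (w d : ℝ → ℝ),
      LaneEmdenPair p c w d → z ≤ c →
      ∫ r in (0 : ℝ)..1, (1 - |w (c * r ^ ((2 + α) / 2))| ^ (p - 1)) ≤ ε →
      ∀ k : ℕ, 1 ≤ k → k ≤ K → HasNegMode ((k : ℝ) ^ 2) (weight α p c w) 0 1 True := by
  induction K with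
  | zero => exact ⟨1, one_pos, fun p c w d _ _ _ k h1 h2 => by omega⟩
  | succ K ih =>
    have hK' : (K : ℝ) + 1 < (2 + α) / 2 * β := by exact_mod_cast hK
    obtain ⟨ε₁, hε₁, h₁⟩ := ih (by linarith)
    obtain ⟨ε₂, hε₂, h₂⟩ := exists_hasNegMode (k := (K : ℝ) + 1) hα hβ hz
      (by linarith [K.cast_nonneg (α := ℝ)]) hK'
    refine ⟨min ε₁ ε₂, lt_min hε₁ hε₂, fun p c w d H hc hInt k h1 h2 => ?_⟩
    rcases Nat.lt_or_ge K k with h | h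
    · obtain rfl : k = K + 1 := by omega
      rw [Nat.cast_add_one]
      exact h₂ p c w d H hc (hInt.trans (min_le_right _ _))
    · exact h₁ p c w d H hc (hInt.trans (min_le_left _ _)) k h1 h

/-- in dimension 2, if `z_1(β) = z_2(0)` and `(2+α)β/2 ∉ ℤ`, then for `p`
close to 1 every radial solution with two nodal zones has Morse index `2⌈(2+α)β/2⌉`. -/
theorem stmt_8 (α : ℝ) (hα : 0 ≤ α) (β : ℝ) (hβ : 0 < β)
    (hzz : ∃ zval : ℝ, IsNthZero β 1 zval ∧ IsNthZero 0 2 zval)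
    (hnonint : ∀ j : ℤ, (2 + α) * β / 2 ≠ (j : ℝ)) :
    ∃ pbar : ℝ, 1 < pbar ∧ ∀ p ∈ Set.Ioo (1 : ℝ) pbar, ∀ u : E2 → ℝ,
      IsRadialNodalSol α p 2 u →
      IsGreatest (morseSet α p u) (2 * (⌈(2 + α) * β / 2⌉).toNat) := by
  obtain ⟨z, hz₁, hz₂⟩ := hzz
  have hs : (2 + α) / 2 * β = (2 + α) * β / 2 := by ring
  have hs0 : 0 < (2 + α) / 2 * β := by positivity
  obtain ⟨K, hK, hK'⟩ : ∃ K : ℕ, (K : ℝ) < (2 + α) / 2 * β ∧ (2 + α) / 2 * β < K + 1 :=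
    ⟨⌊(2 + α) / 2 * β⌋₊, (Nat.floor_le hs0.le).lt_of_ne
      fun h => hnonint ⌊(2 + α) / 2 * β⌋₊ (by rw [← hs, Int.cast_natCast, h]),
      Nat.lt_floor_add_one _⟩
  have hceil : 2 * (⌈(2 + α) * β / 2⌉).toNat = 2 + 2 * K := by
    have : ⌈(2 + α) * β / 2⌉ = (K : ℤ) + 1 := by
      rw [Int.ceil_eq_iff, ← hs]
      push_cast
      exact ⟨by linarith, hK'.le⟩
    rw [this]
    omega
  rw [hceil]
  obtain ⟨η, hη, hle⟩ := exists_morseSet_le hα hβ hz₁ hz₂ hK'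
  obtain ⟨ε₁, hε₁, hmode⟩ := exists_forall_hasNegMode hα hβ hz₁ K hK
  obtain ⟨δ, hδ, hnear⟩ : ∃ δ > 0, ∀ p c : ℝ, 1 < p → p < 1 + δ → z ≤ c → c ≤ z + δ →
      p * c ^ 2 ≤ z ^ 2 + η := by
    have hlim : Tendsto (fun δ : ℝ => (1 + δ) * (z + δ) ^ 2) (𝓝[>] 0) (𝓝 (z ^ 2)) := by
      have : ContinuousAt (fun δ : ℝ => (1 + δ) * (z + δ) ^ 2) 0 := by fun_prop
      simpa using this.tendsto.mono_left nhdsWithin_le_nhds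
    obtain ⟨δ, hδη, hδ⟩ := ((hlim.eventually_lt_const
      (lt_add_of_pos_right (z ^ 2) hη)).and self_mem_nhdsWithin).exists
    refine ⟨δ, hδ, fun p c hp hpδ hzc hcδ => ?_⟩
    have hc0 : 0 ≤ c := hz₁.1.le.trans hzc
    calc p * c ^ 2 ≤ (1 + δ) * (z + δ) ^ 2 := by gcongr
      _ ≤ z ^ 2 + η := hδη.le
  have hκ : 0 < (2 + α) / 2 := by positivity
  obtain ⟨q, hq, hlimit⟩ := twoZonePair_limit hz₂ hκ (lt_min hε₁ hδ)
  refine ⟨min q (1 + δ), lt_min hq (by linarith), fun p hp u hu => ?_⟩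
  obtain ⟨c, w, d, H, hwc, hzero, hform⟩ := exists_laneEmdenPair hα hp.1 hu
  have H' : TwoZonePair p c w d := ⟨H, hwc, hzero⟩
  obtain ⟨hzc, hcz, hInt⟩ := hlimit p ⟨hp.1, hp.2.trans_le (min_le_left _ _)⟩ c w d H'
  refine ⟨H'.mem_morseSet hα hform
    (hmode p c w d H hzc (hInt.trans (min_le_left _ _))), ?_⟩
  exact hle p c w d u H (hnear p c hp.1 (hp.2.trans_le (min_le_right _ _)) hzc
    (hcz.trans (by gcongr; exact min_le_right _ _))) hform
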